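/- arXiv:1806.09585 — 2 statements merged into one kernel-verified Lean document; each statement's English description precedes it below -/
import Mathlib

section
/- The Hausdorff dimension of the graph {(x, W(x)) : x ∈ [0,1]} ⊂ ℝ × ℝ² of the two-dimensional Weierstrass function W is at least 2. -/
open Real MeasureTheory Set Filter

noncomputable section

/-- The Euclidean plane. -/
abbrev E2 : Type := EuclideanSpace ℝ (Fin 2)

/-- The unit vector `(cos t, sin t)` in the Euclidean plane. -/
def cs (t : ℝ) : E2 := (WithLp.equiv 2 (Fin 2 → ℝ)).symm ![Real.cos t, Real.sin t]

/-- The vector `(-sin t, cos t)` in the Euclidean plane. -/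
def cs' (t : ℝ) : E2 := (WithLp.equiv 2 (Fin 2 → ℝ)).symm ![-Real.sin t, Real.cos t]

/-- The two-dimensional Weierstrass function
`W(x) = ∑_{n≥0} 2^{-n/2} (cos (2π 2^n x), sin (2π 2^n x))`. -/
def Wfn (x : ℝ) : E2 := ∑' n : ℕ, (2 : ℝ) ^ (-(n : ℝ) / 2) • cs (2 * π * 2 ^ n * x)

/-- `dig j ξ` is the `j`-th binary digit of `ξ`: `⌊2^j ξ⌋ mod 2` (as a real number). -/
def dig (j : ℕ) (ξ : ℝ) : ℝ := ((⌊(2 : ℝ) ^ j * ξ⌋ % 2 : ℤ) : ℝ)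

/-- `rho n ξ = ∑_{i=1}^n d_{n+1-i}(ξ) 2^{-i}`. -/
def rho (n : ℕ) (ξ : ℝ) : ℝ := ∑ i ∈ Finset.Icc 1 n, dig (n + 1 - i) ξ / 2 ^ i

/-- `x` is a dyadic rational. -/
def dyadic (x : ℝ) : Prop := ∃ (k : ℕ) (m : ℤ), x = (m : ℝ) / 2 ^ k

/-- The stable-direction function
`S(ξ,x) = -2π ∑_{n≥1} 2^{-n/2} (-sin (2π(ρ_n(ξ)+x/2^n)), cos (2π(ρ_n(ξ)+x/2^n)))`. -/
def Sfn (ξ x : ℝ) : E2 :=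
  (-(2 * π)) • ∑' n : ℕ,
    (2 : ℝ) ^ (-((n : ℝ) + 1) / 2) • cs' (2 * π * (rho (n + 1) ξ + x / 2 ^ (n + 1)))

/-- The function `H` given by the doubly infinite series
`H(ξ,x) = ∑_{n≥0} 2^{-n/2} ((cos,sin)(2π 2^n x) - (1,0))
        + ∑_{k≥1} 2^{k/2} ((cos,sin)(2π(ρ_k(ξ)+x/2^k)) - (cos,sin)(2π ρ_k(ξ)))`. -/
def Hfn (ξ x : ℝ) : E2 :=
  (∑' n : ℕ, (2 : ℝ) ^ (-(n : ℝ) / 2) •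
      (cs (2 * π * 2 ^ n * x) - (WithLp.equiv 2 (Fin 2 → ℝ)).symm ![1, 0]))
  + ∑' k : ℕ, (2 : ℝ) ^ (((k : ℝ) + 1) / 2) •
      (cs (2 * π * (rho (k + 1) ξ + x / 2 ^ (k + 1))) - cs (2 * π * rho (k + 1) ξ))

/-- The baker transformation `B(ξ,x) = (2ξ mod 1, (⌊2ξ⌋ + x)/2)`. -/
def baker (p : ℝ × ℝ) : ℝ × ℝ :=
  (Int.fract (2 * p.1), ((⌊2 * p.1⌋ : ℝ) + p.2) / 2)

/-- The unit square `[0,1)²`. -/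
def usq : Set (ℝ × ℝ) := Ico (0:ℝ) 1 ×ˢ Ico (0:ℝ) 1

/-- The explicit formula for the `N`-th backward iterate of the baker transformation:
`B^{-N}(ξ,x) = (ξ/2^N + ∑_{j=1}^N d_j(x) 2^{-(N+1-j)}, 2^N x mod 1)`. -/
def bakerInvN (N : ℕ) (p : ℝ × ℝ) : ℝ × ℝ :=
  (p.1 / 2 ^ N + ∑ j ∈ Finset.Icc 1 N, dig j p.2 / 2 ^ (N + 1 - j),
    Int.fract ((2 : ℝ) ^ N * p.2))

lemma sum_range_mul_eq {M : Type*} [AddCommMonoid M] (f : ℕ → M) (m n : ℕ) :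
    ∑ g ∈ Finset.range (m * n), f g
      = ∑ b ∈ Finset.range n, ∑ a ∈ Finset.range m, f (a + m * b) := by
  induction n with
  | zero => simp
  | succ n ih =>
    rw [Nat.mul_succ, Finset.sum_range_add, ih, Finset.sum_range_succ]
    simp [add_comm]

/-- A finite set of integers of diameter at most `R` has at most `R + 1` elements. -/
lemma card_le_of_pairwise_dist_le (F : Finset ℤ) {R : ℝ} (hR : 0 ≤ R)
    (h : ∀ a ∈ F, ∀ b ∈ F, |(a : ℝ) - b| ≤ R) : (F.card : ℝ) ≤ R + 1 := by
  rcases F.eq_empty_or_nonempty with rfl | hne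
  · simp; linarith
  · have hsub : F ⊆ Finset.Icc (F.min' hne) (F.max' hne) := fun x hx =>
      Finset.mem_Icc.2 ⟨F.min'_le x hx, F.le_max' x hx⟩
    have h1 := Finset.card_le_card hsub
    rw [Int.card_Icc] at h1
    have h2 := h _ (F.max'_mem hne) _ (F.min'_mem hne)
    have h3 : F.min' hne ≤ F.max' hne := F.min'_le_max' hne
    have h4 : (F.card : ℤ) ≤ F.max' hne + 1 - F.min' hne := by omega
    have h5 : (F.card : ℝ) ≤ (F.max' hne : ℝ) + 1 - F.min' hne := by exact_mod_cast h4
    have := le_abs_self ((F.max' hne : ℝ) - F.min' hne)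
    linarith

lemma norm_exp_mul_I_sub_le (x y : ℝ) :
    ‖Complex.exp (x * Complex.I) - Complex.exp (y * Complex.I)‖ ≤ |x - y| := by
  have h := Real.norm_exp_I_mul_ofReal_sub_one_le (x := x - y)
  have : Complex.exp (x * Complex.I) - Complex.exp (y * Complex.I)
      = Complex.exp (y * Complex.I) * (Complex.exp (Complex.I * ((x - y : ℝ) : ℂ)) - 1) := by
    rw [mul_sub, ← Complex.exp_add, mul_one]
    congr 2
    push_cast; ring
  rw [this, norm_mul, Complex.norm_exp_ofReal_mul_I, one_mul]
  simpa using h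

/-- The bound for a geometric sum of unit complex numbers. -/
lemma norm_geom_exp_le (α : ℝ) (hα : α ≠ 0) (hπ : |α| ≤ π) (B : ℕ) :
    ‖∑ a ∈ Finset.range B, Complex.exp ((α * a : ℝ) * Complex.I)‖ ≤ π / |α| := by
  have hα0 : 0 < |α| := abs_pos.2 hα
  have hlow : 2 * |α| / π ≤ ‖Complex.exp (α * Complex.I) - 1‖ := by
    have h1 := Complex.norm_exp_I_mul_ofReal_sub_one (x := α)
    rw [mul_comm (α : ℂ), h1, norm_mul, Real.norm_eq_abs, Real.norm_eq_abs,
      abs_of_pos (by norm_num : (0:ℝ) < 2)]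
    have h2 : |sin (α / 2)| = sin (|α| / 2) := by
      rcases le_or_gt 0 α with h | h
      · rw [abs_of_nonneg h, abs_of_nonneg]
        rw [abs_of_nonneg h] at hπ
        exact sin_nonneg_of_nonneg_of_le_pi (by linarith) (by linarith)
      · rw [abs_of_neg h] at hπ ⊢
        rw [show -α / 2 = -(α / 2) by ring, sin_neg, abs_of_nonpos]
        have := sin_nonneg_of_nonneg_of_le_pi (x := -(α/2)) (by linarith) (by linarith)
        rw [sin_neg] at this; linarith
    rw [h2]
    have h3 := Real.mul_le_sin (x := |α| / 2) (by linarith) (by linarith)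
    calc 2 * |α| / π = 2 * (2 / π * (|α| / 2)) := by ring
      _ ≤ _ := by linarith
  have hne : Complex.exp (α * Complex.I) ≠ 1 := by
    intro h
    rw [h, sub_self, norm_zero] at hlow
    have : 0 < 2 * |α| / π := by positivity
    linarith
  have hsum : ∑ a ∈ Finset.range B, Complex.exp ((α * a : ℝ) * Complex.I)
      = ∑ a ∈ Finset.range B, (Complex.exp (α * Complex.I)) ^ a := by
    refine Finset.sum_congr rfl fun a _ => ?_
    rw [← Complex.exp_nat_mul]; congr 1; push_cast; ring
  rw [hsum, geom_sum_eq hne, norm_div]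
  have hnum : ‖Complex.exp (α * Complex.I) ^ B - 1‖ ≤ 2 := by
    refine (norm_sub_le _ _).trans ?_
    rw [norm_pow, Complex.norm_exp_ofReal_mul_I]; norm_num
  have hpos : 0 < 2 * |α| / π := by positivity
  calc _ ≤ 2 / (2 * |α| / π) := by gcongr
    _ = π / |α| := by field_simp

/-- Kusmin–Landau type bound on a short block, by linearisation of the phase. -/
lemma norm_block_le {h h' h'' : ℝ → ℝ} (hd : ∀ v, HasDerivAt h (h' v) v)
    (hd' : ∀ v, HasDerivAt h' (h'' v) v) {M μ n v : ℝ} (hM : ∀ v, |h'' v| ≤ M)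
    (hn : 0 < n) (hμ : 0 < μ) (h1 : μ ≤ |h' v|) (h2 : |h' v| ≤ π * n) (B : ℕ) :
    ‖∑ a ∈ Finset.range B, Complex.exp (h (v + a / n) * Complex.I)‖
      ≤ B * (M * (B / n) ^ 2) + π * n / μ := by
  have hM0 : 0 ≤ M := (abs_nonneg _).trans (hM 0)
  have hlip : ∀ w, |h' w - h' v| ≤ M * |w - v| := fun w => by
    have := Convex.norm_image_sub_le_of_norm_hasDerivWithin_le (f := h') (f' := h'') (C := M)
      (s := univ) (x := v) (y := w) (fun x _ => (hd' x).hasDerivWithinAt)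
      (fun x _ => hM x) convex_univ (mem_univ _) (mem_univ _)
    simpa using this
  have htay : ∀ x : ℝ, 0 ≤ x → |h (v + x) - (h v + h' v * x)| ≤ M * x ^ 2 := fun x hx => by
    have := Convex.norm_image_sub_le_of_norm_hasDerivWithin_le
      (f := fun y => h y - h' v * y) (f' := fun y => h' y - h' v) (C := M * x)
      (s := Icc v (v + x)) (x := v) (y := v + x)
      (fun y _ => ((hd y).sub (by simpa using (hasDerivAt_id y).const_mul (h' v))).hasDerivWithinAt)
      (fun y hy => by
        refine (hlip y).trans ?_
        gcongr
        rw [abs_of_nonneg (by linarith [hy.1])]; linarith [hy.2])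
      (convex_Icc _ _) ⟨le_rfl, by linarith⟩ ⟨by linarith, le_rfl⟩
    simp only [Real.norm_eq_abs, add_sub_cancel_left, abs_of_nonneg hx] at this
    calc _ = |h (v + x) - h' v * (v + x) - (h v - h' v * v)| := by congr 1; ring
      _ ≤ _ := by rw [sq, ← mul_assoc]; exact this
  have hne : h' v ≠ 0 := fun h => by rw [h, abs_zero] at h1; linarith
  have hgeo : ‖∑ a ∈ Finset.range B,
      Complex.exp ((h v + h' v * (a / n) : ℝ) * Complex.I)‖ ≤ π * n / μ := by
    have : ∑ a ∈ Finset.range B, Complex.exp ((h v + h' v * (a / n) : ℝ) * Complex.I)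
      = Complex.exp (h v * Complex.I) *
        ∑ a ∈ Finset.range B, Complex.exp (((h' v / n) * a : ℝ) * Complex.I) := by
      rw [Finset.mul_sum]
      refine Finset.sum_congr rfl fun a _ => ?_
      rw [← Complex.exp_add]; congr 1; push_cast; ring
    rw [this, norm_mul, Complex.norm_exp_ofReal_mul_I, one_mul]
    refine (norm_geom_exp_le _ (by positivity) ?_ B).trans ?_
    · rw [abs_div, abs_of_pos hn, div_le_iff₀ hn]; exact h2
    · rw [abs_div, abs_of_pos hn]
      calc π / (|h' v| / n) = π * n / |h' v| := by field_simp
        _ ≤ _ := by gcongr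
  have hdiff : ‖∑ a ∈ Finset.range B, (Complex.exp (h (v + a / n) * Complex.I)
      - Complex.exp ((h v + h' v * (a / n) : ℝ) * Complex.I))‖ ≤ B * (M * (B / n) ^ 2) := by
    refine (norm_sum_le_of_le _ (f := _) (n := fun _ => M * (B / n) ^ 2) fun a ha => ?_).trans ?_
    · refine (norm_exp_mul_I_sub_le _ _).trans ((htay _ (by positivity)).trans ?_)
      have : (a : ℝ) ≤ B := by exact_mod_cast (Finset.mem_range.1 ha).le
      gcongr
    · simp
  rw [Finset.sum_sub_distrib] at hdiff
  have := norm_add_le (∑ a ∈ Finset.range B, Complex.exp (h (v + a / n) * Complex.I) -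
    ∑ a ∈ Finset.range B, Complex.exp ((h v + h' v * (a / n) : ℝ) * Complex.I))
    (∑ a ∈ Finset.range B, Complex.exp ((h v + h' v * (a / n) : ℝ) * Complex.I))
  rw [sub_add_cancel] at this
  linarith

/-- A van der Corput type estimate for phases with no simultaneous near-vanishing of the first
two derivatives. -/
lemma norm_expsum_le {h h' h'' : ℝ → ℝ} (hd : ∀ v, HasDerivAt h (h' v) v)
    (hd' : ∀ v, HasDerivAt h' (h'' v) v) {A₁ A₂ μ v₀ : ℝ} {B Q : ℕ} (hB : 0 < B) (hQ : 0 < Q)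
    (hA₂ : 0 < A₂) (hA : A₂ ≤ 4 * A₁) (hμ : 0 < μ) (hμA : μ ≤ A₁ / 10)
    (hM : ∀ v, |h'' v| ≤ 2 * A₂) (h1 : ∀ v, |h' v| ≤ π * (B * Q))
    (h2 : ∀ v, |h' v| ≤ 0.3 * A₁ → 0.3 * A₂ ≤ |h'' v|) :
    ‖∑ a ∈ Finset.range (B * Q), Complex.exp (h (v₀ + a / (B * Q)) * Complex.I)‖
      ≤ B * Q * (2 * A₂ / Q ^ 2 + π * Q / μ + 560 * μ / A₂ + 80 / Q) := by
  have hB' : (0:ℝ) < B := by exact_mod_cast hB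
  have hQ' : (0:ℝ) < Q := by exact_mod_cast hQ
  classical
  set bad : Finset ℕ := (Finset.range Q).filter fun q => |h' (v₀ + q / Q)| < μ with hbad
  have hcard : (bad.card : ℝ) ≤ 80 * (7 * μ / A₂ * Q + 1) := by
    have hmaps : ∀ q ∈ bad, 80 * q / Q ∈ Finset.range 80 := fun q hq => by
      simp only [hbad, Finset.mem_filter, Finset.mem_range] at hq ⊢
      rw [Nat.div_lt_iff_lt_mul hQ]; omega
    have key : ∀ j ∈ Finset.range 80,
        ((bad.filter fun q => 80 * q / Q = j).card : ℝ) ≤ 7 * μ / A₂ * Q + 1 := by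
      intro j _
      have := card_le_of_pairwise_dist_le
        ((bad.filter fun q => 80 * q / Q = j).map Nat.castEmbedding) (R := 7 * μ / A₂ * Q)
        (by positivity) ?_
      · simpa using this
      intro a ha b hb
      simp only [Finset.mem_map, Finset.mem_filter, Nat.castEmbedding_apply] at ha hb
      obtain ⟨x, ⟨hx, hxj⟩, rfl⟩ := ha
      obtain ⟨y, ⟨hy, hyj⟩, rfl⟩ := hb
      simp only [hbad, Finset.mem_filter] at hx hy
      wlog hxy : x < y generalizing x y
      · rcases eq_or_lt_of_le (not_lt.1 hxy) with h | h
        · subst h; simp; positivity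
        · rw [abs_sub_comm]; exact this y hyj x hxj hy hx h
      have hclose : (y : ℝ) / Q - x / Q ≤ 1 / 80 := by
        have e1 : 80 * y < (j + 1) * Q := by
          exact (Nat.div_lt_iff_lt_mul hQ).1 (by omega)
        have e2 : j * Q ≤ 80 * x := by rw [← hxj]; exact Nat.div_mul_le_self _ _
        have e1' : (80 : ℝ) * y < (j + 1) * Q := by exact_mod_cast e1
        have e2' : (j : ℝ) * Q ≤ 80 * x := by exact_mod_cast e2
        rw [← sub_div, div_le_iff₀ hQ']; linarith
      have hxy' : (x : ℝ) < y := by exact_mod_cast hxy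
      have hlt : v₀ + (x : ℝ) / Q < v₀ + y / Q := by gcongr
      obtain ⟨c, hc, hceq⟩ := exists_hasDerivAt_eq_slope h' h'' hlt
        (fun z _ => (hd' z).continuousAt.continuousWithinAt) (fun z _ => hd' z)
      have hc1 : |h' c| ≤ 0.3 * A₁ := by
        have := Convex.norm_image_sub_le_of_norm_hasDerivWithin_le (f := h') (f' := h'')
          (C := 2 * A₂) (s := univ) (x := v₀ + (x : ℝ) / Q) (y := c)
          (fun x _ => (hd' x).hasDerivWithinAt)
          (fun x _ => hM x) convex_univ (mem_univ _) (mem_univ _)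
        rw [Real.norm_eq_abs, Real.norm_eq_abs, abs_of_pos (sub_pos.2 hc.1)] at this
        have e3 : c - (v₀ + (x : ℝ) / Q) ≤ 1 / 80 := by linarith [hc.2]
        have e4 : 2 * A₂ * (c - (v₀ + (x : ℝ) / Q)) ≤ 2 * A₂ * (1 / 80) := by gcongr
        have e5 := abs_sub_abs_le_abs_sub (h' c) (h' (v₀ + (x : ℝ) / Q))
        linarith [hx.2]
      have hc2 := h2 c hc1
      have hgap : 0 < v₀ + (y : ℝ) / Q - (v₀ + x / Q) := by linarith
      rw [hceq, abs_div, abs_of_pos hgap, le_div_iff₀ hgap] at hc2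
      have e6 : |h' (v₀ + (y : ℝ) / Q) - h' (v₀ + x / Q)| ≤ 2 * μ := by
        refine (abs_sub _ _).trans ?_
        linarith [hx.2, hy.2]
      rw [abs_sub_comm, Int.cast_natCast, Int.cast_natCast, abs_of_pos (sub_pos.2 hxy')]
      have e7 : 0.3 * A₂ * ((y : ℝ) - x) ≤ 2 * μ * Q := by
        have : v₀ + (y : ℝ) / Q - (v₀ + x / Q) = (y - x) / Q := by ring
        rw [this, ← mul_div_assoc, div_le_iff₀ hQ'] at hc2
        exact hc2.trans (by gcongr)
      rw [div_mul_eq_mul_div, le_div_iff₀ hA₂]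
      nlinarith [mul_pos hμ hQ']
    rw [Finset.card_eq_sum_card_fiberwise hmaps]
    push_cast
    refine (Finset.sum_le_sum key).trans ?_
    simp [mul_add]
  rw [sum_range_mul_eq]
  have hblock : ∀ q ∈ Finset.range Q,
      ‖∑ a ∈ Finset.range B, Complex.exp (h (v₀ + ((a + B * q : ℕ) : ℝ) / (B * Q)) * Complex.I)‖
        ≤ (if q ∈ bad then (B : ℝ) else 0) +
          (B * (2 * A₂ * (B / (B * Q)) ^ 2) + π * (B * Q) / μ) := by
    intro q hq
    have hrew : ∀ a : ℕ, v₀ + ((a + B * q : ℕ) : ℝ) / (B * Q)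
        = (v₀ + (q : ℝ) / Q) + a / (B * Q) := fun a => by
      push_cast; field_simp; ring
    simp only [hrew]
    by_cases hqb : q ∈ bad
    · rw [if_pos hqb]
      have : ‖∑ a ∈ Finset.range B,
          Complex.exp (h ((v₀ + (q : ℝ) / Q) + a / (B * Q)) * Complex.I)‖ ≤ B := by
        refine (norm_sum_le_of_le _ (n := fun _ => 1) fun a _ => ?_).trans (by simp)
        rw [Complex.norm_exp_ofReal_mul_I]
      have : 0 ≤ (B * (2 * A₂ * ((B:ℝ) / (B * Q)) ^ 2) + π * (B * Q) / μ) := by positivity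
      linarith
    · rw [if_neg hqb, zero_add]
      refine norm_block_le hd hd' hM (by positivity) hμ ?_ (h1 _) B
      simp only [hbad, Finset.mem_filter, not_and, not_lt] at hqb
      exact hqb hq
  refine (norm_sum_le_of_le _ hblock).trans ?_
  rw [Finset.sum_add_distrib, ← Finset.sum_filter, Finset.sum_const, Finset.sum_const,
    nsmul_eq_mul, nsmul_eq_mul, Finset.card_range,
    Finset.filter_mem_eq_inter, Finset.inter_eq_right.2 (Finset.filter_subset _ _)]
  have : (bad.card : ℝ) * B ≤ 80 * (7 * μ / A₂ * Q + 1) * B := by gcongr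
  refine (add_le_add_left this _).trans (le_of_eq ?_)
  field_simp
  ring

/-- `wexp x = exp (2 π i x)`. -/
def wexp (x : ℝ) : ℂ := Complex.exp ((2 * π * x : ℝ) * Complex.I)

lemma norm_wexp (x : ℝ) : ‖wexp x‖ = 1 := Complex.norm_exp_ofReal_mul_I _

lemma wexp_add (x y : ℝ) : wexp (x + y) = wexp x * wexp y := by
  rw [wexp, wexp, wexp, ← Complex.exp_add]; congr 1; push_cast; ring

lemma wexp_int (n : ℤ) : wexp n = 1 := by
  rw [wexp, Complex.exp_eq_one_iff]; exact ⟨n, by push_cast; ring⟩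

lemma wexp_add_int (x : ℝ) (n : ℤ) : wexp (x + n) = wexp x := by
  rw [wexp_add, wexp_int, mul_one]

lemma wexp_half_odd {n : ℤ} (hn : Odd n) : wexp (n / 2) = -1 := by
  obtain ⟨k, rfl⟩ := hn
  rw [show ((2 * k + 1 : ℤ) : ℝ) / 2 = 1 / 2 + k by push_cast; ring, wexp_add_int, wexp]
  rw [← Complex.exp_pi_mul_I]; congr 1; push_cast; ring

lemma norm_wexp_sub_le (x y : ℝ) : ‖wexp x - wexp y‖ ≤ 2 * π * |x - y| := by
  refine (norm_exp_mul_I_sub_le _ _).trans (le_of_eq ?_)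
  rw [← mul_sub, abs_mul, abs_of_pos (by positivity : 0 < 2 * π)]

lemma hasDerivAt_wexp (x : ℝ) : HasDerivAt wexp (2 * π * Complex.I * wexp x) x := by
  have h1 : HasDerivAt (fun y : ℝ => ((2 * π * y : ℝ) : ℂ) * Complex.I)
      (((2 * π : ℝ) : ℂ) * Complex.I) x := by
    have := ((hasDerivAt_id x).const_mul (2 * π)).ofReal_comp.mul_const Complex.I
    simpa using this
  have := h1.cexp
  unfold wexp
  convert this using 1
  push_cast; ring

/-- The contraction ratio `2^{-1/2}`. -/
def sq2 : ℝ := (√2)⁻¹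

lemma sq2_pos : 0 < sq2 := by unfold sq2; positivity

lemma sq2_sq : sq2 ^ 2 = 1 / 2 := by unfold sq2; rw [inv_pow, Real.sq_sqrt (by norm_num)]; norm_num

lemma sq2_lt : sq2 < 0.7072 := by
  nlinarith [sq2_sq, sq2_pos]

lemma sq2_le_one : sq2 ≤ 1 := by linarith [sq2_lt]

lemma sq2_pow_two_mul (n : ℕ) : sq2 ^ (2 * n) = 1 / 2 ^ n := by
  rw [pow_mul, sq2_sq]; simp

/-- The trigonometric sum `∑_{i=1}^T 2^{-i/2} e(w / 2^i)`. -/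
def Xs (T : ℕ) (w : ℝ) : ℂ := ∑ i ∈ Finset.range T, (sq2 ^ (i + 1) : ℝ) * wexp (w / 2 ^ (i + 1))

lemma Xs_add (m T : ℕ) (w : ℝ) : Xs (m + T) w = Xs m w + (sq2 ^ m : ℝ) * Xs T (w / 2 ^ m) := by
  unfold Xs
  rw [Finset.sum_range_add, Finset.mul_sum]
  congr 1
  refine Finset.sum_congr rfl fun i _ => ?_
  rw [← mul_assoc, ← Complex.ofReal_mul, ← pow_add, div_div, ← pow_add, add_assoc]

lemma Xs_add_int_mul (m : ℕ) (w : ℝ) (b : ℤ) : Xs m (w + 2 ^ m * b) = Xs m w := by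
  unfold Xs
  refine Finset.sum_congr rfl fun i hi => ?_
  have hi' := Finset.mem_range.1 hi
  congr 1
  obtain ⟨k, rfl⟩ := Nat.exists_eq_add_of_le (Nat.succ_le_of_lt hi')
  have : (w + 2 ^ (i.succ + k) * b) / 2 ^ (i + 1) = w / 2 ^ (i + 1) + ((2 ^ k * b : ℤ) : ℝ) := by
    rw [Nat.succ_eq_add_one, pow_add _ (i + 1) k]; push_cast; field_simp
  rw [this, wexp_add_int]

/-- The `d`-th derivative in `v` of `Xs T (P + v) - Xs T (R + v)`. -/
def XsD (d T : ℕ) (P R : ℤ) (v : ℝ) : ℂ :=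
  ∑ i ∈ Finset.range T, (sq2 ^ (i + 1) : ℝ) * ((2 * π * Complex.I / 2 ^ (i + 1)) ^ d *
    (wexp ((P + v) / 2 ^ (i + 1)) - wexp ((R + v) / 2 ^ (i + 1))))

lemma hasDerivAt_XsD (d T : ℕ) (P R : ℤ) (v : ℝ) :
    HasDerivAt (XsD d T P R) (XsD (d + 1) T P R v) v := by
  unfold XsD
  refine HasDerivAt.fun_sum fun i _ => ?_
  have key : ∀ Z : ℤ, HasDerivAt (fun v : ℝ => wexp ((Z + v) / 2 ^ (i + 1)))
      ((2 * π * Complex.I / 2 ^ (i + 1)) * wexp ((Z + v) / 2 ^ (i + 1))) v := fun Z => by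
    have h1 : HasDerivAt (fun v : ℝ => ((Z : ℝ) + v) / 2 ^ (i + 1)) (1 / 2 ^ (i + 1)) v :=
      ((hasDerivAt_id v).const_add _).div_const _
    have := (hasDerivAt_wexp (((Z : ℝ) + v) / 2 ^ (i + 1))).scomp v h1
    refine this.congr_deriv ?_
    rw [Complex.real_smul]; push_cast; ring
  refine ((((key P).sub (key R)).const_mul ((2 * π * Complex.I / 2 ^ (i + 1)) ^ d)).const_mul
    ((sq2 ^ (i + 1) : ℝ) : ℂ)).congr_deriv ?_
  ring

/-- `XsD` is dominated by its first nonvanishing term. -/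
lemma XsD_sub_main_le (d T p : ℕ) (hp : p < T) (P R o : ℤ) (ho : Odd o)
    (hPR : P - R = 2 ^ p * o) (v : ℝ) :
    ‖XsD d T P R v - (sq2 ^ (p + 1) : ℝ) * ((2 * π * Complex.I / 2 ^ (p + 1)) ^ d *
      (-2 * wexp ((R + v) / 2 ^ (p + 1))))‖ ≤
      2 * (2 * π) ^ d * (sq2 ^ (2 * d + 1)) ^ (p + 1) *
        (sq2 ^ (2 * d + 1) / (1 - sq2 ^ (2 * d + 1))) := by
  obtain ⟨r, rfl⟩ := Nat.exists_eq_add_of_lt hp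
  have hPR' : (P : ℝ) = R + 2 ^ p * o := by
    have : P = R + 2 ^ p * o := by omega
    rw [this]; push_cast; ring
  unfold XsD
  rw [show p + r + 1 = p + 1 + r by ring, Finset.sum_range_add, Finset.sum_range_succ]
  have hzero : ∑ i ∈ Finset.range p, ((sq2 ^ (i + 1) : ℝ) : ℂ) *
      ((2 * π * Complex.I / 2 ^ (i + 1)) ^ d *
      (wexp ((P + v) / 2 ^ (i + 1)) - wexp ((R + v) / 2 ^ (i + 1)))) = 0 := by
    refine Finset.sum_eq_zero fun i hi => ?_
    obtain ⟨k, hk⟩ := Nat.exists_eq_add_of_le (Nat.succ_le_of_lt (Finset.mem_range.1 hi))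
    have : ((P : ℝ) + v) / 2 ^ (i + 1) = (R + v) / 2 ^ (i + 1) + ((2 ^ k * o : ℤ) : ℝ) := by
      rw [hPR', hk, Nat.succ_eq_add_one, pow_add _ (i + 1) k]; push_cast; field_simp; ring
    rw [this, wexp_add_int]; simp
  have hmain : wexp ((P + v) / 2 ^ (p + 1)) - wexp ((R + v) / 2 ^ (p + 1))
      = -2 * wexp ((R + v) / 2 ^ (p + 1)) := by
    have : ((P : ℝ) + v) / 2 ^ (p + 1) = (R + v) / 2 ^ (p + 1) + o / 2 := by
      rw [hPR', pow_succ]; field_simp; ring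
    rw [this, wexp_add, wexp_half_odd ho]; ring
  rw [hzero, hmain, zero_add, add_sub_cancel_left]
  set ρ := sq2 ^ (2 * d + 1) with hρ
  have hρ0 : 0 < ρ := pow_pos sq2_pos _
  have hρ1 : ρ < 1 := pow_lt_one₀ sq2_pos.le (by linarith [sq2_lt]) (by omega)
  have hterm : ∀ x ∈ Finset.range r, ‖((sq2 ^ (p + 1 + x + 1) : ℝ) : ℂ) *
      ((2 * π * Complex.I / 2 ^ (p + 1 + x + 1)) ^ d *
      (wexp ((P + v) / 2 ^ (p + 1 + x + 1)) - wexp ((R + v) / 2 ^ (p + 1 + x + 1))))‖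
      ≤ 2 * (2 * π) ^ d * ρ ^ (p + 1) * ρ * ρ ^ x := fun x _ => by
    rw [norm_mul, norm_mul, Complex.norm_real, Real.norm_of_nonneg (pow_nonneg sq2_pos.le _),
      norm_pow (_ / _), norm_div, norm_pow (2:ℂ)]
    have h2 : ‖(2 * π * Complex.I : ℂ)‖ = 2 * π := by
      simp [abs_of_pos pi_pos]
    have h3 : ‖wexp ((P + v) / 2 ^ (p + 1 + x + 1)) - wexp ((R + v) / 2 ^ (p + 1 + x + 1))‖ ≤ 2 := by
      refine (norm_sub_le _ _).trans ?_
      rw [norm_wexp, norm_wexp]; norm_num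
    rw [h2]
    have h4 : (2 * π / ‖(2:ℂ)‖ ^ (p + 1 + x + 1)) ^ d
        = (2 * π) ^ d * (sq2 ^ (2 * d)) ^ (p + 1 + x + 1) := by
      rw [← pow_mul, show 2 * d * (p + 1 + x + 1) = 2 * ((p + 1 + x + 1) * d) by ring,
        sq2_pow_two_mul, div_pow, pow_mul]; simp [div_eq_mul_inv]
    rw [h4]
    calc _ ≤ sq2 ^ (p + 1 + x + 1) * ((2 * π) ^ d * (sq2 ^ (2 * d)) ^ (p + 1 + x + 1) * 2) := by
          have := sq2_pos.le; gcongr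
      _ = _ := by rw [hρ]; ring
  refine (norm_sum_le_of_le _ hterm).trans ?_
  rw [← Finset.mul_sum, mul_assoc _ ρ]
  gcongr
  rw [div_eq_mul_inv]
  gcongr
  rw [geom_sum_eq hρ1.ne, ← neg_div_neg_eq, div_eq_mul_inv, neg_sub, neg_sub]
  refine mul_le_of_le_one_left (inv_nonneg.2 (by linarith)) ?_
  linarith [pow_nonneg hρ0.le r]

lemma sq2_three_bound : sq2 ^ 3 / (1 - sq2 ^ 3) ≤ 0.55 := by
  have h : sq2 ^ 3 < 0.3536 := by
    rw [pow_succ, sq2_sq]; linarith [sq2_lt]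
  rw [div_le_iff₀ (by linarith)]; linarith

lemma sq2_five_bound : sq2 ^ 5 / (1 - sq2 ^ 5) ≤ 0.22 := by
  have h : sq2 ^ 5 < 0.1768 := by
    rw [show sq2 ^ 5 = sq2 ^ 2 * sq2 ^ 2 * sq2 by ring, sq2_sq]; linarith [sq2_lt]
  rw [div_le_iff₀ (by linarith)]; linarith

section phase
variable (η : ℂ) (T p : ℕ) (hp : p < T) (P R o : ℤ) (ho : Odd o) (hPR : P - R = 2 ^ p * o)

/-- The main term of the derivative of the phase. -/
def mainE (η : ℂ) (p : ℕ) (R : ℤ) (v : ℝ) : ℂ :=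
  η * ((sq2 ^ (p + 1) : ℝ) * ((2 * π * Complex.I / 2 ^ (p + 1)) *
      (-2 * wexp ((R + v) / 2 ^ (p + 1)))))

lemma norm_mainE (v : ℝ) : ‖mainE η p R v‖ = 4 * π * ‖η‖ * (sq2 ^ 3) ^ (p + 1) := by
  unfold mainE
  have h2 : ‖(2 * π * Complex.I : ℂ)‖ = 2 * π := by simp [abs_of_pos pi_pos]
  rw [norm_mul, norm_mul, norm_mul, norm_mul, norm_div, norm_wexp, Complex.norm_real, h2,
    Real.norm_of_nonneg (pow_nonneg sq2_pos.le _), norm_pow]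
  have : (sq2 ^ 3) ^ (p + 1) = sq2 ^ (p + 1) / 2 ^ (p + 1) := by
    rw [pow_succ sq2 2, sq2_sq, mul_pow, div_pow, one_pow]; ring
  rw [this]
  simp
  ring

include hp ho hPR in
lemma phase_deriv_one (v : ℝ) :
    |(η * XsD 1 T P R v).re - (mainE η p R v).re| ≤ 0.55 * (4 * π * ‖η‖ * (sq2 ^ 3) ^ (p + 1)) := by
  rw [← Complex.sub_re]
  refine (Complex.abs_re_le_norm _).trans ?_
  have h := XsD_sub_main_le 1 T p hp P R o ho hPR v
  rw [pow_one] at h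
  rw [mainE, ← mul_sub, norm_mul]
  refine (mul_le_mul_of_nonneg_left h (norm_nonneg _)).trans ?_
  have h3 := sq2_three_bound
  norm_num at h3 ⊢
  have : 0 ≤ ‖η‖ * (4 * π * (sq2 ^ 3) ^ (p + 1)) := by have := sq2_pos; positivity
  nlinarith

include hp ho hPR in
lemma phase_deriv_two (v : ℝ) :
    |(η * XsD 2 T P R v).re + (mainE η p R v).im * (2 * π / 2 ^ (p + 1))|
      ≤ 0.22 * (8 * π ^ 2 * ‖η‖ * (sq2 ^ 5) ^ (p + 1)) := by
  have e : (mainE η p R v).im * (2 * π / 2 ^ (p + 1))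
      = -(mainE η p R v * (2 * π * Complex.I / 2 ^ (p + 1))).re := by
    have : (2 * π * Complex.I / 2 ^ (p + 1) : ℂ) = ((2 * π / 2 ^ (p + 1) : ℝ) : ℂ) * Complex.I := by
      push_cast; ring
    rw [this, ← mul_assoc, Complex.mul_I_re, Complex.im_mul_ofReal, neg_neg]
  rw [e, ← sub_eq_add_neg, ← Complex.sub_re]
  refine (Complex.abs_re_le_norm _).trans ?_
  have h := XsD_sub_main_le 2 T p hp P R o ho hPR v
  have e2 : η * XsD 2 T P R v - mainE η p R v * (2 * π * Complex.I / 2 ^ (p + 1))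
      = η * (XsD 2 T P R v - (sq2 ^ (p + 1) : ℝ) * ((2 * π * Complex.I / 2 ^ (p + 1)) ^ 2 *
      (-2 * wexp ((R + v) / 2 ^ (p + 1))))) := by
    rw [mainE]; ring
  rw [e2, norm_mul]
  refine (mul_le_mul_of_nonneg_left h (norm_nonneg _)).trans ?_
  have h3 := sq2_five_bound
  norm_num at h3 ⊢
  have : 0 ≤ ‖η‖ * (8 * π ^ 2 * (sq2 ^ 5) ^ (p + 1)) := by have := sq2_pos; positivity
  nlinarith

lemma amplitude_two_eq : 8 * π ^ 2 * ‖η‖ * (sq2 ^ 5) ^ (p + 1)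
    = 4 * π * ‖η‖ * (sq2 ^ 3) ^ (p + 1) * (2 * π / 2 ^ (p + 1)) := by
  have : (sq2 ^ 5) ^ (p + 1) = (sq2 ^ 3) ^ (p + 1) * (1 / 2 ^ (p + 1)) := by
    rw [pow_add sq2 3 2, sq2_sq, mul_pow, div_pow, one_pow]
  rw [this]; ring

include hp ho hPR in
lemma abs_phase_deriv_one_le (v : ℝ) :
    |(η * XsD 1 T P R v).re| ≤ 1.55 * (4 * π * ‖η‖ * (sq2 ^ 3) ^ (p + 1)) := by
  have h := phase_deriv_one η T p hp P R o ho hPR v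
  have h1 := Complex.abs_re_le_norm (mainE η p R v)
  rw [norm_mainE] at h1
  have := abs_sub_abs_le_abs_sub (η * XsD 1 T P R v).re (mainE η p R v).re
  linarith

include hp ho hPR in
lemma abs_phase_deriv_two_le (v : ℝ) :
    |(η * XsD 2 T P R v).re| ≤ 2 * (8 * π ^ 2 * ‖η‖ * (sq2 ^ 5) ^ (p + 1)) := by
  have h := phase_deriv_two η T p hp P R o ho hPR v
  have h1 := Complex.abs_im_le_norm (mainE η p R v)
  rw [norm_mainE] at h1
  have h2 : |(mainE η p R v).im * (2 * π / 2 ^ (p + 1))| ≤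
      8 * π ^ 2 * ‖η‖ * (sq2 ^ 5) ^ (p + 1) := by
    rw [amplitude_two_eq, abs_mul, abs_of_pos (by positivity : 0 < 2 * π / 2 ^ (p + 1))]
    gcongr
  have h3 := abs_sub_abs_le_abs_sub (η * XsD 2 T P R v).re
    (-((mainE η p R v).im * (2 * π / 2 ^ (p + 1))))
  rw [sub_neg_eq_add, abs_neg] at h3
  have : 0 ≤ 8 * π ^ 2 * ‖η‖ * (sq2 ^ 5) ^ (p + 1) := by have := sq2_pos; positivity
  linarith

include hp ho hPR in
lemma le_abs_phase_deriv_two (v : ℝ)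
    (hv : |(η * XsD 1 T P R v).re| ≤ 0.3 * (4 * π * ‖η‖ * (sq2 ^ 3) ^ (p + 1))) :
    0.3 * (8 * π ^ 2 * ‖η‖ * (sq2 ^ 5) ^ (p + 1)) ≤ |(η * XsD 2 T P R v).re| := by
  have h1 := phase_deriv_one η T p hp P R o ho hPR v
  have h2 := phase_deriv_two η T p hp P R o ho hPR v
  set A := 4 * π * ‖η‖ * (sq2 ^ 3) ^ (p + 1) with hA
  have hA0 : 0 ≤ A := by have := sq2_pos; positivity
  have hre : |(mainE η p R v).re| ≤ 0.85 * A := by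
    have := abs_sub_abs_le_abs_sub (mainE η p R v).re (η * XsD 1 T P R v).re
    rw [abs_sub_comm] at this
    linarith
  have him : 0.52 * A ≤ |(mainE η p R v).im| := by
    have hn := Complex.sq_norm (mainE η p R v)
    rw [norm_mainE, Complex.normSq_apply] at hn
    refine abs_le_of_sq_le_sq' ?_ (abs_nonneg _) |>.2
    rw [sq_abs]
    have : (mainE η p R v).re ^ 2 ≤ (0.85 * A) ^ 2 := by
      rw [← sq_abs]; gcongr
    nlinarith
  have h3 := abs_sub_abs_le_abs_sub ((mainE η p R v).im * (2 * π / 2 ^ (p + 1)))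
    (-(η * XsD 2 T P R v).re)
  rw [sub_neg_eq_add, abs_neg, add_comm ((mainE η p R v).im * _)] at h3
  have h4 : 0.52 * (A * (2 * π / 2 ^ (p + 1))) ≤ |(mainE η p R v).im * (2 * π / 2 ^ (p + 1))| := by
    rw [abs_mul, abs_of_pos (by positivity : 0 < 2 * π / 2 ^ (p + 1)), ← mul_assoc]
    gcongr
  rw [amplitude_two_eq, ← hA] at h2 ⊢
  linarith

end phase

/-- Decay of the off-diagonal exponential sums. -/
lemma offdiag_le (η : ℂ) (T p j : ℕ) (hp : p < T) (hpj : p < j) (hj : 3 ≤ j)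
    (P R o : ℤ) (ho : Odd o) (hPR : P - R = 2 ^ p * o) (h1 : 2 ^ (32 * j) ≤ ‖η‖)
    (h2 : ‖η‖ ≤ 2 ^ (32 * j + 64)) (v₀ : ℝ) :
    ‖∑ a ∈ Finset.range (2 ^ (64 * j)), Complex.exp
      ((η * XsD 0 T P R (v₀ + a / 2 ^ (64 * j))).re * Complex.I)‖
      ≤ 2 ^ (64 * j) * (2 ^ 72 / 2 ^ j) := by
  have hdh : ∀ d v, HasDerivAt (fun v => (η * XsD d T P R v).re) (η * XsD (d + 1) T P R v).re v :=
    fun d v => by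
      have := ((hasDerivAt_XsD d T P R v).const_mul η)
      exact (Complex.reCLM.hasFDerivAt.comp_hasDerivAt v this)
  have hs := sq2_pos
  have hη : 0 < ‖η‖ := lt_of_lt_of_le (by positivity) h1
  set A₁ := 4 * π * ‖η‖ * (sq2 ^ 3) ^ (p + 1) with hA₁
  set A₂ := 8 * π ^ 2 * ‖η‖ * (sq2 ^ 5) ^ (p + 1) with hA₂
  have hA₁0 : 0 < A₁ := by positivity
  have hA₂0 : 0 < A₂ := by positivity
  have hπ3 := pi_gt_three
  have hπ4 := pi_lt_d2
  have hA21 : A₂ ≤ 4 * A₁ := by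
    rw [hA₂, amplitude_two_eq, ← hA₁, mul_comm 4]
    gcongr
    rw [div_le_iff₀ (by positivity)]
    have : (2:ℝ) ^ 1 ≤ 2 ^ (p + 1) := pow_le_pow_right₀ (by norm_num) (by omega)
    linarith
  have hA₁up : A₁ ≤ 2 * π * 2 ^ (32 * j + 64) := by
    have : (sq2 ^ 3) ^ (p + 1) ≤ 1 / 2 := by
      calc (sq2 ^ 3) ^ (p + 1) ≤ (sq2 ^ 3) ^ 1 :=
            pow_le_pow_of_le_one (by positivity) (pow_le_one₀ hs.le sq2_le_one) (by omega)
        _ = 1 / 2 * sq2 := by rw [pow_one, pow_succ, sq2_sq]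
        _ ≤ _ := by linarith [sq2_le_one]
    calc A₁ ≤ 4 * π * 2 ^ (32 * j + 64) * (1 / 2) := by rw [hA₁]; gcongr
      _ = _ := by ring
  have hA₁low : 12 * 2 ^ (30 * j) ≤ A₁ := by
    have : 1 / 2 ^ (2 * j) ≤ (sq2 ^ 3) ^ (p + 1) := by
      rw [← sq2_pow_two_mul, ← pow_mul]
      exact pow_le_pow_of_le_one hs.le sq2_le_one (by omega)
    calc (12:ℝ) * 2 ^ (30 * j) = 4 * 3 * 2 ^ (32 * j) * (1 / 2 ^ (2 * j)) := by
          rw [show 32 * j = 30 * j + 2 * j by ring, pow_add]; field_simp; norm_num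
      _ ≤ _ := by rw [hA₁]; gcongr
  have hA₂low : 72 * 2 ^ (29 * j) ≤ A₂ := by
    have : 1 / 2 ^ (3 * j) ≤ (sq2 ^ 5) ^ (p + 1) := by
      rw [← sq2_pow_two_mul, ← pow_mul]
      exact pow_le_pow_of_le_one hs.le sq2_le_one (by omega)
    calc (72:ℝ) * 2 ^ (29 * j) = 8 * 3 ^ 2 * 2 ^ (32 * j) * (1 / 2 ^ (3 * j)) := by
          rw [show 32 * j = 29 * j + 3 * j by ring, pow_add]; field_simp; norm_num
      _ ≤ _ := by rw [hA₂]; gcongr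
  have hpow : (2:ℝ) ^ (28 * j) ≤ 2 ^ (30 * j) := pow_le_pow_right₀ (by norm_num) (by omega)
  have hvdc := norm_expsum_le (hdh 0) (hdh 1) (A₁ := A₁) (A₂ := A₂) (μ := 2 ^ (28 * j))
    (v₀ := v₀) (B := 2 ^ (40 * j)) (Q := 2 ^ (24 * j)) (by positivity) (by positivity) hA₂0 hA21
    (by positivity) (by linarith)
    (fun v => abs_phase_deriv_two_le η T p hp P R o ho hPR v)
    (fun v => by
      refine (abs_phase_deriv_one_le η T p hp P R o ho hPR v).trans ?_
      push_cast
      rw [← pow_add]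
      have : (2:ℝ) ^ (32 * j + 64) * 4 ≤ 2 ^ (40 * j + 24 * j) := by
        rw [show (4:ℝ) = 2 ^ 2 by norm_num, ← pow_add]
        exact pow_le_pow_right₀ (by norm_num) (by omega)
      have h5 : π * (2 ^ (32 * j + 64) * 4) ≤ π * 2 ^ (40 * j + 24 * j) := by gcongr
      have : 0 < π * (2:ℝ) ^ (32 * j + 64) := by positivity
      linarith)
    (fun v hv => le_abs_phase_deriv_two η T p hp P R o ho hPR v hv)
  rw [← pow_add, show 40 * j + 24 * j = 64 * j by ring] at hvdc
  push_cast at hvdc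
  rw [← pow_add, show 40 * j + 24 * j = 64 * j by ring] at hvdc
  refine hvdc.trans ?_
  gcongr
  have hmono : ∀ c : ℕ, 1 ≤ c → (1:ℝ) / 2 ^ (c * j) ≤ 1 / 2 ^ j := fun c hc => by
    exact one_div_le_one_div_of_le (by positivity)
      (pow_le_pow_right₀ (by norm_num) (Nat.le_mul_of_pos_left _ hc))
  have b1 : 2 * A₂ / (2 ^ (24 * j)) ^ 2 ≤ 2 ^ 70 * (1 / 2 ^ j) := by
    calc 2 * A₂ / (2 ^ (24 * j)) ^ 2 ≤ 2 * (2 ^ 5 * 2 ^ (32 * j + 64)) / (2 ^ (24 * j)) ^ 2 := by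
          gcongr
          have : (0:ℝ) < 2 ^ (32 * j + 64) := by positivity
          nlinarith
      _ = 2 ^ 70 * (1 / 2 ^ (16 * j)) := by
          rw [← pow_mul, show 24 * j * 2 = 32 * j + 16 * j by ring, pow_add, pow_add]
          field_simp
      _ ≤ _ := mul_le_mul_of_nonneg_left (hmono 16 (by norm_num)) (by positivity)
  have b2 : π * 2 ^ (24 * j) / 2 ^ (28 * j) ≤ 4 * (1 / 2 ^ j) := by
    calc π * 2 ^ (24 * j) / 2 ^ (28 * j) = π * (1 / 2 ^ (4 * j)) := by
          rw [show 28 * j = 24 * j + 4 * j by ring, pow_add]; field_simp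
      _ ≤ 4 * (1 / 2 ^ j) := by
          have := hmono 4 (by norm_num)
          gcongr
          linarith
  have b3 : 560 * 2 ^ (28 * j) / A₂ ≤ 8 * (1 / 2 ^ j) := by
    calc 560 * 2 ^ (28 * j) / A₂ ≤ 560 * 2 ^ (28 * j) / (72 * 2 ^ (29 * j)) := by gcongr
      _ = 560 / 72 * (1 / 2 ^ j) := by
          rw [show 29 * j = 28 * j + j by ring, pow_add]; field_simp
      _ ≤ _ := by gcongr; norm_num
  have b4 : (80:ℝ) / 2 ^ (24 * j) ≤ 80 * (1 / 2 ^ j) := by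
    rw [div_eq_mul_one_div]; exact mul_le_mul_of_nonneg_left (hmono 24 (by norm_num)) (by positivity)
  have : (0:ℝ) < 1 / 2 ^ j := by positivity
  rw [div_eq_mul_one_div (2 ^ 72)]
  linarith

lemma norm_sum_sq_le_card {ι : Type*} (S : Finset ι) (v : ι → ℂ) :
    ‖∑ x ∈ S, v x‖ ^ 2 ≤ S.card * ∑ x ∈ S, ‖v x‖ ^ 2 := by
  calc ‖∑ x ∈ S, v x‖ ^ 2 ≤ (∑ x ∈ S, ‖v x‖) ^ 2 := by gcongr; exact norm_sum_le _ _
    _ ≤ _ := sq_sum_le_card_mul_sum_sq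

lemma norm_sum_sq_eq {ι : Type*} (S : Finset ι) (v : ι → ℂ) :
    ((‖∑ x ∈ S, v x‖ ^ 2 : ℝ) : ℂ) = ∑ x ∈ S, ∑ y ∈ S, v x * (starRingEnd ℂ) (v y) := by
  rw [← Finset.sum_mul_sum, ← map_sum, Complex.mul_conj, Complex.normSq_eq_norm_sq]

/-- Van der Corput differencing. -/
lemma differencing {ι κ σ : Type*} (S : Finset ι) (U : Finset κ) (V : Finset σ)
    (φ : σ → ℂ) (hφ : ∀ a, ‖φ a‖ = 1) (ψ : ι → κ → σ → ℂ) :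
    ‖∑ f ∈ S, ∑ b ∈ U, ∑ a ∈ V, φ a * ψ f b a‖ ^ 2 ≤
      S.card * V.card * ∑ f ∈ S, ∑ b ∈ U, ∑ b' ∈ U,
        ‖∑ a ∈ V, ψ f b a * (starRingEnd ℂ) (ψ f b' a)‖ := by
  have h1 : ∑ f ∈ S, ∑ b ∈ U, ∑ a ∈ V, φ a * ψ f b a
      = ∑ x ∈ S ×ˢ V, φ x.2 * ∑ b ∈ U, ψ x.1 b x.2 := by
    rw [Finset.sum_product]
    refine Finset.sum_congr rfl fun f _ => ?_
    rw [Finset.sum_comm]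
    exact Finset.sum_congr rfl fun a _ => (Finset.mul_sum _ _ _).symm
  rw [h1]
  refine (norm_sum_sq_le_card _ _).trans ?_
  rw [Finset.card_product, Nat.cast_mul, Finset.sum_product]
  gcongr with f _
  simp only [norm_mul, hφ, one_mul]
  have h2 : ((∑ a ∈ V, ‖∑ b ∈ U, ψ f b a‖ ^ 2 : ℝ) : ℂ)
      = ∑ b ∈ U, ∑ b' ∈ U, ∑ a ∈ V, ψ f b a * (starRingEnd ℂ) (ψ f b' a) := by
    rw [Complex.ofReal_sum]
    simp only [norm_sum_sq_eq]
    rw [Finset.sum_comm]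
    exact Finset.sum_congr rfl fun b _ => Finset.sum_comm
  calc ∑ a ∈ V, ‖∑ b ∈ U, ψ f b a‖ ^ 2
      = ‖((∑ a ∈ V, ‖∑ b ∈ U, ψ f b a‖ ^ 2 : ℝ) : ℂ)‖ := by
        rw [Complex.norm_real, Real.norm_of_nonneg (by positivity)]
    _ ≤ _ := by
        rw [h2]
        exact norm_sum_le_of_le _ fun b _ => norm_sum_le _ _

lemma exists_two_pow_mul_odd_of_ne {b b' L : ℕ} (hb : b < 2 ^ L) (hb' : b' < 2 ^ L) (h : b ≠ b') :
    ∃ (p : ℕ) (o : ℤ), p < L ∧ Odd o ∧ (b : ℤ) - b' = 2 ^ p * o := by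
  obtain ⟨p, m, hm, hpm⟩ := Nat.exists_eq_two_pow_mul_odd (n := ((b : ℤ) - b').natAbs) (by omega)
  have hlt : ((b : ℤ) - b').natAbs < 2 ^ L := by
    zify at hb hb' ⊢
    rw [abs_lt]; constructor <;> linarith [Int.natCast_nonneg b, Int.natCast_nonneg b']
  have hp : p < L := by
    by_contra hc
    have h1 : 2 ^ L ≤ 2 ^ p := Nat.pow_le_pow_right (by norm_num) (not_lt.1 hc)
    have h2 : 2 ^ p ≤ 2 ^ p * m := Nat.le_mul_of_pos_right _ hm.pos
    omega
  rcases Int.natAbs_eq ((b : ℤ) - b') with h1 | h1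
  · exact ⟨p, m, hp, by exact_mod_cast hm, by rw [h1, hpm]; push_cast; ring⟩
  · exact ⟨p, -m, hp, Odd.neg (by exact_mod_cast hm), by rw [h1, hpm]; push_cast; ring⟩

lemma fourier_decay_sq (j t : ℕ) (u : ℝ) (ζ : ℂ) (hj : 3 ≤ j) (h1 : 2 ^ (64 * j) ≤ ‖ζ‖)
    (h2 : ‖ζ‖ ≤ 2 ^ (64 * j + 64)) (h3 : ‖ζ‖ ≤ 2 ^ t) :
    ‖∑ g ∈ Finset.range (4 ^ t), Complex.exp ((ζ * Xs (2 * t) (g + u)).re * Complex.I)‖ ^ 2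
      ≤ 2 ^ 73 / 2 ^ j * 16 ^ t := by
  have hjt : 64 * j ≤ t := by
    have := h1.trans h3
    exact (pow_le_pow_iff_right₀ (by norm_num : (1:ℝ) < 2)).1 this
  obtain ⟨r, hr⟩ := Nat.exists_eq_add_of_le (show 65 * j ≤ 2 * t by omega)
  obtain ⟨T, hT⟩ := Nat.exists_eq_add_of_le (show 64 * j ≤ 2 * t by omega)
  have h4t : 4 ^ t = 2 ^ (64 * j) * (2 ^ j * 2 ^ r) := by
    rw [show 4 = 2 ^ 2 by norm_num, ← pow_mul, hr, ← pow_add, ← pow_add]; congr 1; ring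
  rw [h4t, sum_range_mul_eq, sum_range_mul_eq]
  set η : ℂ := ζ * (sq2 ^ (64 * j) : ℝ) with hη
  have hsq : sq2 ^ (64 * j) = 1 / 2 ^ (32 * j) := by
    rw [← sq2_pow_two_mul]; congr 1; ring
  have hηn : ‖η‖ = ‖ζ‖ / 2 ^ (32 * j) := by
    rw [hη, norm_mul, Complex.norm_real, hsq, Real.norm_of_nonneg (by positivity)]; ring
  have hη1 : 2 ^ (32 * j) ≤ ‖η‖ := by
    rw [hηn, le_div_iff₀ (by positivity), ← pow_add,
      show 32 * j + 32 * j = 64 * j by ring]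
    exact h1
  have hη2 : ‖η‖ ≤ 2 ^ (32 * j + 64) := by
    rw [hηn, div_le_iff₀ (by positivity), ← pow_add,
      show 32 * j + 64 + 32 * j = 64 * j + 64 by ring]
    exact h2
  set φ : ℕ → ℂ := fun a => Complex.exp ((ζ * Xs (64 * j) (a + u)).re * Complex.I) with hφ
  set w : ℕ → ℝ := fun a => u / 2 ^ (64 * j) + a / 2 ^ (64 * j) with hw
  set ψ : ℕ → ℕ → ℕ → ℂ := fun f b a =>
    Complex.exp ((η * Xs T (((b + 2 ^ j * f : ℕ) : ℤ) + w a)).re * Complex.I) with hψ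
  have hsplit : ∀ f b a : ℕ, Complex.exp ((ζ * Xs (2 * t)
      (((a + 2 ^ (64 * j) * (b + 2 ^ j * f) : ℕ) : ℝ) + u)).re * Complex.I) = φ a * ψ f b a := by
    intro f b a
    simp only [hφ, hψ]
    rw [← Complex.exp_add, ← add_mul, ← Complex.ofReal_add, ← Complex.add_re]
    congr 4
    rw [hT, Xs_add, mul_add, hη, mul_assoc]
    congr 2
    · have := Xs_add_int_mul (64 * j) (a + u) ((b + 2 ^ j * f : ℕ) : ℤ)
      rw [← this]; congr 1; push_cast; ring
    · congr 1; simp only [hw]; congr 1; push_cast; field_simp; ring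
  simp only [hsplit]
  refine (differencing _ _ _ φ (fun a => Complex.norm_exp_ofReal_mul_I _) ψ).trans ?_
  have hpair : ∀ f, ∀ b ∈ Finset.range (2 ^ j), ∀ b' ∈ Finset.range (2 ^ j),
      ‖∑ a ∈ Finset.range (2 ^ (64 * j)), ψ f b a * (starRingEnd ℂ) (ψ f b' a)‖
        ≤ (if b = b' then 2 ^ (64 * j) else 0) + 2 ^ (64 * j) * (2 ^ 72 / 2 ^ j) := by
    intro f b hb b' hb'
    split_ifs with hbb
    · have : ‖∑ a ∈ Finset.range (2 ^ (64 * j)), ψ f b a * (starRingEnd ℂ) (ψ f b' a)‖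
          ≤ 2 ^ (64 * j) := by
        refine (norm_sum_le_of_le _ (n := fun _ => 1) fun a _ => ?_).trans (by simp)
        rw [norm_mul, RCLike.norm_conj, Complex.norm_exp_ofReal_mul_I,
          Complex.norm_exp_ofReal_mul_I, one_mul]
      have : (0:ℝ) ≤ 2 ^ (64 * j) * (2 ^ 72 / 2 ^ j) := by positivity
      linarith
    · rw [zero_add]
      obtain ⟨p, o, hpj, ho, hpo⟩ := exists_two_pow_mul_odd_of_ne (Finset.mem_range.1 hb)
        (Finset.mem_range.1 hb') hbb
      have := offdiag_le η T p j (by omega) hpj hj ((b + 2 ^ j * f : ℕ) : ℤ)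
        ((b' + 2 ^ j * f : ℕ) : ℤ) o ho (by rw [← hpo]; push_cast; ring) hη1 hη2
        (u / 2 ^ (64 * j))
      refine le_of_eq_of_le ?_ this
      congr 1
      refine Finset.sum_congr rfl fun a _ => ?_
      simp only [hψ]
      rw [← Complex.exp_conj, ← Complex.exp_add]
      congr 1
      rw [map_mul, Complex.conj_I, Complex.conj_ofReal, mul_neg, ← sub_eq_add_neg, ← sub_mul,
        ← Complex.ofReal_sub, ← Complex.sub_re, ← mul_sub]
      congr 4
      simp only [XsD, Xs, pow_zero, one_mul, mul_sub, Finset.sum_sub_distrib, hw]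
  have hsum : ∑ f ∈ Finset.range (2 ^ r), ∑ b ∈ Finset.range (2 ^ j), ∑ b' ∈ Finset.range (2 ^ j),
      ‖∑ a ∈ Finset.range (2 ^ (64 * j)), ψ f b a * (starRingEnd ℂ) (ψ f b' a)‖
      ≤ ∑ f ∈ Finset.range (2 ^ r), ∑ b ∈ Finset.range (2 ^ j), ∑ b' ∈ Finset.range (2 ^ j),
        (((if b = b' then 2 ^ (64 * j) else 0) : ℝ) + 2 ^ (64 * j) * (2 ^ 72 / 2 ^ j)) :=
    Finset.sum_le_sum fun f _ => Finset.sum_le_sum fun b hb => Finset.sum_le_sum fun b' hb' =>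
      hpair f b hb b' hb'
  refine (mul_le_mul_of_nonneg_left hsum (by positivity)).trans ?_
  have hinner : ∀ b ∈ Finset.range (2 ^ j), ∑ b' ∈ Finset.range (2 ^ j),
      (((if b = b' then 2 ^ (64 * j) else 0) : ℝ) + 2 ^ (64 * j) * (2 ^ 72 / 2 ^ j))
      = 2 ^ (64 * j) + 2 ^ j * (2 ^ (64 * j) * (2 ^ 72 / 2 ^ j)) := fun b hb => by
    rw [Finset.sum_add_distrib, Finset.sum_ite_eq, if_pos hb]
    simp
  rw [Finset.sum_congr rfl fun f _ => Finset.sum_congr rfl hinner]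
  simp only [Finset.sum_const, Finset.card_range, nsmul_eq_mul]
  push_cast
  have h16 : (16:ℝ) ^ t = (2 ^ (64 * j) * (2 ^ j * 2 ^ r)) ^ 2 := by
    rw [show (16:ℝ) = 4 ^ 2 by norm_num, ← pow_mul, mul_comm 2 t, pow_mul]
    congr 1; exact_mod_cast h4t
  rw [h16]
  have : (2:ℝ) ^ r * 2 ^ (64 * j) *
      (2 ^ r * (2 ^ j * (2 ^ (64 * j) + 2 ^ j * (2 ^ (64 * j) * (2 ^ 72 / 2 ^ j)))))
      = (1 + 2 ^ 72) / 2 ^ j * (2 ^ (64 * j) * (2 ^ j * 2 ^ r)) ^ 2 := by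
    field_simp
  rw [this]
  gcongr
  norm_num

/-- Decay of exponential sums with linear phase along the points `X_g(u)`. -/
lemma fourier_decay (j t : ℕ) (u : ℝ) (ζ : ℂ) (h1 : 2 ^ (64 * (2 * j)) ≤ ‖ζ‖) (h3 : ‖ζ‖ ≤ 2 ^ t) :
    ‖∑ g ∈ Finset.range (4 ^ t), Complex.exp ((ζ * Xs (2 * t) (g + u)).re * Complex.I)‖
      ≤ 2 ^ 37 / 2 ^ j * 4 ^ t := by
  rcases lt_or_ge j 2 with hj | hj
  · have : ‖∑ g ∈ Finset.range (4 ^ t), Complex.exp ((ζ * Xs (2 * t) (g + u)).re * Complex.I)‖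
        ≤ 4 ^ t := by
      refine (norm_sum_le_of_le _ (n := fun _ => 1) fun a _ => ?_).trans (by simp)
      rw [Complex.norm_exp_ofReal_mul_I]
    refine this.trans (le_mul_of_one_le_left (by positivity) ?_)
    interval_cases j <;> norm_num
  · obtain ⟨n, hn1, hn2⟩ : ∃ n : ℕ, 2 ^ (64 * n) ≤ ‖ζ‖ ∧ ‖ζ‖ < 2 ^ (64 * (n + 1)) := by
      have := exists_nat_pow_near (x := ‖ζ‖) (y := (2:ℝ) ^ 64)
        (le_trans (one_le_pow₀ (by norm_num)) h1) (by norm_num)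
      simpa only [← pow_mul] using this
    have hnj : 2 * j ≤ n := by
      have := (pow_lt_pow_iff_right₀ (by norm_num : (1:ℝ) < 2)).1 (h1.trans_lt hn2)
      omega
    have := fourier_decay_sq n t u ζ (by omega) hn1 (by rw [mul_add] at hn2; exact hn2.le) h3
    refine abs_le_of_sq_le_sq' (this.trans ?_) (by positivity) |>.2
    rw [mul_pow, div_pow, ← pow_mul, ← pow_mul, ← pow_mul, mul_comm t 2, pow_mul 4 2 t]
    norm_num1
    gcongr
    · norm_num
    · norm_num
    · omega

/-- The character `w ↦ exp (i Re (ξ w))`. -/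
def chi (ξ w : ℂ) : ℂ := Complex.exp ((ξ * w).re * Complex.I)

lemma norm_chi (ξ w : ℂ) : ‖chi ξ w‖ = 1 := Complex.norm_exp_ofReal_mul_I _

lemma chi_add_right (ξ v w : ℂ) : chi ξ (v + w) = chi ξ v * chi ξ w := by
  rw [chi, chi, chi, ← Complex.exp_add, mul_add, Complex.add_re]; push_cast; ring_nf

lemma conj_chi (ξ w : ℂ) : (starRingEnd ℂ) (chi ξ w) = chi ξ (-w) := by
  rw [chi, chi, ← Complex.exp_conj]; simp; ring_nf

lemma chi_mul_conj (ξ ξ' w : ℂ) : chi ξ w * (starRingEnd ℂ) (chi ξ' w) = chi (ξ - ξ') w := by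
  rw [conj_chi, chi, chi, chi, ← Complex.exp_add]; simp; ring_nf

lemma chi_sub_right (ξ v w : ℂ) : chi ξ (v - w) = chi ξ v * (starRingEnd ℂ) (chi ξ w) := by
  rw [conj_chi, sub_eq_add_neg, chi_add_right]

/-- A lattice point of the plane, as a frequency. -/
def lat (ν : ℕ × ℕ) : ℂ := ν.1 - ν.2 * Complex.I

/-- The square of lattice points of side `N`. -/
def latSq (N : ℕ) : Finset (ℕ × ℕ) := Finset.range N ×ˢ Finset.range N

/-- The two-dimensional Fejér-type kernel at scale `1 / N`. -/
def fker (N : ℕ) (w : ℂ) : ℝ := ‖∑ ν ∈ latSq N, chi (lat ν) w‖ ^ 2 / N ^ 4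

lemma fker_nonneg (N : ℕ) (w : ℂ) : 0 ≤ fker N w := by unfold fker; positivity

lemma fker_eq (N : ℕ) (w : ℂ) : (fker N w : ℂ)
    = (∑ y ∈ latSq N ×ˢ latSq N, chi (lat y.1 - lat y.2) w) / N ^ 4 := by
  rw [fker, Complex.ofReal_div, norm_sum_sq_eq, Finset.sum_product]
  simp only [chi_mul_conj]
  push_cast; rfl

lemma lat_mul_re (ν : ℕ × ℕ) (w : ℂ) : (lat ν * w).re = ν.1 * w.re + ν.2 * w.im := by
  simp [lat, Complex.mul_re]

lemma one_le_four_mul_fker {N : ℕ} (hN : 0 < N) {w : ℂ} (hw : ‖w‖ ≤ 1 / (2 * N)) :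
    1 ≤ 4 * fker N w := by
  have hN' : (0:ℝ) < N := by exact_mod_cast hN
  have hre := (Complex.abs_re_le_norm w).trans hw
  have him := (Complex.abs_im_le_norm w).trans hw
  have hterm : ∀ ν ∈ latSq N, 1 / 2 ≤ (chi (lat ν) w).re := fun ν hν => by
    simp only [latSq, Finset.mem_product, Finset.mem_range] at hν
    rw [chi, Complex.exp_ofReal_mul_I_re, lat_mul_re]
    have h1 : |(ν.1 : ℝ) * w.re + ν.2 * w.im| ≤ 1 := by
      refine (abs_add_le _ _).trans ?_
      rw [abs_mul, abs_mul, Nat.abs_cast, Nat.abs_cast]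
      have e1 : (ν.1 : ℝ) ≤ N := by exact_mod_cast hν.1.le
      have e2 : (ν.2 : ℝ) ≤ N := by exact_mod_cast hν.2.le
      calc _ ≤ (N : ℝ) * (1 / (2 * N)) + N * (1 / (2 * N)) := by gcongr
        _ = 1 := by field_simp; norm_num
    have h2 := Real.one_sub_sq_div_two_le_cos (x := (ν.1 : ℝ) * w.re + ν.2 * w.im)
    have h3 : ((ν.1 : ℝ) * w.re + ν.2 * w.im) ^ 2 ≤ 1 := by
      rw [← sq_abs]; exact pow_le_one₀ (abs_nonneg _) h1
    linarith
  have hsum : (N:ℝ) ^ 2 * (1 / 2) ≤ ‖∑ ν ∈ latSq N, chi (lat ν) w‖ := by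
    refine le_trans ?_ (Complex.re_le_norm _)
    rw [Complex.re_sum]
    refine le_trans (le_of_eq ?_) (Finset.card_nsmul_le_sum _ _ _ hterm)
    simp [latSq, sq]
  rw [fker, mul_div_assoc', le_div_iff₀ (by positivity)]
  calc 1 * (N:ℝ) ^ 4 = 4 * ((N:ℝ) ^ 2 * (1 / 2)) ^ 2 := by ring
    _ ≤ _ := by gcongr

/-- The energy of a family of points. -/
def energy {ι : Type*} (N : ℕ) (E : Finset ι) (p : ι → ℂ) : ℝ :=
  ∑ x ∈ E ×ˢ E, fker N (p x.1 - p x.2)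

lemma energy_eq {ι : Type*} (N : ℕ) (E : Finset ι) (p : ι → ℂ) :
    energy N E p = (∑ y ∈ latSq N ×ˢ latSq N,
      ‖∑ e ∈ E, chi (lat y.1 - lat y.2) (p e)‖ ^ 2) / N ^ 4 := by
  have : ((energy N E p : ℝ) : ℂ) = (((∑ y ∈ latSq N ×ˢ latSq N,
      ‖∑ e ∈ E, chi (lat y.1 - lat y.2) (p e)‖ ^ 2) / N ^ 4 : ℝ) : ℂ) := by
    rw [energy, Complex.ofReal_sum]
    simp only [fker_eq]
    rw [← Finset.sum_div, Finset.sum_comm, Complex.ofReal_div, Complex.ofReal_sum]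
    simp only [norm_sum_sq_eq, Finset.sum_product, chi_sub_right]
    push_cast; rfl
  exact_mod_cast this

lemma card_close_le (N : ℕ) (y : ℕ) {r : ℝ} (hr : 0 ≤ r) :
    (((Finset.range N).filter fun x : ℕ => |(x : ℝ) - y| < r).card : ℝ) ≤ 2 * r + 1 := by
  have := card_le_of_pairwise_dist_le
    (((Finset.range N).filter fun x : ℕ => |(x : ℝ) - y| < r).map Nat.castEmbedding)
    (R := 2 * r) (by positivity) ?_
  · simpa using this
  · intro a ha b hb
    simp only [Finset.mem_map, Finset.mem_filter, Nat.castEmbedding_apply] at ha hb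
    obtain ⟨a, ⟨-, ha⟩, rfl⟩ := ha
    obtain ⟨b, ⟨-, hb⟩, rfl⟩ := hb
    simp only [Int.cast_natCast]
    rw [abs_lt] at ha hb
    rw [abs_le]; constructor <;> linarith

lemma card_lat_close_le (N : ℕ) {r : ℝ} (hr : 0 ≤ r) :
    (((latSq N ×ˢ latSq N).filter fun y => ‖lat y.1 - lat y.2‖ < r).card : ℝ)
      ≤ N ^ 2 * (2 * r + 1) ^ 2 := by
  classical
  have hsub : ∀ z ∈ latSq N,
      ((((latSq N ×ˢ latSq N).filter fun y => ‖lat y.1 - lat y.2‖ < r).filter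
        fun y => y.2 = z).card : ℝ) ≤ (2 * r + 1) ^ 2 := fun z _ => by
    have h1 : (((latSq N ×ˢ latSq N).filter fun y => ‖lat y.1 - lat y.2‖ < r).filter
        fun y => y.2 = z).card ≤ (((Finset.range N).filter fun x : ℕ => |(x : ℝ) - z.1| < r) ×ˢ
          ((Finset.range N).filter fun x : ℕ => |(x : ℝ) - z.2| < r)).card := by
      refine Finset.card_le_card_of_injOn Prod.fst ?_ ?_
      · rintro ⟨a, b⟩ hy
        simp only [Finset.coe_filter, Finset.mem_filter, Finset.mem_product, latSq,
          mem_ofPred_eq] at hy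
        obtain ⟨⟨⟨ha, -⟩, hlt⟩, rfl⟩ := hy
        simp only [Finset.coe_product, Finset.coe_filter, mem_prod, mem_ofPred_eq]
        have e1 := (Complex.abs_re_le_norm _).trans_lt hlt
        have e2 := (Complex.abs_im_le_norm _).trans_lt hlt
        simp [lat] at e1 e2
        refine ⟨⟨ha.1, e1⟩, ha.2, ?_⟩
        rwa [abs_sub_comm, sub_eq_neg_add]
      · rintro ⟨a, b⟩ hy ⟨a', b'⟩ hy' hab
        simp only [Finset.coe_filter, mem_ofPred_eq] at hy hy'
        exact Prod.ext hab (hy.2.trans hy'.2.symm)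
    calc _ ≤ ((((Finset.range N).filter fun x : ℕ => |(x : ℝ) - z.1| < r) ×ˢ
          ((Finset.range N).filter fun x : ℕ => |(x : ℝ) - z.2| < r)).card : ℝ) := by
          exact_mod_cast h1
      _ ≤ (2 * r + 1) * (2 * r + 1) := by
          rw [Finset.card_product, Nat.cast_mul]
          gcongr
          · exact card_close_le N _ hr
          · exact card_close_le N _ hr
      _ = _ := by ring
  rw [Finset.card_eq_sum_card_fiberwise (f := Prod.snd) (t := latSq N) (by
    intro y hy
    simp only [Finset.coe_filter, Finset.mem_product, mem_ofPred_eq] at hy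
    exact hy.1.2)]
  push_cast
  refine (Finset.sum_le_sum hsub).trans ?_
  simp [latSq, sq]

/-- Counting near-coincidences by Fourier analysis. -/
lemma card_coincidence_le {ι κ σ : Type*} (E : Finset ι) (E' : Finset κ) (Ω : Finset σ)
    (p : ι → ℂ) (p' : κ → ℂ) (Y : σ → ℂ) {N : ℕ} (hN : 0 < N) {r δ : ℝ} (hr : 0 ≤ r)
    (hδ0 : 0 ≤ δ)
    (hδ : ∀ ν ∈ latSq N, ∀ ν' ∈ latSq N, r ≤ ‖lat ν - lat ν'‖ →
      ‖∑ g ∈ Ω, chi (lat ν - lat ν') (Y g)‖ ≤ δ * Ω.card) :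
    (((E ×ˢ E' ×ˢ Ω).filter fun x => ‖p x.1 - p' x.2.1 + Y x.2.2‖ ≤ 1 / (2 * N)).card : ℝ) ≤
      4 * Ω.card * (δ * (energy N E p + energy N E' p') / 2
        + E.card * E'.card * (2 * r + 1) ^ 2 / N ^ 2) := by
  classical
  have hN' : (0:ℝ) < N := by exact_mod_cast hN
  have h1 : (((E ×ˢ E' ×ˢ Ω).filter fun x => ‖p x.1 - p' x.2.1 + Y x.2.2‖ ≤ 1 / (2 * N)).card : ℝ)
      ≤ 4 * ∑ x ∈ E ×ˢ E' ×ˢ Ω, fker N (p x.1 - p' x.2.1 + Y x.2.2) := by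
    rw [Finset.card_filter, Nat.cast_sum, Finset.mul_sum]
    refine Finset.sum_le_sum fun x _ => ?_
    split_ifs with h
    · simpa using one_le_four_mul_fker hN h
    · simpa using fker_nonneg N _
  set A : ℂ → ℝ := fun ξ => ‖∑ e ∈ E, chi ξ (p e)‖ with hA
  set A' : ℂ → ℝ := fun ξ => ‖∑ e ∈ E', chi ξ (p' e)‖ with hA'
  have h2 : ∑ x ∈ E ×ˢ E' ×ˢ Ω, fker N (p x.1 - p' x.2.1 + Y x.2.2)
      ≤ (∑ y ∈ latSq N ×ˢ latSq N, A (lat y.1 - lat y.2) * A' (lat y.1 - lat y.2) *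
        ‖∑ g ∈ Ω, chi (lat y.1 - lat y.2) (Y g)‖) / N ^ 4 := by
    have e1 : ((∑ x ∈ E ×ˢ E' ×ˢ Ω, fker N (p x.1 - p' x.2.1 + Y x.2.2) : ℝ) : ℂ)
        = (∑ y ∈ latSq N ×ˢ latSq N, (∑ e ∈ E, chi (lat y.1 - lat y.2) (p e)) *
          ((starRingEnd ℂ) (∑ e ∈ E', chi (lat y.1 - lat y.2) (p' e)) *
          ∑ g ∈ Ω, chi (lat y.1 - lat y.2) (Y g))) / N ^ 4 := by
      rw [Complex.ofReal_sum]
      simp only [fker_eq]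
      rw [← Finset.sum_div, Finset.sum_comm]
      congr 1
      refine Finset.sum_congr rfl fun y _ => ?_
      simp only [chi_add_right, chi_sub_right]
      rw [map_sum, Finset.sum_mul_sum, ← Finset.sum_product', Finset.sum_mul_sum,
        ← Finset.sum_product']
      exact Finset.sum_congr rfl fun x _ => by ring
    have e2 := Complex.re_le_norm ((∑ x ∈ E ×ˢ E' ×ˢ Ω, fker N (p x.1 - p' x.2.1 + Y x.2.2) : ℝ) : ℂ)
    rw [Complex.ofReal_re, e1, norm_div, norm_pow, Complex.norm_natCast] at e2
    refine e2.trans ?_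
    gcongr
    refine norm_sum_le_of_le _ fun y _ => ?_
    rw [norm_mul, norm_mul, RCLike.norm_conj, mul_assoc]
  have h3 : ∑ y ∈ latSq N ×ˢ latSq N, A (lat y.1 - lat y.2) * A' (lat y.1 - lat y.2) *
        ‖∑ g ∈ Ω, chi (lat y.1 - lat y.2) (Y g)‖ ≤ ∑ y ∈ latSq N ×ˢ latSq N,
        (Ω.card * δ / 2 * (A (lat y.1 - lat y.2) ^ 2 + A' (lat y.1 - lat y.2) ^ 2) +
          (if ‖lat y.1 - lat y.2‖ < r then (E.card * E'.card * Ω.card : ℝ) else 0)) := by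
    refine Finset.sum_le_sum fun y hy => ?_
    rw [Finset.mem_product] at hy
    have a0 : 0 ≤ A (lat y.1 - lat y.2) := norm_nonneg _
    have a0' : 0 ≤ A' (lat y.1 - lat y.2) := norm_nonneg _
    have key : A (lat y.1 - lat y.2) * A' (lat y.1 - lat y.2) ≤
      (A (lat y.1 - lat y.2) ^ 2 + A' (lat y.1 - lat y.2) ^ 2) / 2 := by
      linarith [two_mul_le_add_sq (A (lat y.1 - lat y.2)) (A' (lat y.1 - lat y.2))]
    have hcard : ∀ {τ : Type _} (F : Finset τ) (v : τ → ℂ) (ξ : ℂ),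
        ‖∑ x ∈ F, chi ξ (v x)‖ ≤ F.card := fun F v ξ =>
      (norm_sum_le_of_le _ (n := fun _ => 1) fun a _ => (norm_chi _ _).le).trans (by simp)
    have hcardE : A (lat y.1 - lat y.2) ≤ E.card :=
      (norm_sum_le_of_le _ (n := fun _ => 1) fun a _ => (norm_chi _ _).le).trans (by simp)
    have hcardE' : A' (lat y.1 - lat y.2) ≤ E'.card :=
      (norm_sum_le_of_le _ (n := fun _ => 1) fun a _ => (norm_chi _ _).le).trans (by simp)
    split_ifs with h
    · have e1 : A (lat y.1 - lat y.2) * A' (lat y.1 - lat y.2) *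
        ‖∑ g ∈ Ω, chi (lat y.1 - lat y.2) (Y g)‖ ≤ E.card * E'.card * Ω.card := by
        gcongr
        exact hcard Ω Y _
      have : 0 ≤ Ω.card * δ / 2 * (A (lat y.1 - lat y.2) ^ 2 + A' (lat y.1 - lat y.2) ^ 2) := by
        positivity
      linarith
    · rw [add_zero]
      calc _ ≤ (A (lat y.1 - lat y.2) ^ 2 + A' (lat y.1 - lat y.2) ^ 2) / 2 * (δ * Ω.card) := by
            gcongr
            exact hδ _ hy.1 _ hy.2 (not_lt.1 h)
        _ = _ := by ring
  have h4 : ∑ y ∈ latSq N ×ˢ latSq N,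
        (Ω.card * δ / 2 * (A (lat y.1 - lat y.2) ^ 2 + A' (lat y.1 - lat y.2) ^ 2) +
          (if ‖lat y.1 - lat y.2‖ < r then (E.card * E'.card * Ω.card : ℝ) else 0))
      ≤ Ω.card * δ / 2 * (N ^ 4 * (energy N E p + energy N E' p')) +
        N ^ 2 * (2 * r + 1) ^ 2 * (E.card * E'.card * Ω.card) := by
    rw [Finset.sum_add_distrib, ← Finset.mul_sum, Finset.sum_add_distrib, energy_eq, energy_eq,
      ← Finset.sum_filter, Finset.sum_const, nsmul_eq_mul]
    gcongr
    · apply le_of_eq; field_simp; rfl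
    · exact card_lat_close_le N hr
  calc _ ≤ 4 * ((Ω.card * δ / 2 * (N ^ 4 * (energy N E p + energy N E' p')) +
        N ^ 2 * (2 * r + 1) ^ 2 * (E.card * E'.card * Ω.card)) / N ^ 4) := by
        refine h1.trans ?_
        gcongr
        refine h2.trans ?_
        gcongr
        exact h3.trans h4
    _ = _ := by field_simp

/-- One-dimensional decay weight. -/
def decayWt (i : ℤ) : ℝ := 1 / (1 + (i : ℝ) ^ 2)

lemma decayWt_nonneg (i : ℤ) : 0 ≤ decayWt i := by unfold decayWt; positivity

lemma summable_decayWt : Summable decayWt := by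
  have h := (Real.summable_one_div_int_pow (p := 2)).2 (by norm_num)
  refine Summable.of_norm_bounded_eventually h ?_
  filter_upwards [(Set.finite_singleton (0 : ℤ)).compl_mem_cofinite] with i hi
  have : (i : ℝ) ≠ 0 := by simpa using hi
  have h2 : 0 < (i : ℝ) ^ 2 := by positivity
  rw [Real.norm_of_nonneg (decayWt_nonneg i), decayWt]
  gcongr
  linarith

lemma dirichlet_sq_le {N : ℕ} (hN : 0 < N) {x : ℝ} (hx : |x| ≤ π) :
    ‖∑ a ∈ Finset.range N, Complex.exp ((x * a : ℝ) * Complex.I)‖ ^ 2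
      ≤ N ^ 2 * (88 * decayWt ⌊2 * N * x⌋) := by
  have hN' : (0:ℝ) < N := by exact_mod_cast hN
  have hπ2 : π ^ 2 ≤ 10 := by nlinarith [pi_lt_d2, pi_gt_three]
  have h1 : ‖∑ a ∈ Finset.range N, Complex.exp ((x * a : ℝ) * Complex.I)‖ ^ 2 * (1 + (N * x) ^ 2)
      ≤ 11 * N ^ 2 := by
    have htriv : ‖∑ a ∈ Finset.range N, Complex.exp ((x * a : ℝ) * Complex.I)‖ ≤ N :=
      (norm_sum_le_of_le _ (n := fun _ => 1) fun a _ =>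
        (Complex.norm_exp_ofReal_mul_I _).le).trans (by simp)
    have h2 : ‖∑ a ∈ Finset.range N, Complex.exp ((x * a : ℝ) * Complex.I)‖ * |x| ≤ π := by
      rcases eq_or_ne x 0 with rfl | hx0
      · simp [pi_pos.le]
      · have := norm_geom_exp_le x hx0 hx N
        rwa [le_div_iff₀ (abs_pos.2 hx0)] at this
    set D := ‖∑ a ∈ Finset.range N, Complex.exp ((x * a : ℝ) * Complex.I)‖
    have hD : 0 ≤ D := norm_nonneg _
    have e1 : D ^ 2 ≤ N ^ 2 := by gcongr
    have e2 : D ^ 2 * x ^ 2 ≤ π ^ 2 := by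
      rw [← sq_abs x, ← mul_pow]; gcongr
    calc D ^ 2 * (1 + (N * x) ^ 2) = D ^ 2 + (N:ℝ) ^ 2 * (D ^ 2 * x ^ 2) := by ring
      _ ≤ (N:ℝ) ^ 2 + (N:ℝ) ^ 2 * 10 := by gcongr; linarith
      _ = _ := by ring
  set i := ⌊2 * N * x⌋
  have hi1 : (i : ℝ) ≤ 2 * N * x := Int.floor_le _
  have hi2 : 2 * N * x < i + 1 := Int.lt_floor_add_one _
  have hi : 1 + (i : ℝ) ^ 2 ≤ 8 * (1 + (N * x) ^ 2) := by
    nlinarith [sq_nonneg (2 * (N * x) + 1), sq_nonneg (2 * (N * x) - 1), sq_nonneg (i - 2 * (N * x))]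
  rw [decayWt, mul_one_div, mul_div_assoc', le_div_iff₀ (by positivity)]
  have hD := sq_nonneg ‖∑ a ∈ Finset.range N, Complex.exp ((x * a : ℝ) * Complex.I)‖
  nlinarith

lemma fker_le {N : ℕ} (hN : 0 < N) {w : ℂ} (hw : ‖w‖ ≤ 1) :
    fker N w ≤ 88 ^ 2 * (decayWt ⌊2 * N * w.re⌋ * decayWt ⌊2 * N * w.im⌋) := by
  have hN' : (0:ℝ) < N := by exact_mod_cast hN
  have hprod : ∑ ν ∈ latSq N, chi (lat ν) w
      = (∑ a ∈ Finset.range N, Complex.exp ((w.re * a : ℝ) * Complex.I)) *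
        ∑ a ∈ Finset.range N, Complex.exp ((w.im * a : ℝ) * Complex.I) := by
    rw [latSq, Finset.sum_product, Finset.sum_mul_sum]
    refine Finset.sum_congr rfl fun a _ => Finset.sum_congr rfl fun b _ => ?_
    rw [chi, lat_mul_re, ← Complex.exp_add]
    congr 1; push_cast; ring
  rw [fker, hprod, norm_mul, mul_pow, div_le_iff₀ (by positivity)]
  have hπ := pi_gt_three
  have h1 := dirichlet_sq_le hN (x := w.re) ((Complex.abs_re_le_norm w).trans (by linarith))
  have h2 := dirichlet_sq_le hN (x := w.im) ((Complex.abs_im_le_norm w).trans (by linarith))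
  have := decayWt_nonneg ⌊2 * N * w.re⌋
  calc _ ≤ (N ^ 2 * (88 * decayWt ⌊2 * N * w.re⌋)) * (N ^ 2 * (88 * decayWt ⌊2 * N * w.im⌋)) := by
        gcongr
    _ = _ := by ring

/-- The absolute constant in the energy bound. -/
def energyC : ℝ := (88 * ∑' i : ℤ, decayWt i) ^ 2

lemma energyC_nonneg : 0 ≤ energyC := sq_nonneg _

lemma energy_le {ι : Type*} {N : ℕ} (hN : 0 < N) (E : Finset ι) (p : ι → ℂ) {M : ℝ}
    (hM : ∀ e ∈ E, ((E.filter fun e' => ‖p e - p e'‖ ≤ 1 / N).card : ℝ) ≤ M)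
    (hp : ∀ e ∈ E, ∀ e' ∈ E, ‖p e - p e'‖ ≤ 1) :
    energy N E p ≤ energyC * (E.card * M) := by
  classical
  have hN' : (0:ℝ) < N := by exact_mod_cast hN
  rw [energy, Finset.sum_product]
  have key : ∀ e ∈ E, ∑ e' ∈ E, fker N (p e - p e') ≤ energyC * M := by
    intro e he
    have hM0 : 0 ≤ M := (Nat.cast_nonneg _).trans (hM e he)
    set f : ι → ℤ × ℤ := fun e' => (⌊2 * N * (p e - p e').re⌋, ⌊2 * N * (p e - p e').im⌋) with hf
    set I := (E.image f).image Prod.fst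
    set L := (E.image f).image Prod.snd
    have hmaps : ∀ x ∈ E, f x ∈ I ×ˢ L := fun x hx => by
      rw [Finset.mem_product]
      exact ⟨Finset.mem_image_of_mem _ (Finset.mem_image_of_mem _ hx),
        Finset.mem_image_of_mem _ (Finset.mem_image_of_mem _ hx)⟩
    have hfib : ∀ y : ℤ × ℤ, ((E.filter fun x => f x = y).card : ℝ) ≤ M := by
      intro y
      rcases (E.filter fun x => f x = y).eq_empty_or_nonempty with h | ⟨x₀, hx₀⟩
      · simp [h, hM0]
      · rw [Finset.mem_filter] at hx₀
        refine le_trans ?_ (hM x₀ hx₀.1)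
        norm_cast
        refine Finset.card_le_card fun x hx => ?_
        rw [Finset.mem_filter] at hx ⊢
        refine ⟨hx.1, ?_⟩
        have heq : f x = f x₀ := hx.2.trans hx₀.2.symm
        have h1 : ⌊2 * N * (p e - p x).re⌋ = ⌊2 * N * (p e - p x₀).re⌋ := congrArg Prod.fst heq
        have h2 : ⌊2 * N * (p e - p x).im⌋ = ⌊2 * N * (p e - p x₀).im⌋ := congrArg Prod.snd heq
        have h1' := Int.abs_sub_lt_one_of_floor_eq_floor h1
        have h2' := Int.abs_sub_lt_one_of_floor_eq_floor h2
        rw [← mul_sub, abs_mul, abs_of_pos (by positivity)] at h1' h2'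
        have e1 : |(p x₀ - p x).re| ≤ 1 / (2 * N) := by
          rw [le_div_iff₀ (by positivity), mul_comm]
          rw [show (p e - p x).re - (p e - p x₀).re = (p x₀ - p x).re by simp] at h1'
          exact h1'.le
        have e2 : |(p x₀ - p x).im| ≤ 1 / (2 * N) := by
          rw [le_div_iff₀ (by positivity), mul_comm]
          rw [show (p e - p x).im - (p e - p x₀).im = (p x₀ - p x).im by simp] at h2'
          exact h2'.le
        refine (Complex.norm_le_abs_re_add_abs_im _).trans ((add_le_add e1 e2).trans ?_)
        apply le_of_eq; field_simp; norm_num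
    calc ∑ e' ∈ E, fker N (p e - p e')
        ≤ ∑ e' ∈ E, 88 ^ 2 * (decayWt (f e').1 * decayWt (f e').2) :=
          Finset.sum_le_sum fun e' he' => fker_le hN (hp e he e' he')
      _ = ∑ y ∈ I ×ˢ L, ∑ e' ∈ E.filter (fun x => f x = y),
            88 ^ 2 * (decayWt (f e').1 * decayWt (f e').2) :=
          (Finset.sum_fiberwise_of_maps_to hmaps _).symm
      _ ≤ ∑ y ∈ I ×ˢ L, M * (88 ^ 2 * (decayWt y.1 * decayWt y.2)) := by
          refine Finset.sum_le_sum fun y _ => ?_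
          rw [Finset.sum_congr rfl (g := fun _ => 88 ^ 2 * (decayWt y.1 * decayWt y.2))
            fun x hx => by rw [(Finset.mem_filter.1 hx).2], Finset.sum_const, nsmul_eq_mul]
          have := decayWt_nonneg y.1
          have := decayWt_nonneg y.2
          gcongr
          exact hfib y
      _ = M * 88 ^ 2 * ((∑ i ∈ I, decayWt i) * ∑ l ∈ L, decayWt l) := by
          rw [← Finset.mul_sum, ← Finset.mul_sum, Finset.sum_product, Finset.sum_mul_sum]; ring
      _ ≤ M * 88 ^ 2 * ((∑' i, decayWt i) * ∑' l, decayWt l) := by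
          have hI := summable_decayWt.sum_le_tsum I fun i _ => decayWt_nonneg i
          have hL := summable_decayWt.sum_le_tsum L fun i _ => decayWt_nonneg i
          have := Finset.sum_nonneg (s := L) fun i _ => decayWt_nonneg i
          have : 0 ≤ ∑' i, decayWt i := tsum_nonneg decayWt_nonneg
          gcongr
      _ = energyC * M := by rw [energyC]; ring
  refine (Finset.sum_le_sum key).trans (le_of_eq ?_)
  simp; ring

/-- The complex form of the Weierstrass function. -/
def Wc (x : ℝ) : ℂ := ∑' n : ℕ, ((sq2 ^ n : ℝ) : ℂ) * wexp (2 ^ n * x)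

lemma norm_Wc_term (x : ℝ) (n : ℕ) : ‖((sq2 ^ n : ℝ) : ℂ) * wexp (2 ^ n * x)‖ = sq2 ^ n := by
  rw [norm_mul, norm_wexp, mul_one, Complex.norm_real,
    Real.norm_of_nonneg (pow_nonneg sq2_pos.le _)]

lemma summable_sq2 : Summable fun n : ℕ => sq2 ^ n :=
  summable_geometric_of_lt_one sq2_pos.le (by linarith [sq2_lt])

lemma summable_Wc (x : ℝ) : Summable fun n : ℕ => ((sq2 ^ n : ℝ) : ℂ) * wexp (2 ^ n * x) :=
  Summable.of_norm (by simpa only [norm_Wc_term] using summable_sq2)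

lemma tsum_sq2_le : ∑' n : ℕ, sq2 ^ n ≤ 4 := by
  rw [tsum_geometric_of_lt_one sq2_pos.le (by linarith [sq2_lt])]
  rw [inv_le_comm₀ (by linarith [sq2_lt]) (by norm_num)]
  linarith [sq2_lt]

lemma norm_Wc_le (x : ℝ) : ‖Wc x‖ ≤ 4 := by
  refine (norm_tsum_le_tsum_norm ?_).trans ?_
  · simpa only [norm_Wc_term] using summable_sq2
  · simpa only [norm_Wc_term] using tsum_sq2_le

lemma Wc_add_int (x : ℝ) (m : ℤ) : Wc (x + m) = Wc x := by
  unfold Wc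
  congr 1; ext n
  have : (2:ℝ) ^ n * (x + m) = 2 ^ n * x + ((2 ^ n * m : ℤ) : ℝ) := by push_cast; ring
  rw [this, wexp_add_int]

lemma Wc_eq (x : ℝ) : Wc x = wexp x + sq2 * Wc (2 * x) := by
  unfold Wc
  rw [(summable_Wc x).tsum_eq_zero_add, ← tsum_mul_left]
  simp only [pow_zero, Complex.ofReal_one, one_mul]
  congr 2; ext n
  rw [pow_succ, pow_succ]; push_cast; ring_nf

lemma continuous_wexp : Continuous wexp := by unfold wexp; fun_prop

lemma continuous_Wc : Continuous Wc := by
  unfold Wc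
  refine continuous_tsum (u := fun n => sq2 ^ n) (fun n => ?_) summable_sq2 fun n x => ?_
  · exact continuous_const.mul (continuous_wexp.comp (by fun_prop))
  · exact (norm_Wc_term x n).le

lemma Wc_eq_four (x : ℝ) :
    Wc x = (wexp x + sq2 * wexp (2 * x)) + (1 / 2 : ℂ) * Wc (4 * x) := by
  have h : ((sq2 : ℂ)) * sq2 = 1 / 2 := by
    rw [← Complex.ofReal_mul, ← sq, sq2_sq]; norm_num
  rw [Wc_eq x, Wc_eq (2 * x), mul_add, ← mul_assoc, h, ← mul_assoc]; norm_num; ring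

lemma Wc_low_freq_le (x y : ℝ) :
    ‖(wexp x + sq2 * wexp (2 * x)) - (wexp y + sq2 * wexp (2 * y))‖ ≤ 16 * |x - y| := by
  have h1 := norm_wexp_sub_le x y
  have h2 := norm_wexp_sub_le (2 * x) (2 * y)
  rw [← mul_sub, abs_mul, abs_two] at h2
  have h3 : (wexp x + sq2 * wexp (2 * x)) - (wexp y + sq2 * wexp (2 * y))
      = (wexp x - wexp y) + sq2 * (wexp (2 * x) - wexp (2 * y)) := by ring
  rw [h3]
  refine (norm_add_le _ _).trans ?_
  rw [norm_mul, Complex.norm_real, Real.norm_of_nonneg sq2_pos.le]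
  have h4 : sq2 * ‖wexp (2 * x) - wexp (2 * y)‖ ≤ 0.7072 * (2 * π * (2 * |x - y|)) := by
    have := sq2_lt.le
    gcongr
  have h5 : 0 ≤ |x - y| := abs_nonneg _
  nlinarith [pi_lt_d2]

lemma Wc_sub_le (k : ℕ) : ∀ x y : ℝ,
    ‖Wc x - Wc y‖ ≤ 16 * (2 ^ k - 1) * |x - y| + 8 / 2 ^ k := by
  induction k with
  | zero =>
    intro x y
    have := norm_sub_le (Wc x) (Wc y)
    have := norm_Wc_le x
    have := norm_Wc_le y
    norm_num; linarith
  | succ k ih =>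
    intro x y
    have h := ih (4 * x) (4 * y)
    rw [← mul_sub, abs_mul, abs_of_pos (by norm_num : (0:ℝ) < 4)] at h
    rw [Wc_eq_four x, Wc_eq_four y, add_sub_add_comm, ← mul_sub]
    refine (norm_add_le _ _).trans ?_
    have h1 := Wc_low_freq_le x y
    rw [norm_mul]
    have : ‖(1 / 2 : ℂ)‖ = 1 / 2 := by norm_num
    rw [this]
    have e : (8:ℝ) / 2 ^ (k + 1) = 1 / 2 * (8 / 2 ^ k) := by rw [pow_succ]; field_simp
    rw [e, pow_succ]
    nlinarith

lemma Wc_sub_le' (k : ℕ) (x y : ℝ) :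
    ‖Wc x - Wc y‖ ≤ 16 * 2 ^ k * |x - y| + 8 / 2 ^ k := by
  refine (Wc_sub_le k x y).trans ?_
  have := abs_nonneg (x - y)
  nlinarith

lemma Wc_scale_le (z : ℕ) (x y : ℝ) :
    ‖Wc (4 ^ z * x) - Wc (4 ^ z * y)‖ ≤ 2 ^ z * ‖Wc x - Wc y‖ + 16 * 4 ^ z * |x - y| := by
  induction z with
  | zero => simp
  | succ z ih =>
    have h1 := Wc_low_freq_le (4 ^ z * x) (4 ^ z * y)
    rw [← mul_sub, abs_mul, abs_of_pos (by positivity : (0:ℝ) < 4 ^ z)] at h1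
    have h2 : Wc (4 ^ (z + 1) * x) - Wc (4 ^ (z + 1) * y)
        = 2 * ((Wc (4 ^ z * x) - Wc (4 ^ z * y)) -
          ((wexp (4 ^ z * x) + sq2 * wexp (2 * (4 ^ z * x)))
            - (wexp (4 ^ z * y) + sq2 * wexp (2 * (4 ^ z * y))))) := by
      rw [Wc_eq_four (4 ^ z * x), Wc_eq_four (4 ^ z * y), pow_succ]; ring_nf
    rw [h2, norm_mul, Complex.norm_ofNat, pow_succ, pow_succ]
    have h3 := norm_sub_le (Wc (4 ^ z * x) - Wc (4 ^ z * y))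
      ((wexp (4 ^ z * x) + sq2 * wexp (2 * (4 ^ z * x)))
            - (wexp (4 ^ z * y) + sq2 * wexp (2 * (4 ^ z * y))))
    linarith

/-- The part of `W` at scales above the unit scale. -/
def Zs (T : ℕ) (w : ℝ) : ℂ :=
  ∑ i ∈ Finset.range T, (((sq2 ^ (i + 1))⁻¹ : ℝ) : ℂ) * wexp (w / 2 ^ (i + 1))

lemma Wc_div_two_pow (T : ℕ) (w : ℝ) :
    Wc (w / 2 ^ T) = (sq2 ^ T : ℝ) * (Zs T w + Wc w) := by
  induction T with
  | zero => simp [Zs]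
  | succ T ih =>
    have hs : (sq2 : ℂ) ≠ 0 := by exact_mod_cast sq2_pos.ne'
    rw [Wc_eq, show 2 * (w / 2 ^ (T + 1)) = w / 2 ^ T by rw [pow_succ]; field_simp, ih]
    unfold Zs
    rw [Finset.sum_range_succ]
    push_cast
    field_simp
    ring

lemma wexp_taylor_le (x y : ℝ) :
    ‖wexp x - wexp y - 2 * π * Complex.I * (x - y) * wexp y‖ ≤ (2 * π) ^ 2 * |x - y| ^ 2 := by
  have h1 : wexp x - wexp y - 2 * π * Complex.I * (x - y) * wexp y
      = wexp y * (Complex.exp (((2 * π * (x - y) : ℝ)) * Complex.I) - 1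
        - ((2 * π * (x - y) : ℝ)) * Complex.I) := by
    have : wexp x = wexp y * Complex.exp (((2 * π * (x - y) : ℝ)) * Complex.I) := by
      change _ = wexp y * wexp (x - y)
      rw [← wexp_add]; ring_nf
    rw [this]; push_cast; ring
  rw [h1, norm_mul, norm_wexp, one_mul]
  set θ := 2 * π * (x - y) with hθ
  have hθ2 : (2 * π) ^ 2 * |x - y| ^ 2 = θ ^ 2 := by rw [sq_abs, hθ]; ring
  rw [hθ2]
  have hd : ∀ s : ℝ, HasDerivAt (fun s : ℝ => Complex.exp (s * Complex.I) - 1 - s * Complex.I)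
      (Complex.exp (s * Complex.I) * Complex.I - Complex.I) s := fun s => by
    have h0 : HasDerivAt (fun s : ℝ => (s : ℂ) * Complex.I) Complex.I s := by
      simpa using (hasDerivAt_id s).ofReal_comp.mul_const Complex.I
    exact (h0.cexp.sub_const 1).sub h0
  have := Convex.norm_image_sub_le_of_norm_hasDerivWithin_le
    (f := fun s : ℝ => Complex.exp (s * Complex.I) - 1 - s * Complex.I)
    (f' := fun s => Complex.exp (s * Complex.I) * Complex.I - Complex.I) (C := |θ|)
    (s := Icc (-|θ|) |θ|) (x := 0) (y := θ) (fun s _ => (hd s).hasDerivWithinAt)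
    (fun s hs => by
      have := norm_exp_mul_I_sub_le s 0
      rw [← sub_one_mul, norm_mul, Complex.norm_I, mul_one]
      simp only [Complex.ofReal_zero, zero_mul, Complex.exp_zero, sub_zero] at this
      exact this.trans (abs_le.2 hs))
    (convex_Icc _ _) ⟨by simp, by simp⟩ ⟨neg_abs_le _, le_abs_self _⟩
  simpa [← sq] using this

lemma sum_sq2_le (T : ℕ) : ∑ i ∈ Finset.range T, sq2 ^ (i + 1) ≤ 4 := by
  refine le_trans (Finset.sum_le_sum fun i _ => ?_)
    ((summable_sq2.sum_le_tsum (Finset.range T) fun i _ => pow_nonneg sq2_pos.le _).trans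
      tsum_sq2_le)
  exact pow_le_pow_of_le_one sq2_pos.le sq2_le_one (by omega)

lemma norm_Xs_le (T : ℕ) (w : ℝ) : ‖Xs T w‖ ≤ 4 := by
  refine (norm_sum_le_of_le _ (n := fun i => sq2 ^ (i + 1)) fun i _ => ?_).trans (sum_sq2_le T)
  rw [norm_mul, norm_wexp, mul_one, Complex.norm_real,
    Real.norm_of_nonneg (pow_nonneg sq2_pos.le _)]

/-- Linearisation of the large-scale part. -/
lemma Zs_sub_linear_le (T : ℕ) {w w' γ δ₀ ρ ρ' ε : ℝ} (h1 : |w - w'| ≤ ρ) (h2 : |w' - γ| ≤ ρ')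
    (h3 : |(w - w') - δ₀| ≤ ε) :
    ‖Zs T w - Zs T w' - 2 * π * Complex.I * δ₀ * Xs T γ‖
      ≤ 4 * ((2 * π) ^ 2 * ρ * (ρ + ρ') + 2 * π * ε) := by
  have hρ : 0 ≤ ρ := (abs_nonneg _).trans h1
  have hρ' : 0 ≤ ρ' := (abs_nonneg _).trans h2
  have hε : 0 ≤ ε := (abs_nonneg _).trans h3
  unfold Zs Xs
  rw [← Finset.sum_sub_distrib, Finset.mul_sum, ← Finset.sum_sub_distrib]
  have hterm : ∀ i ∈ Finset.range T, ‖(((sq2 ^ (i + 1))⁻¹ : ℝ) : ℂ) * wexp (w / 2 ^ (i + 1)) -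
      (((sq2 ^ (i + 1))⁻¹ : ℝ) : ℂ) * wexp (w' / 2 ^ (i + 1)) -
      2 * π * Complex.I * δ₀ * (((sq2 ^ (i + 1) : ℝ) : ℂ) * wexp (γ / 2 ^ (i + 1)))‖
      ≤ sq2 ^ (i + 1) * ((2 * π) ^ 2 * ρ * (ρ + ρ') + 2 * π * ε) := fun i _ => by
    set l := i + 1
    have hs := sq2_pos
    have hinv : (sq2 ^ l)⁻¹ = 2 ^ l * sq2 ^ l := by
      have : sq2 ^ l * sq2 ^ l * 2 ^ l = 1 := by
        rw [← sq, ← pow_mul, mul_comm l 2, sq2_pow_two_mul]; field_simp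
      field_simp; linarith
    have h2l : (1:ℝ) ≤ 2 ^ l := one_le_pow₀ (by norm_num)
    have e0 : (((sq2 ^ l)⁻¹ : ℝ) : ℂ) * wexp (w / 2 ^ l) -
      (((sq2 ^ l)⁻¹ : ℝ) : ℂ) * wexp (w' / 2 ^ l) -
      2 * π * Complex.I * δ₀ * (((sq2 ^ l : ℝ) : ℂ) * wexp (γ / 2 ^ l))
      = ((sq2 ^ l : ℝ) : ℂ) * (2 ^ l * (wexp (w / 2 ^ l) - wexp (w' / 2 ^ l)
          - 2 * π * Complex.I * (((w / 2 ^ l : ℝ) : ℂ) - ((w' / 2 ^ l : ℝ) : ℂ)) *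
            wexp (w' / 2 ^ l))
        + 2 * π * Complex.I * ((w - w' : ℝ) : ℂ) * (wexp (w' / 2 ^ l) - wexp (γ / 2 ^ l))
        + 2 * π * Complex.I * (((w - w') - δ₀ : ℝ) : ℂ) * wexp (γ / 2 ^ l)) := by
      rw [hinv]; push_cast; field_simp; ring
    have hI : ‖(2 * π * Complex.I : ℂ)‖ = 2 * π := by simp [abs_of_pos pi_pos]
    rw [e0, norm_mul, Complex.norm_real, Real.norm_of_nonneg (pow_nonneg hs.le _)]
    gcongr
    have t1 := wexp_taylor_le (w / 2 ^ l) (w' / 2 ^ l)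
    have t2 := norm_wexp_sub_le (w' / 2 ^ l) (γ / 2 ^ l)
    rw [← sub_div, abs_div, abs_of_pos (by positivity : (0:ℝ) < 2 ^ l)] at t1 t2
    clear e0
    generalize (2 * π * Complex.I : ℂ) = J at hI t1 ⊢
    refine (norm_add₃_le).trans ?_
    rw [norm_mul, norm_mul, norm_mul, norm_mul, norm_mul, hI, norm_wexp, Complex.norm_real,
      Complex.norm_real, Real.norm_eq_abs, Real.norm_eq_abs, norm_pow, Complex.norm_ofNat, mul_one]
    have t1' : (2:ℝ) ^ l * ((2 * π) ^ 2 * (|w - w'| / 2 ^ l) ^ 2) ≤ (2 * π) ^ 2 * ρ * ρ := by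
      have : (2:ℝ) ^ l * ((2 * π) ^ 2 * (|w - w'| / 2 ^ l) ^ 2)
        = (2 * π) ^ 2 * |w - w'| * |w - w'| / 2 ^ l := by field_simp
      rw [this]
      refine (div_le_self (by positivity) h2l).trans ?_
      gcongr
    have t2' : 2 * π * (|w' - γ| / 2 ^ l) ≤ 2 * π * ρ' := by
      gcongr
      exact (div_le_self (by positivity) h2l).trans h2
    calc _ ≤ (2 * π) ^ 2 * ρ * ρ + 2 * π * ρ * (2 * π * ρ') + 2 * π * ε := by
          refine add_le_add (add_le_add (le_trans ?_ t1') ?_) ?_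
          · gcongr
          · have := t2.trans t2'
            gcongr
          · gcongr
      _ = _ := by ring
  refine (norm_sum_le_of_le _ hterm).trans ?_
  rw [← Finset.sum_mul]
  gcongr
  exact sum_sq2_le T

/-- The graph points over `c / 4 ^ k` and `d / 4 ^ k` are at distance of order `2 ^ (-k)`. -/
def Near (K : ℝ) (k : ℕ) (c d : ℤ) : Prop :=
  |(c : ℝ) - d| ≤ K * 2 ^ k ∧ ‖Wc (c / 4 ^ k) - Wc (d / 4 ^ k)‖ ≤ K / 2 ^ k

lemma Near.mono {K K' : ℝ} (h : K ≤ K') {k : ℕ} {c d : ℤ} (hn : Near K k c d) :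
    Near K' k c d :=
  ⟨hn.1.trans (by gcongr), hn.2.trans (by gcongr)⟩

lemma near_add_period {K : ℝ} {k : ℕ} {c d : ℤ} (m : ℤ) (hn : Near K k c d) :
    Near K k (c + 4 ^ k * m) (d + 4 ^ k * m) := by
  have h : ∀ x : ℤ, Wc (((x + 4 ^ k * m : ℤ) : ℝ) / 4 ^ k) = Wc (x / 4 ^ k) := fun x => by
    rw [← Wc_add_int (x / 4 ^ k) m]
    congr 1; push_cast; field_simp
  refine ⟨?_, ?_⟩
  · have := hn.1
    push_cast
    rwa [add_sub_add_right_eq_sub]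
  · rw [h, h]; exact hn.2

lemma four_pow_eq_sq (n : ℕ) : (4 : ℝ) ^ n = 2 ^ n * 2 ^ n := by
  rw [← mul_pow]; norm_num

/-- The constant in the linearisation estimate. -/
def linC (K : ℝ) : ℝ := K + 4 * ((2 * π) ^ 2 * K * (2 * K + 1) + 2 * π)

lemma digit_diff_le {t q : ℕ} {e e' : ℤ} (he : 0 ≤ e) (he4 : e < 4 ^ t) (he' : 0 ≤ e')
    (he4' : e' < 4 ^ t) : |(e : ℝ) / 4 ^ (q + t) - e' / 4 ^ (q + t)| ≤ 1 / 4 ^ q := by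
  rw [← sub_div, abs_div, abs_of_pos (by positivity : (0:ℝ) < 4 ^ (q + t)), pow_add,
    div_le_div_iff₀ (by positivity) (by positivity)]
  have : |(e : ℝ) - e'| ≤ 4 ^ t := by
    have h1 : (0:ℝ) ≤ e := by exact_mod_cast he
    have h2 : (e:ℝ) ≤ 4 ^ t := by exact_mod_cast he4.le
    have h3 : (0:ℝ) ≤ e' := by exact_mod_cast he'
    have h4 : (e':ℝ) ≤ 4 ^ t := by exact_mod_cast he4'.le
    rw [abs_le]; constructor <;> linarith
  calc _ ≤ (4:ℝ) ^ t * 4 ^ q := by gcongr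
    _ = _ := by ring

lemma digit_le {t q : ℕ} {e : ℤ} (he : 0 ≤ e) (he4 : e < 4 ^ t) :
    |(e : ℝ) / 4 ^ (q + t)| ≤ 1 / 4 ^ q := by
  have := digit_diff_le (q := q) he he4 le_rfl (by positivity : (0:ℤ) < 4 ^ t)
  simpa using this

section Linearization

variable {K : ℝ} {q t : ℕ} {g c d e e' : ℤ}

lemma near_arg_diff
    (h : Near K (q + 2 * t) (e + 4 ^ t * (c + 4 ^ q * g)) (e' + 4 ^ t * (d + 4 ^ q * g))) :
    |((g : ℝ) + (c / 4 ^ q + e / 4 ^ (q + t))) - (g + (d / 4 ^ q + e' / 4 ^ (q + t)))|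
      ≤ K / 2 ^ q := by
  have h1 := h.1
  have e1 : ((g : ℝ) + (c / 4 ^ q + e / 4 ^ (q + t))) - (g + (d / 4 ^ q + e' / 4 ^ (q + t)))
    = (((e + 4 ^ t * (c + 4 ^ q * g) : ℤ) : ℝ) - ((e' + 4 ^ t * (d + 4 ^ q * g) : ℤ) : ℝ))
      / 4 ^ (q + t) := by
    push_cast; rw [pow_add]; field_simp; ring
  rw [e1, abs_div, abs_of_pos (by positivity : (0:ℝ) < 4 ^ (q + t)), div_le_iff₀ (by positivity)]
  refine h1.trans (le_of_eq ?_)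
  rw [four_pow_eq_sq, pow_add, pow_add, two_mul, pow_add]; field_simp

lemma near_linear (hK : 0 ≤ K) (hqt : t ≤ q) (he : 0 ≤ e) (he4 : e < 4 ^ t) (he' : 0 ≤ e')
    (he4' : e' < 4 ^ t)
    (h : Near K (q + 2 * t) (e + 4 ^ t * (c + 4 ^ q * g)) (e' + 4 ^ t * (d + 4 ^ q * g))) :
    ‖(2:ℂ) ^ q * Wc (c / 4 ^ q + e / 4 ^ (q + t)) - 2 ^ q * Wc (d / 4 ^ q + e' / 4 ^ (q + t))
      + (2 * π * Complex.I * (c - d) / 2 ^ q) * Xs (2 * t) (g + c / 4 ^ q)‖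
      ≤ linC K / 2 ^ t := by
  set x : ℝ := c / 4 ^ q + e / 4 ^ (q + t) with hx
  set y : ℝ := d / 4 ^ q + e' / 4 ^ (q + t) with hy
  have a1 := near_arg_diff h
  rw [← hx, ← hy] at a1
  have a2 : |((g:ℝ) + y) - (g + c / 4 ^ q)| ≤ K / 2 ^ q + 1 / 4 ^ q := by
    have : ((g:ℝ) + y) - (g + c / 4 ^ q) = e / 4 ^ (q + t) - ((g + x) - (g + y)) := by
      rw [hx]; ring
    rw [this]
    refine (abs_sub _ _).trans ?_
    have := digit_le (q := q) he he4
    linarith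
  have a3 : |((g:ℝ) + x) - (g + y) - (c / 4 ^ q - d / 4 ^ q)| ≤ 1 / 4 ^ q := by
    have : ((g:ℝ) + x) - (g + y) - (c / 4 ^ q - d / 4 ^ q)
      = e / 4 ^ (q + t) - e' / 4 ^ (q + t) := by rw [hx, hy]; ring
    rw [this]
    exact digit_diff_le he he4 he' he4'
  have hl := Zs_sub_linear_le (2 * t) a1 a2 a3
  have hW : ∀ v : ℝ, Wc ((g + v) / 2 ^ (2 * t)) = (1 / 2 ^ t : ℂ) * (Zs (2 * t) (g + v) + Wc v) :=
    fun v => by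
      rw [Wc_div_two_pow, sq2_pow_two_mul, add_comm (g : ℝ) v, Wc_add_int]
      push_cast; rfl
  have hn := h.2
  have hX : ((e + 4 ^ t * (c + 4 ^ q * g) : ℤ) : ℝ) / 4 ^ (q + 2 * t) = (g + x) / 2 ^ (2 * t) := by
    rw [hx, pow_mul 2 2 t, two_mul, pow_add, pow_add, pow_add]; push_cast
    norm_num; field_simp; ring
  have hY : ((e' + 4 ^ t * (d + 4 ^ q * g) : ℤ) : ℝ) / 4 ^ (q + 2 * t) = (g + y) / 2 ^ (2 * t) := by
    rw [hy, pow_mul 2 2 t, two_mul, pow_add, pow_add, pow_add]; push_cast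
    norm_num; field_simp; ring
  rw [hX, hY, hW, hW, ← mul_sub, norm_mul] at hn
  have hn1 : ‖(Zs (2 * t) (g + x) + Wc x) - (Zs (2 * t) (g + y) + Wc y)‖ ≤ K / 2 ^ (q + t) := by
    have e2 : ‖(1 / 2 ^ t : ℂ)‖ = 1 / 2 ^ t := by simp
    rw [e2] at hn
    have e3 : K / 2 ^ (q + t) = 2 ^ t * (K / 2 ^ (q + 2 * t)) := by
      rw [pow_add, pow_add, two_mul, pow_add]; field_simp
    rw [e3]
    calc _ = 2 ^ t * (1 / 2 ^ t *
          ‖(Zs (2 * t) (g + x) + Wc x) - (Zs (2 * t) (g + y) + Wc y)‖) := by field_simp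
      _ ≤ _ := by gcongr
  have key : (2:ℂ) ^ q * Wc x - 2 ^ q * Wc y
      + (2 * π * Complex.I * (c - d) / 2 ^ q) * Xs (2 * t) (g + c / 4 ^ q)
      = 2 ^ q * (((Zs (2 * t) (g + x) + Wc x) - (Zs (2 * t) (g + y) + Wc y))
        - (Zs (2 * t) (g + x) - Zs (2 * t) (g + y)
          - 2 * π * Complex.I * ((c / 4 ^ q - d / 4 ^ q : ℝ) : ℂ)
            * Xs (2 * t) (g + c / 4 ^ q))) := by
    have : (2:ℂ) ^ q * ((c / 4 ^ q - d / 4 ^ q : ℝ) : ℂ) = (c - d) / 2 ^ q := by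
      push_cast
      have : (4:ℂ) ^ q = 2 ^ q * 2 ^ q := by rw [← mul_pow]; norm_num
      rw [this]; field_simp
    linear_combination -(2 * π * Complex.I * Xs (2 * t) (g + c / 4 ^ q)) * this
  rw [key, norm_mul, norm_pow, Complex.norm_ofNat]
  have hq1 : (1:ℝ) ≤ 2 ^ q := one_le_pow₀ (by norm_num)
  have ht1 : (2:ℝ) ^ t ≤ 2 ^ q := pow_le_pow_right₀ (by norm_num) hqt
  have hq4 : (1:ℝ) / 4 ^ q ≤ 1 / 2 ^ q :=
    one_div_le_one_div_of_le (by positivity) (by gcongr; norm_num)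
  calc _ ≤ 2 ^ q * (K / 2 ^ (q + t) + 4 * ((2 * π) ^ 2 * (K / 2 ^ q)
          * (K / 2 ^ q + (K / 2 ^ q + 1 / 4 ^ q)) + 2 * π * (1 / 4 ^ q))) := by
        gcongr
        exact (norm_sub_le _ _).trans (add_le_add hn1 hl)
    _ ≤ 2 ^ q * (K / 2 ^ (q + t) + 4 * ((2 * π) ^ 2 * (K / 2 ^ q)
          * (K / 2 ^ q + (K / 2 ^ q + 1 / 2 ^ q)) + 2 * π * (1 / 4 ^ q))) := by
        gcongr
    _ = K / 2 ^ t + 4 * ((2 * π) ^ 2 * K * (2 * K + 1) + 2 * π) / 2 ^ q := by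
        rw [four_pow_eq_sq, pow_add]; field_simp; ring
    _ ≤ K / 2 ^ t + 4 * ((2 * π) ^ 2 * K * (2 * K + 1) + 2 * π) / 2 ^ t := by
        gcongr
    _ = _ := by rw [linC]; ring

/-- The constant for closeness at a coarser level. -/
def coarseC (K : ℝ) : ℝ := linC K + 8 * π * (K + 1) + 48

lemma near_coarse (hK : 0 ≤ K) (hqt : t ≤ q) (he : 0 ≤ e) (he4 : e < 4 ^ t) (he' : 0 ≤ e')
    (he4' : e' < 4 ^ t)
    (h : Near K (q + 2 * t) (e + 4 ^ t * (c + 4 ^ q * g)) (e' + 4 ^ t * (d + 4 ^ q * g))) :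
    Near (coarseC K) q c d := by
  have hl := near_linear hK hqt he he4 he' he4' h
  have a1 := near_arg_diff h
  have a3 := digit_diff_le (q := q) he he4 he' he4'
  have hq1 : (1:ℝ) ≤ 2 ^ q := one_le_pow₀ (by norm_num)
  have ht1 : (1:ℝ) ≤ 2 ^ t := one_le_pow₀ (by norm_num)
  have hq4 : (1:ℝ) / 4 ^ q ≤ 1 / 2 ^ q :=
    one_div_le_one_div_of_le (by positivity) (by gcongr; norm_num)
  have hlin : 0 ≤ linC K := by unfold linC; have := pi_pos; positivity
  have hcd : |(c : ℝ) - d| ≤ (K + 1) * 2 ^ q := by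
    have e1 : (c : ℝ) - d = 4 ^ q * ((((g : ℝ) + (c / 4 ^ q + e / 4 ^ (q + t)))
      - (g + (d / 4 ^ q + e' / 4 ^ (q + t)))) - (e / 4 ^ (q + t) - e' / 4 ^ (q + t))) := by
      field_simp; ring
    rw [e1, abs_mul, abs_of_pos (by positivity : (0:ℝ) < 4 ^ q)]
    calc _ ≤ (4:ℝ) ^ q * (K / 2 ^ q + 1 / 2 ^ q) := by
          gcongr
          exact (abs_sub _ _).trans (add_le_add a1 (a3.trans hq4))
      _ = _ := by rw [four_pow_eq_sq]; field_simp
  refine ⟨hcd.trans ?_, ?_⟩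
  · gcongr
    unfold coarseC
    have := pi_gt_three
    nlinarith
  · have w1 := Wc_sub_le' q (c / 4 ^ q + e / 4 ^ (q + t)) (c / 4 ^ q)
    have w2 := Wc_sub_le' q (d / 4 ^ q + e' / 4 ^ (q + t)) (d / 4 ^ q)
    rw [add_sub_cancel_left] at w1 w2
    have b : ∀ {u : ℝ}, |u| ≤ 1 / 4 ^ q → 16 * 2 ^ q * |u| + 8 / 2 ^ q ≤ 24 / 2 ^ q :=
      fun {u} hu => by
        calc 16 * 2 ^ q * |u| + 8 / 2 ^ q ≤ 16 * 2 ^ q * (1 / 4 ^ q) + 8 / 2 ^ q := by gcongr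
          _ = _ := by rw [four_pow_eq_sq]; field_simp; norm_num
    have w1' := w1.trans (b (digit_le he he4))
    have w2' := w2.trans (b (digit_le he' he4'))
    set x : ℝ := c / 4 ^ q + e / 4 ^ (q + t) with hx
    set y : ℝ := d / 4 ^ q + e' / 4 ^ (q + t) with hy
    have hxs : ‖(2 * π * Complex.I * (c - d) / 2 ^ q) * Xs (2 * t) (g + c / 4 ^ q)‖
        ≤ 8 * π * (K + 1) := by
      rw [norm_mul, norm_div, norm_mul, norm_pow, Complex.norm_ofNat]
      have hI : ‖(2 * π * Complex.I : ℂ)‖ = 2 * π := by simp [abs_of_pos pi_pos]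
      have hcd' : ‖(c - d : ℂ)‖ = |(c : ℝ) - d| := by
        rw [← Real.norm_eq_abs, ← Complex.norm_real]; push_cast; rfl
      rw [hI, hcd']
      calc _ ≤ 2 * π * ((K + 1) * 2 ^ q) / 2 ^ q * 4 := by
            gcongr
            exact norm_Xs_le _ _
        _ = _ := by field_simp; norm_num
    have hxy : 2 ^ q * ‖Wc x - Wc y‖ ≤ linC K + 8 * π * (K + 1) := by
      have e1 : 2 ^ q * ‖Wc x - Wc y‖ = ‖(2:ℂ) ^ q * Wc x - 2 ^ q * Wc y‖ := by
        rw [← mul_sub, norm_mul, norm_pow, Complex.norm_ofNat]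
      rw [e1, ← add_sub_cancel_right ((2:ℂ) ^ q * Wc x - 2 ^ q * Wc y)
        ((2 * π * Complex.I * (c - d) / 2 ^ q) * Xs (2 * t) (g + c / 4 ^ q))]
      exact (norm_sub_le _ _).trans (add_le_add (hl.trans (div_le_self hlin ht1)) hxs)
    have hxy' : ‖Wc x - Wc y‖ ≤ (linC K + 8 * π * (K + 1)) / 2 ^ q := by
      rw [le_div_iff₀ (by positivity)]; linarith
    have e2 : Wc (c / 4 ^ q) - Wc (d / 4 ^ q)
      = (Wc x - Wc y) - (Wc x - Wc (c / 4 ^ q)) + (Wc y - Wc (d / 4 ^ q)) := by ring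
    rw [e2]
    have e3 : coarseC K / 2 ^ q
      = (linC K + 8 * π * (K + 1)) / 2 ^ q + 24 / 2 ^ q + 24 / 2 ^ q := by
      unfold coarseC; ring
    rw [e3]
    exact (norm_add_le _ _).trans
      (add_le_add ((norm_sub_le _ _).trans (add_le_add hxy' w1')) w2')

end Linearization

lemma near_coarser {K : ℝ} (hK : 0 ≤ K) {p z : ℕ} {c d : ℤ} (h : Near K (p + z) c d)
    (hcd : |(c : ℝ) - d| ≤ 2 ^ p) : Near (K + 16) p c d := by
  refine ⟨hcd.trans (le_mul_of_one_le_left (by positivity) (by linarith)), ?_⟩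
  have e : ∀ x : ℤ, (x : ℝ) / 4 ^ p = 4 ^ z * (x / 4 ^ (p + z)) := fun x => by
    rw [pow_add]; field_simp
  rw [e, e]
  refine (Wc_scale_le z _ _).trans ?_
  have h2 := h.2
  rw [← sub_div, abs_div, abs_of_pos (by positivity : (0:ℝ) < 4 ^ (p + z))]
  calc _ ≤ 2 ^ z * (K / 2 ^ (p + z)) + 16 * 4 ^ z * (2 ^ p / 4 ^ (p + z)) := by gcongr
    _ = _ := by rw [pow_add, pow_add, four_pow_eq_sq p]; field_simp

/-- The rescaled Weierstrass function at the point with address `c`, `e`. -/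
def wpt (q t : ℕ) (c e : ℤ) : ℂ := (2:ℂ) ^ q * Wc (c / 4 ^ q + e / 4 ^ (q + t))

lemma norm_lat_sub_le {N : ℕ} {ν ν' : ℕ × ℕ} (hν : ν ∈ latSq N) (hν' : ν' ∈ latSq N) :
    ‖lat ν - lat ν'‖ ≤ 2 * N := by
  simp only [latSq, Finset.mem_product, Finset.mem_range] at hν hν'
  have e : lat ν - lat ν' = ((ν.1 - ν'.1 : ℝ) : ℂ) - ((ν.2 - ν'.2 : ℝ) : ℂ) * Complex.I := by
    unfold lat; push_cast; ring
  have b : ∀ {m n : ℕ}, m < N → n < N → |(m : ℝ) - n| ≤ N := fun {m n} hm hn => by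
    have h1 : (m : ℝ) ≤ N := by exact_mod_cast hm.le
    have h2 : (n : ℝ) ≤ N := by exact_mod_cast hn.le
    rw [abs_le]; constructor <;> linarith [Nat.cast_nonneg (α := ℝ) m, Nat.cast_nonneg (α := ℝ) n]
  rw [e, two_mul]
  refine (norm_sub_le _ _).trans ?_
  rw [norm_mul, Complex.norm_I, mul_one, Complex.norm_real, Complex.norm_real]
  exact add_le_add (b hν.1 hν'.1) (b hν.2 hν'.2)

lemma linC_nonneg {K : ℝ} (hK : 0 ≤ K) : 0 ≤ linC K := by
  unfold linC; have := pi_pos; positivity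

lemma linC_le_coarseC {K : ℝ} (hK : 0 ≤ K) : linC K ≤ coarseC K := by
  unfold coarseC; have := pi_pos; nlinarith

lemma le_coarseC {K : ℝ} (hK : 0 ≤ K) : 48 ≤ coarseC K := by
  have := linC_nonneg hK
  unfold coarseC; have := pi_pos; nlinarith

lemma norm_wpt_sub_le {q t : ℕ} {c e e' : ℤ} (he : e ∈ Finset.Ico (0:ℤ) (4 ^ t))
    (he' : e' ∈ Finset.Ico (0:ℤ) (4 ^ t)) : ‖wpt q t c e - wpt q t c e'‖ ≤ 24 := by
  rw [Finset.mem_Ico] at he he'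
  have h := digit_diff_le (q := q) he.1 he.2 he'.1 he'.2
  have w := Wc_sub_le' q (c / 4 ^ q + e / 4 ^ (q + t)) (c / 4 ^ q + e' / 4 ^ (q + t))
  rw [add_sub_add_left_eq_sub] at w
  rw [wpt, wpt, ← mul_sub, norm_mul, norm_pow, Complex.norm_ofNat]
  calc _ ≤ (2:ℝ) ^ q * (16 * 2 ^ q * (1 / 4 ^ q) + 8 / 2 ^ q) := by
        gcongr
        exact w.trans (by gcongr)
    _ = 24 := by rw [four_pow_eq_sq]; field_simp; norm_num

/-- The triples of lower and upper digits compatible with the linearised closeness relation. -/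
def coinc (K : ℝ) (q t : ℕ) (c d : ℤ) (E E' : Finset ℤ) : Finset (ℤ × ℤ × ℕ) :=
  (E ×ˢ E' ×ˢ Finset.range (4 ^ t)).filter fun x =>
    ‖wpt q t c x.1 - wpt q t d x.2.1
      + (2 * π * Complex.I * (c - d) / 2 ^ q) * Xs (2 * t) ((x.2.2 : ℝ) + c / 4 ^ q)‖
      ≤ linC K / 2 ^ t

section

variable {K : ℝ} {q t : ℕ} {c d : ℤ} {E E' : Finset ℤ} {M : ℝ}

lemma card_coinc_le_of_decay (hK : 0 ≤ K) (hE : E ⊆ Finset.Ico 0 (4 ^ t))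
    (hE' : E' ⊆ Finset.Ico 0 (4 ^ t)) (hM0 : 0 ≤ M)
    (hM : ∀ e ∈ E, ((E.filter fun e' =>
      ‖wpt q t c e - wpt q t c e'‖ ≤ 16 * coarseC K / 2 ^ t).card : ℝ) ≤ M)
    (hM' : ∀ e ∈ E', ((E'.filter fun e' =>
      ‖wpt q t d e - wpt q t d e'‖ ≤ 16 * coarseC K / 2 ^ t).card : ℝ) ≤ M)
    {r δ : ℝ} (hr : 0 ≤ r) (hδ0 : 0 ≤ δ)
    (hδ : ∀ ν ∈ latSq (2 ^ t), ∀ ν' ∈ latSq (2 ^ t), r ≤ ‖lat ν - lat ν'‖ →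
      ‖∑ g ∈ Finset.range (4 ^ t), chi (lat ν - lat ν') (((16 * coarseC K)⁻¹ : ℝ) *
        ((2 * π * Complex.I * (c - d) / 2 ^ q) * Xs (2 * t) ((g : ℝ) + c / 4 ^ q)))‖
        ≤ δ * 4 ^ t) :
    ((coinc K q t c d E E').card : ℝ)
      ≤ 4 * 16 ^ t * (δ * (energyC * M) + (2 * r + 1) ^ 2) := by
  have hC := le_coarseC hK
  have hlC := linC_le_coarseC hK
  set a : ℝ := (16 * coarseC K)⁻¹ with ha
  have ha0 : 0 < a := by rw [ha]; positivity
  have hna : ‖(a : ℂ)‖ = a := by rw [Complex.norm_real, Real.norm_of_nonneg ha0.le]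
  have hN : 0 < 2 ^ t := by positivity
  have h := card_coincidence_le E E' (Finset.range (4 ^ t)) (fun e => a * wpt q t c e)
    (fun e => a * wpt q t d e) (fun g : ℕ => a *
        ((2 * π * Complex.I * (c - d) / 2 ^ q) * Xs (2 * t) ((g : ℝ) + c / 4 ^ q)))
    (N := 2 ^ t) hN hr hδ0 (δ := δ) (by
      rw [Finset.card_range]; push_cast; exact hδ)
  have hcardE : ∀ {F : Finset ℤ}, F ⊆ Finset.Ico 0 (4 ^ t) → (F.card : ℝ) ≤ 4 ^ t :=
    fun {F} hF => by
      have := Finset.card_le_card hF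
      rw [Int.card_Ico] at this
      have e : ((4 : ℤ) ^ t - 0).toNat = 4 ^ t := by
        rw [sub_zero, show (4:ℤ) ^ t = ((4 ^ t : ℕ) : ℤ) by push_cast; rfl, Int.toNat_natCast]
      rw [e] at this
      exact_mod_cast this
  have hen : ∀ {F : Finset ℤ} {c' : ℤ}, F ⊆ Finset.Ico 0 (4 ^ t) →
      (∀ e ∈ F, ((F.filter fun e' =>
        ‖wpt q t c' e - wpt q t c' e'‖ ≤ 16 * coarseC K / 2 ^ t).card : ℝ) ≤ M) →
      energy (2 ^ t) F (fun e => a * wpt q t c' e) ≤ energyC * (4 ^ t * M) := fun {F c'} hF hFM => by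
    refine (energy_le hN F (fun e => a * wpt q t c' e) (M := M) (fun e he => ?_)
      fun e he e' he' => ?_).trans ?_
    · refine le_trans ?_ (hFM e he)
      norm_cast
      refine Finset.card_le_card (Finset.monotone_filter_right _ fun e' _ he' => ?_)
      rw [← mul_sub, norm_mul, hna] at he'
      push_cast at he'
      rw [div_eq_mul_one_div]
      have : 16 * coarseC K * (a * ‖wpt q t c' e - wpt q t c' e'‖)
          = ‖wpt q t c' e - wpt q t c' e'‖ := by rw [ha]; field_simp
      rw [← this]
      push_cast
      gcongr
    · rw [← mul_sub, norm_mul, hna]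
      calc _ ≤ a * 24 := by gcongr; exact norm_wpt_sub_le (hF he) (hF he')
        _ ≤ 1 := by rw [ha, inv_mul_le_iff₀ (by positivity)]; linarith
    · gcongr
      · exact energyC_nonneg
      · exact hcardE hF
  have hsub : coinc K q t c d E E' ⊆ (E ×ˢ E' ×ˢ Finset.range (4 ^ t)).filter fun x =>
      ‖a * wpt q t c x.1 - a * wpt q t d x.2.1 + a *
        ((2 * π * Complex.I * (c - d) / 2 ^ q) * Xs (2 * t) ((x.2.2 : ℝ) + c / 4 ^ q))‖
        ≤ 1 / (2 * (2 ^ t : ℕ)) := by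
    refine Finset.monotone_filter_right _ fun x _ hx => ?_
    rw [← mul_sub, ← mul_add, norm_mul, hna]
    calc _ ≤ a * (linC K / 2 ^ t) := by gcongr
      _ ≤ a * (8 * coarseC K / 2 ^ t) := by gcongr; linarith
      _ = _ := by rw [ha]; push_cast; field_simp; norm_num
  refine (Nat.cast_le.2 (Finset.card_le_card hsub)).trans (h.trans ?_)
  rw [Finset.card_range]
  have h1 := hen hE hM
  have h2 := hen hE' hM'
  have h16 : (16:ℝ) ^ t = 4 ^ t * 4 ^ t := by rw [← mul_pow]; norm_num
  push_cast
  calc _ ≤ 4 * 4 ^ t * (δ * (energyC * (4 ^ t * M) + energyC * (4 ^ t * M)) / 2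
        + 4 ^ t * 4 ^ t * (2 * r + 1) ^ 2 / (2 ^ t) ^ 2) := by
        gcongr
        · exact hcardE hE
        · exact hcardE hE'
    _ = _ := by rw [sq ((2:ℝ) ^ t), ← four_pow_eq_sq, h16]; field_simp; ring

lemma card_coinc_le (hK : 0 ≤ K) (hE : E ⊆ Finset.Ico 0 (4 ^ t))
    (hE' : E' ⊆ Finset.Ico 0 (4 ^ t)) (hM0 : 0 ≤ M)
    (hM : ∀ e ∈ E, ((E.filter fun e' =>
      ‖wpt q t c e - wpt q t c e'‖ ≤ 16 * coarseC K / 2 ^ t).card : ℝ) ≤ M)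
    (hM' : ∀ e ∈ E', ((E'.filter fun e' =>
      ‖wpt q t d e - wpt q t d e'‖ ≤ 16 * coarseC K / 2 ^ t).card : ℝ) ≤ M) :
    ((coinc K q t c d E E').card : ℝ) ≤ 4 * 16 ^ t * (energyC * M + 1) := by
  have := card_coinc_le_of_decay hK hE hE' hM0 hM hM' (r := 0) (δ := 1) le_rfl zero_le_one
    fun ν _ ν' _ _ => by
      refine (norm_sum_le_of_le _ fun g _ => (norm_chi _ _).le).trans ?_
      simp
  simpa using this

lemma card_coinc_le_of_far (hK : 0 ≤ K) (hE : E ⊆ Finset.Ico 0 (4 ^ t))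
    (hE' : E' ⊆ Finset.Ico 0 (4 ^ t)) (hM0 : 0 ≤ M)
    (hM : ∀ e ∈ E, ((E.filter fun e' =>
      ‖wpt q t c e - wpt q t c e'‖ ≤ 16 * coarseC K / 2 ^ t).card : ℝ) ≤ M)
    (hM' : ∀ e ∈ E', ((E'.filter fun e' =>
      ‖wpt q t d e - wpt q t d e'‖ ≤ 16 * coarseC K / 2 ^ t).card : ℝ) ≤ M)
    {j : ℕ} (hcd : |(c : ℝ) - d| ≤ coarseC K * 2 ^ q)
    (hfar : 2 ^ q ≤ 2 ^ (128 * j) * |(c : ℝ) - d|) :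
    ((coinc K q t c d E E').card : ℝ)
      ≤ 4 * 16 ^ t * (2 ^ 37 / 2 ^ j * (energyC * M) + (48 * coarseC K) ^ 2 * 2 ^ (512 * j)) := by
  have hC := le_coarseC hK
  refine (card_coinc_le_of_decay hK hE hE' hM0 hM hM' (r := 2 ^ (256 * j) * (16 * coarseC K))
    (δ := 2 ^ 37 / 2 ^ j) (by positivity) (by positivity) fun ν hν ν' hν' hνν => ?_).trans ?_
  · set ζ : ℂ := (lat ν - lat ν') * ((((16 * coarseC K)⁻¹ : ℝ) : ℂ) *
      (2 * π * Complex.I * (c - d) / 2 ^ q)) with hζ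
    have hnζ : ‖ζ‖ = ‖lat ν - lat ν'‖ * ((16 * coarseC K)⁻¹ * (2 * π * |(c : ℝ) - d| / 2 ^ q)) := by
      have hI : ‖(2 * π * Complex.I : ℂ)‖ = 2 * π := by simp [abs_of_pos pi_pos]
      have hcd' : ‖(c - d : ℂ)‖ = |(c : ℝ) - d| := by
        rw [← Real.norm_eq_abs, ← Complex.norm_real]; push_cast; rfl
      rw [hζ, norm_mul, norm_mul, norm_div, norm_mul (2 * π * Complex.I), hI, hcd', norm_pow,
        Complex.norm_ofNat, Complex.norm_real, Real.norm_of_nonneg (by positivity)]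
    have hX : 1 / 2 ^ (128 * j) ≤ 2 * π * |(c : ℝ) - d| / 2 ^ q := by
      rw [div_le_div_iff₀ (by positivity) (by positivity)]
      have : 0 ≤ 2 ^ (128 * j) * |(c : ℝ) - d| := by positivity
      nlinarith [pi_gt_three]
    have := fourier_decay j t (c / 4 ^ q) ζ (by
      rw [hnζ]
      calc (2:ℝ) ^ (64 * (2 * j)) = 2 ^ (256 * j) * (16 * coarseC K) *
            ((16 * coarseC K)⁻¹ * (1 / 2 ^ (128 * j))) := by
              have : (2:ℝ) ^ (256 * j) = 2 ^ (64 * (2 * j)) * 2 ^ (128 * j) := by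
                rw [← pow_add]; congr 1; ring
              rw [this]; field_simp
        _ ≤ _ := by
            exact mul_le_mul hνν (mul_le_mul_of_nonneg_left hX (by positivity)) (by positivity)
              (norm_nonneg _)) (by
      rw [hnζ]
      have h2 := norm_lat_sub_le hν hν'
      push_cast at h2
      calc _ ≤ 2 * 2 ^ t * ((16 * coarseC K)⁻¹ * (2 * π * (coarseC K * 2 ^ q) / 2 ^ q)) := by
            gcongr
        _ = 2 ^ t * (π / 4) := by field_simp; norm_num
        _ ≤ 2 ^ t * 1 := by gcongr; linarith [pi_le_four]
        _ = _ := mul_one _)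
    refine le_trans (le_of_eq ?_) this
    congr 1
    refine Finset.sum_congr rfl fun g _ => ?_
    rw [chi, hζ]
    ring_nf
  · gcongr
    have h1 : (1:ℝ) ≤ 2 ^ (256 * j) := one_le_pow₀ (by norm_num)
    calc _ ≤ (2 ^ (256 * j) * (48 * coarseC K)) ^ 2 := by
          gcongr
          nlinarith
      _ = _ := by
          rw [mul_pow, ← pow_mul]; ring_nf

end

open Classical in
/-- The elements of `S` close to `c` at level `k`. -/
def nbr (K : ℝ) (k : ℕ) (S : Set ℤ) (c : ℤ) : Finset ℤ :=
  (Finset.Icc (c - ⌈K * 2 ^ k⌉) (c + ⌈K * 2 ^ k⌉)).filter fun d => d ∈ S ∧ Near K k c d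

lemma mem_nbr {K : ℝ} {k : ℕ} {S : Set ℤ} {c d : ℤ} :
    d ∈ nbr K k S c ↔ d ∈ S ∧ Near K k c d := by
  classical
  rw [nbr, Finset.mem_filter, and_iff_right_iff_imp]
  rintro ⟨-, h, -⟩
  have h1 := abs_le.1 h
  have h2 := Int.le_ceil (K * 2 ^ k)
  rw [Finset.mem_Icc]
  constructor
  · have : ((c - ⌈K * 2 ^ k⌉ : ℤ) : ℝ) ≤ d := by push_cast; linarith
    exact_mod_cast this
  · have : (d : ℝ) ≤ ((c + ⌈K * 2 ^ k⌉ : ℤ) : ℝ) := by push_cast; linarith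
    exact_mod_cast this

/-- A periodic set of addresses at level `k` that misses at most `B` addresses per period and whose
elements have at most `V` close elements. -/
structure Good (K : ℝ) (k : ℕ) (B V : ℝ) (S : Set ℤ) : Prop where
  period : ∀ c ∈ S, ∀ m : ℤ, c + 4 ^ k * m ∈ S
  bad : ∀ F : Finset ℤ, (∀ c ∈ F, 0 ≤ c ∧ c < 4 ^ k ∧ c ∉ S) → (F.card : ℝ) ≤ B
  mult : ∀ c ∈ S, ∀ F : Finset ℤ, (∀ d ∈ F, d ∈ S ∧ Near K k c d) → (F.card : ℝ) ≤ V

open Classical in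
/-- The admissible lower digits over `c`. -/
def lowDigits (t : ℕ) (S : Set ℤ) (c : ℤ) : Finset ℤ :=
  (Finset.Ico 0 (4 ^ t)).filter fun e => e + 4 ^ t * c ∈ S

lemma mem_lowDigits {t : ℕ} {S : Set ℤ} {c e : ℤ} :
    e ∈ lowDigits t S c ↔ (0 ≤ e ∧ e < 4 ^ t) ∧ e + 4 ^ t * c ∈ S := by
  classical
  rw [lowDigits, Finset.mem_filter, Finset.mem_Ico]

lemma lowDigits_subset (t : ℕ) (S : Set ℤ) (c : ℤ) : lowDigits t S c ⊆ Finset.Ico 0 (4 ^ t) := by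
  classical exact Finset.filter_subset _ _

lemma card_lowDigits_close_le {K B V : ℝ} {q t : ℕ} {S : Set ℤ} (hK : 1 ≤ K) (hqt : t ≤ q)
    (hS : Good K (q + t) B V S) (c e : ℤ) (he : e ∈ lowDigits t S c) :
    (((lowDigits t S c).filter fun e' => ‖wpt q t c e - wpt q t c e'‖ ≤ K / 2 ^ t).card : ℝ)
      ≤ V := by
  rw [← Finset.card_image_of_injective _ (f := fun e' => e' + 4 ^ t * c)
    (add_left_injective _)]
  have he0 := mem_lowDigits.1 he
  refine hS.mult (e + 4 ^ t * c) he0.2 _ fun d hd => ?_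
  simp only [Finset.mem_image, Finset.mem_filter] at hd
  obtain ⟨e', ⟨he', hw⟩, rfl⟩ := hd
  have he0' := mem_lowDigits.1 he'
  refine ⟨he0'.2, ?_, ?_⟩
  · push_cast
    rw [add_sub_add_right_eq_sub]
    have h1 : (0:ℝ) ≤ e := by exact_mod_cast he0.1.1
    have h2 : (e:ℝ) ≤ 4 ^ t := by exact_mod_cast he0.1.2.le
    have h3 : (0:ℝ) ≤ e' := by exact_mod_cast he0'.1.1
    have h4 : (e':ℝ) ≤ 4 ^ t := by exact_mod_cast he0'.1.2.le
    have h5 : |(e : ℝ) - e'| ≤ 4 ^ t := by rw [abs_le]; constructor <;> linarith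
    refine h5.trans ?_
    rw [four_pow_eq_sq, pow_add]
    have : (2:ℝ) ^ t ≤ 2 ^ q := pow_le_pow_right₀ (by norm_num) hqt
    calc (2:ℝ) ^ t * 2 ^ t ≤ 2 ^ q * 2 ^ t := by gcongr
      _ ≤ _ := le_mul_of_one_le_left (by positivity) hK
  · have h : ∀ x : ℤ, ((x + 4 ^ t * c : ℤ) : ℝ) / 4 ^ (q + t) = c / 4 ^ q + x / 4 ^ (q + t) :=
      fun x => by push_cast; rw [pow_add]; field_simp; ring
    rw [h, h]
    rw [wpt, wpt, ← mul_sub, norm_mul, norm_pow, Complex.norm_ofNat] at hw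
    rw [le_div_iff₀ (by positivity)] at hw ⊢
    rw [pow_add 2 q t]
    linarith

section

variable {K K₂ B₁ B₂ B₃ V₁ V₂ V₃ : ℝ} {p j t : ℕ} {S₁ S₂ S₃ : Set ℤ}

/-- The addresses all of whose truncations are good. -/
def refine3 (t : ℕ) (S₁ S₂ S₃ : Set ℤ) : Set ℤ := {X | X ∈ S₁ ∧ X / 4 ^ t ∈ S₂ ∧ X / 4 ^ t ∈ S₃}

lemma sum_coinc_le (hK : 0 ≤ K) (hK₂ : 16 * coarseC K ≤ K₂)
    (hqt : t ≤ p + 128 * j) (h1 : Good K₂ (p + 128 * j + t) B₁ V₁ S₁)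
    (h2 : Good K₂ (p + 128 * j) B₂ V₂ S₂) (h3 : Good K₂ p B₃ V₃ S₃) (hV1 : 0 ≤ V₁)
    {c : ℤ} (hc2 : c ∈ S₂) (hc3 : c ∈ S₃) :
    ∑ d ∈ nbr (coarseC K) (p + 128 * j) (S₂ ∩ S₃) c,
      ((coinc K (p + 128 * j) t c d (lowDigits t S₁ c) (lowDigits t S₁ d)).card : ℝ)
    ≤ V₂ * (4 * 16 ^ t * (2 ^ 37 / 2 ^ j * (energyC * V₁)
        + (48 * coarseC K) ^ 2 * 2 ^ (512 * j))) + V₃ * (4 * 16 ^ t * (energyC * V₁ + 1)) := by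
  have hC := le_coarseC hK
  set q := p + 128 * j with hq
  set R := nbr (coarseC K) q (S₂ ∩ S₃) c with hR
  set U := 4 * 16 ^ t * (2 ^ 37 / 2 ^ j * (energyC * V₁)
        + (48 * coarseC K) ^ 2 * 2 ^ (512 * j)) with hU
  set U' := 4 * 16 ^ t * (energyC * V₁ + 1) with hU'
  have hE := energyC_nonneg
  have hU0 : 0 ≤ U := by positivity
  have hU0' : 0 ≤ U' := by positivity
  have hM : ∀ c' : ℤ, ∀ e ∈ lowDigits t S₁ c', (((lowDigits t S₁ c').filter fun e' =>
      ‖wpt q t c' e - wpt q t c' e'‖ ≤ 16 * coarseC K / 2 ^ t).card : ℝ) ≤ V₁ := fun c' e he => by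
    refine le_trans ?_ (card_lowDigits_close_le (K := K₂) (by linarith) hqt h1 c' e he)
    refine Nat.cast_le.2 (Finset.card_le_card (Finset.monotone_filter_right _ fun e' _ h => ?_))
    exact le_trans h (by gcongr)
  have hterm : ∀ d ∈ R, ((coinc K q t c d (lowDigits t S₁ c) (lowDigits t S₁ d)).card : ℝ)
      ≤ U + if |(c : ℝ) - d| ≤ 2 ^ p then U' else 0 := fun d hd => by
    have hd' := (mem_nbr.1 hd).2
    split_ifs with hcd
    · exact (card_coinc_le hK (lowDigits_subset _ _ _) (lowDigits_subset _ _ _) hV1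
        (hM c) (hM d)).trans (by linarith)
    · rw [add_zero]
      refine card_coinc_le_of_far hK (lowDigits_subset _ _ _) (lowDigits_subset _ _ _) hV1
        (hM c) (hM d) hd'.1 ?_
      rw [hq, pow_add, mul_comm]
      gcongr
      exact (not_le.1 hcd).le
  refine (Finset.sum_le_sum hterm).trans ?_
  rw [Finset.sum_add_distrib, Finset.sum_const, nsmul_eq_mul, ← Finset.sum_filter,
    Finset.sum_const, nsmul_eq_mul]
  gcongr
  · refine h2.mult c hc2 R fun d hd => ?_
    have := mem_nbr.1 hd
    exact ⟨this.1.1, this.2.mono (by linarith)⟩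
  · refine h3.mult c hc3 _ fun d hd => ?_
    have hd := Finset.mem_filter.1 hd
    have := mem_nbr.1 hd.1
    exact ⟨this.1.2, (near_coarser (by linarith) this.2 hd.2).mono (by linarith)⟩

lemma sum_card_nbr_le (hK : 0 ≤ K) (hK₂ : 16 * coarseC K ≤ K₂)
    (hqt : t ≤ p + 128 * j) (h1 : Good K₂ (p + 128 * j + t) B₁ V₁ S₁)
    (h2 : Good K₂ (p + 128 * j) B₂ V₂ S₂) (h3 : Good K₂ p B₃ V₃ S₃) (hV1 : 0 ≤ V₁)
    (hV2 : 0 ≤ V₂) (hV3 : 0 ≤ V₃)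
    (F : Finset ℤ) (hF : ∀ X ∈ F, (0 ≤ X ∧ X < 4 ^ (p + 128 * j + 2 * t)) ∧
      X ∈ refine3 t S₁ S₂ S₃) :
    ∑ X ∈ F, ((nbr K (p + 128 * j + 2 * t) (refine3 t S₁ S₂ S₃) X).card : ℝ)
    ≤ 4 * 4 ^ (p + 128 * j + 2 * t) * (V₂ * (2 ^ 37 / 2 ^ j * (energyC * V₁)
        + (48 * coarseC K) ^ 2 * 2 ^ (512 * j)) + V₃ * (energyC * V₁ + 1)) := by
  classical
  have hC := le_coarseC hK
  have hE := energyC_nonneg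
  set q := p + 128 * j with hq
  set S := refine3 t S₁ S₂ S₃ with hS
  set P := F.sigma fun X => nbr K (q + 2 * t) S X with hP
  set D := ((Finset.Ico (0:ℤ) (4 ^ q)).filter fun c => c ∈ S₂ ∧ c ∈ S₃).sigma
    fun c => nbr (coarseC K) q (S₂ ∩ S₃) c with hD
  let f : (Σ _ : ℤ, ℤ) → (Σ _ : ℤ, ℤ) := fun x =>
    ⟨x.1 / 4 ^ t % 4 ^ q, x.2 / 4 ^ t - 4 ^ q * (x.1 / 4 ^ t / 4 ^ q)⟩
  have h4t : (0:ℤ) < 4 ^ t := by positivity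
  have h4q : (0:ℤ) < 4 ^ q := by positivity
  have per2 : ∀ x m : ℤ, x ∈ S₂ → x - 4 ^ q * m ∈ S₂ := fun x m hx => by
    have := h2.period x hx (-m)
    rwa [mul_neg, ← sub_eq_add_neg] at this
  have per3 : ∀ x m : ℤ, x ∈ S₃ → x - 4 ^ q * m ∈ S₃ := fun x m hx => by
    have := h3.period x hx (-(4 ^ (128 * j) * m))
    rwa [mul_neg, ← sub_eq_add_neg, ← mul_assoc, ← pow_add] at this
  have per1 : ∀ x m : ℤ, x ∈ S₁ → x - 4 ^ t * (4 ^ q * m) ∈ S₁ := fun x m hx => by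
    have := h1.period x hx (-m)
    rwa [mul_neg, ← sub_eq_add_neg, add_comm q t, pow_add, mul_assoc] at this
  have hX : ∀ X : ℤ, X = X % 4 ^ t + 4 ^ t * (X / 4 ^ t % 4 ^ q + 4 ^ q * (X / 4 ^ t / 4 ^ q)) :=
    fun X => by rw [Int.emod_add_mul_ediv, Int.emod_add_mul_ediv]
  have hY : ∀ X Y : ℤ, Y = Y % 4 ^ t + 4 ^ t * (Y / 4 ^ t - 4 ^ q * (X / 4 ^ t / 4 ^ q)
      + 4 ^ q * (X / 4 ^ t / 4 ^ q)) := fun X Y => by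
    rw [sub_add_cancel, Int.emod_add_mul_ediv]
  have hmod : ∀ x : ℤ, x % 4 ^ q = x - 4 ^ q * (x / 4 ^ q) := fun x => by
    rw [Int.emod_def]
  have hmt : ∀ x : ℤ, 0 ≤ x % 4 ^ t ∧ x % 4 ^ t < 4 ^ t := fun x =>
    ⟨Int.emod_nonneg _ h4t.ne', Int.emod_lt_of_pos _ h4t⟩
  have hnear : ∀ X Y : ℤ, Near K (q + 2 * t) X Y → Near K (q + 2 * t)
      (X % 4 ^ t + 4 ^ t * (X / 4 ^ t % 4 ^ q + 4 ^ q * (X / 4 ^ t / 4 ^ q)))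
      (Y % 4 ^ t + 4 ^ t * (Y / 4 ^ t - 4 ^ q * (X / 4 ^ t / 4 ^ q)
      + 4 ^ q * (X / 4 ^ t / 4 ^ q))) := fun X Y h => by rwa [← hX, ← hY]
  have hmaps : ∀ x ∈ P, f x ∈ D := fun x hx => by
    obtain ⟨hx1, hx2⟩ := Finset.mem_sigma.1 hx
    obtain ⟨-, hX1, hX2, hX3⟩ := hF _ hx1
    obtain ⟨⟨hY1, hY2, hY3⟩, hn⟩ := mem_nbr.1 hx2
    rw [hD, Finset.mem_sigma, Finset.mem_filter, Finset.mem_Ico, mem_nbr]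
    refine ⟨⟨⟨Int.emod_nonneg _ h4q.ne', Int.emod_lt_of_pos _ h4q⟩, ?_, ?_⟩, ⟨?_, ?_⟩, ?_⟩
    · change _ % _ ∈ _
      rw [hmod]; exact per2 _ _ hX2
    · change _ % _ ∈ _
      rw [hmod]; exact per3 _ _ hX3
    · exact per2 _ _ hY2
    · exact per3 _ _ hY3
    · exact near_coarse hK hqt (hmt _).1 (hmt _).2 (hmt _).1 (hmt _).2 (hnear _ _ hn)
  have hfib : ∀ y ∈ D, (P.filter fun x => f x = y).card
      ≤ (coinc K q t y.1 y.2 (lowDigits t S₁ y.1) (lowDigits t S₁ y.2)).card := by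
    rintro ⟨c, d⟩ -
    have hinj : ∀ x ∈ P.filter fun x => f x = ⟨c, d⟩,
        (x.1 / 4 ^ t % 4 ^ q = c ∧ x.2 / 4 ^ t - 4 ^ q * (x.1 / 4 ^ t / 4 ^ q) = d) ∧
          0 ≤ x.1 / 4 ^ t / 4 ^ q ∧ x.1 / 4 ^ t / 4 ^ q < 4 ^ t ∧ x.1 ∈ S₁ ∧ x.2 ∈ S₁ ∧
          Near K (q + 2 * t) x.1 x.2 := fun x hx => by
      obtain ⟨hx, hfx⟩ := Finset.mem_filter.1 hx
      obtain ⟨hx1, hx2⟩ := Finset.mem_sigma.1 hx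
      obtain ⟨⟨hX0, hX4⟩, hX1, -⟩ := hF _ hx1
      obtain ⟨⟨hY1, -⟩, hn⟩ := mem_nbr.1 hx2
      refine ⟨⟨congrArg Sigma.fst hfx, congrArg Sigma.snd hfx⟩, ?_, ?_, hX1, hY1, hn⟩
      · exact Int.ediv_nonneg (Int.ediv_nonneg hX0 h4t.le) h4q.le
      · rw [Int.ediv_lt_iff_lt_mul h4q, Int.ediv_lt_iff_lt_mul h4t]
        refine hX4.trans_le (le_of_eq ?_)
        rw [two_mul, pow_add, pow_add]; ring
    refine Finset.card_le_card_of_injOn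
      (fun x => (x.1 % 4 ^ t, x.2 % 4 ^ t, (x.1 / 4 ^ t / 4 ^ q).toNat)) (fun x hx => ?_) ?_
    · obtain ⟨⟨hc, hd⟩, hg0, hg4, hX1, hY1, hn⟩ := hinj x hx
      have hg : (((x.1 / 4 ^ t / 4 ^ q).toNat : ℕ) : ℤ) = x.1 / 4 ^ t / 4 ^ q :=
        Int.toNat_of_nonneg hg0
      have hgr : (((x.1 / 4 ^ t / 4 ^ q).toNat : ℕ) : ℝ) = ((x.1 / 4 ^ t / 4 ^ q : ℤ) : ℝ) := by
        exact_mod_cast hg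
      have hn' := hnear _ _ hn
      have eX := hX x.1
      have eY := hY x.1 x.2
      rw [hc] at hn' eX
      rw [hd] at hn' eY
      rw [coinc, Finset.mem_coe, Finset.mem_filter, Finset.mem_product, Finset.mem_product,
        Finset.mem_range, mem_lowDigits, mem_lowDigits]
      refine ⟨⟨⟨hmt _, ?_⟩, ⟨hmt _, ?_⟩, ?_⟩, ?_⟩
      · have := per1 _ (x.1 / 4 ^ t / 4 ^ q) hX1
        convert this using 1
        linear_combination (-1 : ℤ) * eX
      · have := per1 _ (x.1 / 4 ^ t / 4 ^ q) hY1
        convert this using 1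
        linear_combination (-1 : ℤ) * eY
      · zify; rwa [hg]
      · rw [hgr]
        exact near_linear hK hqt (hmt _).1 (hmt _).2 (hmt _).1 (hmt _).2 hn'
    · intro x hx y hy hxy
      obtain ⟨⟨hc, hd⟩, hg0, -⟩ := hinj x hx
      obtain ⟨⟨hc', hd'⟩, hg0', -⟩ := hinj y hy
      simp only [Prod.mk.injEq] at hxy
      obtain ⟨e1, e2, e3⟩ := hxy
      have eg : x.1 / 4 ^ t / 4 ^ q = y.1 / 4 ^ t / 4 ^ q := by
        rw [← Int.toNat_of_nonneg hg0, e3, Int.toNat_of_nonneg hg0']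
      have a1 : x.1 = y.1 := by
        rw [hX x.1, hX y.1, hc, hc', e1, eg]
      have a2 : x.2 = y.2 := by
        rw [hY x.1 x.2, hY y.1 y.2, hd, hd', e2, eg]
      exact Sigma.ext a1 (heq_of_eq a2)
  have hcard : ∑ X ∈ F, ((nbr K (q + 2 * t) S X).card : ℝ) = (P.card : ℝ) := by
    rw [hP, Finset.card_sigma]; push_cast; rfl
  rw [hcard, Finset.card_eq_sum_card_fiberwise hmaps]
  push_cast
  refine (Finset.sum_le_sum fun y hy => Nat.cast_le.2 (hfib y hy)).trans ?_
  rw [hD, Finset.sum_sigma]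
  refine (Finset.sum_le_sum fun c hc => sum_coinc_le hK hK₂ hqt h1 h2 h3 hV1
    (Finset.mem_filter.1 hc).2.1 (Finset.mem_filter.1 hc).2.2).trans ?_
  rw [Finset.sum_const, nsmul_eq_mul]
  have hcd : ((((Finset.Ico (0:ℤ) (4 ^ q)).filter fun c => c ∈ S₂ ∧ c ∈ S₃).card : ℕ) : ℝ)
      ≤ 4 ^ q := by
    have := Finset.card_filter_le (Finset.Ico (0:ℤ) (4 ^ q)) fun c => c ∈ S₂ ∧ c ∈ S₃
    rw [Int.card_Ico] at this
    have e : ((4 : ℤ) ^ q - 0).toNat = 4 ^ q := by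
      rw [sub_zero, show (4:ℤ) ^ q = ((4 ^ q : ℕ) : ℤ) by push_cast; rfl, Int.toNat_natCast]
    rw [e] at this
    exact_mod_cast this
  refine (mul_le_mul_of_nonneg_right hcd (by positivity)).trans (le_of_eq ?_)
  have : (16:ℝ) ^ t = 4 ^ (2 * t) := by rw [pow_mul]; norm_num
  rw [this, pow_add 4 q]; ring

end

lemma Good.card_digit_bad_le {K B V : ℝ} {m : ℕ} {S : Set ℤ} (hS : Good K m B V S) (s n : ℕ)
    (F : Finset ℤ) (hF : ∀ X ∈ F, (0 ≤ X ∧ X < 4 ^ (s + m + n)) ∧ X / 4 ^ s ∉ S) :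
    (F.card : ℝ) ≤ 4 ^ s * 4 ^ n * B := by
  classical
  have h4s : (0:ℤ) < 4 ^ s := by positivity
  have h4m : (0:ℤ) < 4 ^ m := by positivity
  set G := F.image fun X => X / 4 ^ s % 4 ^ m with hG
  have hGB : (G.card : ℝ) ≤ B := by
    refine hS.bad G fun c hc => ?_
    obtain ⟨X, hX, rfl⟩ := Finset.mem_image.1 hc
    refine ⟨Int.emod_nonneg _ h4m.ne', Int.emod_lt_of_pos _ h4m, fun h => (hF X hX).2 ?_⟩
    have := hS.period _ h (X / 4 ^ s / 4 ^ m)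
    rwa [Int.emod_add_mul_ediv] at this
  have hcard : F.card ≤ (Finset.Ico (0:ℤ) (4 ^ s) ×ˢ G ×ˢ Finset.Ico (0:ℤ) (4 ^ n)).card := by
    refine Finset.card_le_card_of_injOn
      (fun X => (X % 4 ^ s, X / 4 ^ s % 4 ^ m, X / 4 ^ s / 4 ^ m)) (fun X hX => ?_) ?_
    · obtain ⟨⟨h0, h4⟩, -⟩ := hF X hX
      simp only [Finset.coe_product, Set.mem_prod, Finset.mem_coe, Finset.mem_Ico]
      refine ⟨⟨Int.emod_nonneg _ h4s.ne', Int.emod_lt_of_pos _ h4s⟩,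
        Finset.mem_image_of_mem _ hX,
        Int.ediv_nonneg (Int.ediv_nonneg h0 h4s.le) h4m.le, ?_⟩
      rw [Int.ediv_lt_iff_lt_mul h4m, Int.ediv_lt_iff_lt_mul h4s]
      refine h4.trans_le (le_of_eq ?_)
      rw [pow_add, pow_add]; ring
    · intro x _ y _ hxy
      simp only [Prod.mk.injEq] at hxy
      obtain ⟨e1, e2, e3⟩ := hxy
      rw [← Int.emod_add_mul_ediv x (4 ^ s), ← Int.emod_add_mul_ediv y (4 ^ s),
        ← Int.emod_add_mul_ediv (x / 4 ^ s) (4 ^ m), ← Int.emod_add_mul_ediv (y / 4 ^ s) (4 ^ m),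
        e1, e2, e3]
  have hI : ∀ l : ℕ, (Finset.Ico (0:ℤ) (4 ^ l)).card = 4 ^ l := fun l => by
    rw [Int.card_Ico, sub_zero, show (4:ℤ) ^ l = ((4 ^ l : ℕ) : ℤ) by push_cast; rfl,
      Int.toNat_natCast]
  rw [Finset.card_product, Finset.card_product, hI, hI] at hcard
  calc (F.card : ℝ) ≤ ((4 ^ s * (G.card * 4 ^ n) : ℕ) : ℝ) := Nat.cast_le.2 hcard
    _ = 4 ^ s * 4 ^ n * G.card := by push_cast; ring
    _ ≤ _ := by gcongr

section

variable {K K₂ B₁ B₂ B₃ V₁ V₂ V₃ : ℝ} {p j t : ℕ} {S₁ S₂ S₃ : Set ℤ}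

lemma refine3_period (h1 : Good K₂ (p + 128 * j + t) B₁ V₁ S₁)
    (h2 : Good K₂ (p + 128 * j) B₂ V₂ S₂) (h3 : Good K₂ p B₃ V₃ S₃) {X : ℤ}
    (hX : X ∈ refine3 t S₁ S₂ S₃) (m : ℤ) :
    X + 4 ^ (p + 128 * j + 2 * t) * m ∈ refine3 t S₁ S₂ S₃ := by
  obtain ⟨hX1, hX2, hX3⟩ := hX
  have h4t : (4:ℤ) ^ t ≠ 0 := by positivity
  have e : (X + 4 ^ (p + 128 * j + 2 * t) * m) / 4 ^ t
      = X / 4 ^ t + 4 ^ (p + 128 * j) * (4 ^ t * m) := by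
    rw [show X + 4 ^ (p + 128 * j + 2 * t) * m = X + 4 ^ t * (4 ^ (p + 128 * j) * (4 ^ t * m)) by
      rw [two_mul t, pow_add, pow_add]; ring, Int.add_mul_ediv_left _ _ h4t]
  refine ⟨?_, ?_, ?_⟩
  · have := h1.period X hX1 (4 ^ t * m)
    rwa [← mul_assoc, ← pow_add, add_assoc _ t t, ← two_mul] at this
  · rw [e]; exact h2.period _ hX2 _
  · rw [e, pow_add, mul_assoc]; exact h3.period _ hX3 _

lemma card_not_refine3_le (h1 : Good K₂ (p + 128 * j + t) B₁ V₁ S₁)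
    (h2 : Good K₂ (p + 128 * j) B₂ V₂ S₂) (h3 : Good K₂ p B₃ V₃ S₃) (F : Finset ℤ)
    (hF : ∀ X ∈ F, (0 ≤ X ∧ X < 4 ^ (p + 128 * j + 2 * t)) ∧ X ∉ refine3 t S₁ S₂ S₃) :
    (F.card : ℝ) ≤ 4 ^ t * B₁ + 4 ^ (2 * t) * B₂ + 4 ^ (128 * j + 2 * t) * B₃ := by
  classical
  have f1 := h1.card_digit_bad_le 0 t (F.filter fun X => X ∉ S₁) fun X hX => by
    obtain ⟨hX, h⟩ := Finset.mem_filter.1 hX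
    refine ⟨?_, by simpa using h⟩
    convert (hF X hX).1 using 3
    ring
  have f2 := h2.card_digit_bad_le t t (F.filter fun X => X / 4 ^ t ∉ S₂) fun X hX => by
    obtain ⟨hX, h⟩ := Finset.mem_filter.1 hX
    refine ⟨?_, h⟩
    convert (hF X hX).1 using 3
    ring
  have f3 := h3.card_digit_bad_le t (128 * j + t) (F.filter fun X => X / 4 ^ t ∉ S₃) fun X hX => by
    obtain ⟨hX, h⟩ := Finset.mem_filter.1 hX
    refine ⟨?_, h⟩
    convert (hF X hX).1 using 3
    ring
  have hsub : F ⊆ (F.filter fun X => X ∉ S₁) ∪ (F.filter fun X => X / 4 ^ t ∉ S₂)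
      ∪ (F.filter fun X => X / 4 ^ t ∉ S₃) := fun X hX => by
    have h := (hF X hX).2
    simp only [Finset.mem_union, Finset.mem_filter, hX, true_and]
    by_contra! hc
    exact h ⟨hc.1.1, hc.1.2, hc.2⟩
  have hc := (Finset.card_le_card hsub).trans ((Finset.card_union_le _ _).trans
    (Nat.add_le_add_right (Finset.card_union_le _ _) _))
  have hc' : (F.card : ℝ) ≤ _ := Nat.cast_le.2 hc
  push_cast at hc'
  refine hc'.trans (add_le_add (add_le_add (f1.trans_eq ?_) (f2.trans_eq ?_)) (f3.trans_eq ?_))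
  · simp
  · rw [two_mul t, pow_add]
  · rw [two_mul t, ← pow_add]; congr 2; ring

/-- The total number of close pairs at the new level. -/
def pairBound (K : ℝ) (k j : ℕ) (V₁ V₂ V₃ : ℝ) : ℝ :=
  4 * 4 ^ k * (V₂ * (2 ^ 37 / 2 ^ j * (energyC * V₁)
        + (48 * coarseC K) ^ 2 * 2 ^ (512 * j)) + V₃ * (energyC * V₁ + 1))

lemma exists_good_of_good (hK : 0 ≤ K) (hK₂ : 16 * coarseC K ≤ K₂)
    (hqt : t ≤ p + 128 * j) (h1 : Good K₂ (p + 128 * j + t) B₁ V₁ S₁)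
    (h2 : Good K₂ (p + 128 * j) B₂ V₂ S₂) (h3 : Good K₂ p B₃ V₃ S₃) (hV1 : 0 ≤ V₁)
    (hV2 : 0 ≤ V₂) (hV3 : 0 ≤ V₃) {V : ℝ} (hV : 0 < V) :
    ∃ S, Good K (p + 128 * j + 2 * t) (4 ^ t * B₁ + 4 ^ (2 * t) * B₂ + 4 ^ (128 * j + 2 * t) * B₃
      + pairBound K (p + 128 * j + 2 * t) j V₁ V₂ V₃ / V) V S := by
  classical
  set k := p + 128 * j + 2 * t with hk
  set S := refine3 t S₁ S₂ S₃ with hS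
  refine ⟨{X | X ∈ S ∧ ((nbr K k S X).card : ℝ) ≤ V}, ?_, ?_, ?_⟩
  · rintro X ⟨hX, hXV⟩ m
    refine ⟨refine3_period h1 h2 h3 hX m, le_trans (Nat.cast_le.2 ?_) hXV⟩
    refine Finset.card_le_card_of_injOn (fun Y => Y + 4 ^ k * (-m)) (fun Y hY => ?_)
      ((add_left_injective _).injOn)
    obtain ⟨hY, hn⟩ := mem_nbr.1 hY
    refine mem_nbr.2 ⟨refine3_period h1 h2 h3 hY _, ?_⟩
    have := near_add_period (-m) hn
    rwa [add_assoc, ← mul_add, add_neg_cancel, mul_zero, add_zero] at this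
  · intro F hF
    have f1 := card_not_refine3_le h1 h2 h3 (F.filter fun X => X ∉ S) fun X hX => by
      obtain ⟨hX, h⟩ := Finset.mem_filter.1 hX
      exact ⟨⟨(hF X hX).1, (hF X hX).2.1⟩, h⟩
    have f2 := sum_card_nbr_le hK hK₂ hqt h1 h2 h3 hV1 hV2 hV3
      (F.filter fun X => X ∈ S) fun X hX => by
      obtain ⟨hX, h⟩ := Finset.mem_filter.1 hX
      exact ⟨⟨(hF X hX).1, (hF X hX).2.1⟩, h⟩
    have f3 : ((F.filter fun X => X ∈ S).card : ℝ) * V ≤ pairBound K k j V₁ V₂ V₃ := by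
      refine le_trans ?_ f2
      rw [← nsmul_eq_mul]
      refine Finset.card_nsmul_le_sum _ _ _ fun X hX => ?_
      obtain ⟨hX, h⟩ := Finset.mem_filter.1 hX
      by_contra! hc
      exact (hF X hX).2.2 ⟨h, hc.le⟩
    rw [← le_div_iff₀ hV] at f3
    have := Finset.card_filter_add_card_filter_not (s := F) (p := fun X => X ∈ S)
    have hc : (F.card : ℝ) = (F.filter fun X => X ∈ S).card + (F.filter fun X => X ∉ S).card := by
      rw [← this]; push_cast; rfl
    rw [hc]
    linarith
  · rintro X ⟨hX, hXV⟩ F hF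
    refine le_trans (Nat.cast_le.2 (Finset.card_le_card fun Y hY => ?_)) hXV
    exact mem_nbr.2 ⟨(hF Y hY).1.1, (hF Y hY).2⟩

end

lemma Good.mono {K B B' V V' : ℝ} {k : ℕ} {S : Set ℤ} (h : Good K k B V S) (hB : B ≤ B')
    (hV : V ≤ V') : Good K k B' V' S :=
  ⟨h.period, fun F hF => (h.bad F hF).trans hB, fun c hc F hF => (h.mult c hc F hF).trans hV⟩

/-- Up to exponentially small exceptional sets, every address of level `k` has at most
`2 ^ ((1 - b) * k)` close addresses. -/
def GoodDim (b : ℝ) : Prop := ∀ K > (0:ℝ), ∃ C ≥ (1:ℝ), ∃ η > (0:ℝ), ∀ k : ℕ, ∃ S : Set ℤ,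
  Good K k (C * 4 ^ k * 2 ^ (-(η * k))) (C * 2 ^ ((1 - b) * k)) S

lemma GoodDim.mono {b b' : ℝ} (h : GoodDim b) (hb : b' ≤ b) : GoodDim b' := fun K hK => by
  obtain ⟨C, hC, η, hη, hS⟩ := h K hK
  refine ⟨C, hC, η, hη, fun k => (hS k).imp fun S hS => hS.mono le_rfl ?_⟩
  gcongr
  norm_num

lemma goodDim_zero : GoodDim 0 := fun K hK => by
  refine ⟨2 * K + 1, by linarith, 1, one_pos, fun k => ⟨Set.univ, fun _ _ _ => trivial,
    fun F hF => ?_, fun c _ F hF => ?_⟩⟩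
  · have : F = ∅ := Finset.eq_empty_of_forall_notMem fun c hc => (hF c hc).2.2 trivial
    rw [this, Finset.card_empty, Nat.cast_zero]; positivity
  · have h := card_le_of_pairwise_dist_le F (R := 2 * (K * 2 ^ k)) (by positivity)
      fun a ha b hb => by
        have h1 := abs_le.1 (hF a ha).2.1
        have h2 := abs_le.1 (hF b hb).2.1
        rw [abs_le]; constructor <;> linarith
    rw [sub_zero, one_mul, Real.rpow_natCast]
    have : (1:ℝ) ≤ 2 ^ k := one_le_pow₀ (by norm_num)
    nlinarith

/-- The choice of the intermediate levels. -/
lemma exists_levels {ε : ℝ} (hε : 0 < ε) (hε1 : ε ≤ 1) (k : ℕ) : ∃ p j t : ℕ,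
    k = p + 128 * j + 2 * t ∧ t ≤ p + 128 * j ∧ p + 128 * j ≤ t + 2 ∧ 512 * (j : ℝ) ≤ ε * t ∧
    k ≤ 4 * p ∧ ε ^ 2 / 1536 * k ≤ ε * j + 2 := by
  set t := k / 3 with ht
  set j := ⌊ε * t / 512⌋₊ with hj
  have hjε : 512 * (j : ℝ) ≤ ε * t := by
    have := Nat.floor_le (by positivity : 0 ≤ ε * t / 512)
    rw [← hj] at this; linarith
  have hjt : 512 * j ≤ t := by
    have : 512 * (j : ℝ) ≤ t := hjε.trans (mul_le_of_le_one_left (by positivity) hε1)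
    exact_mod_cast this
  refine ⟨k - 2 * t - 128 * j, j, t, by omega, by omega, by omega, hjε, by omega, ?_⟩
  have h1 := Nat.lt_floor_add_one (ε * t / 512)
  rw [← hj] at h1
  have h2 : (k : ℝ) ≤ 3 * t + 2 := by
    have : k ≤ 3 * t + 2 := by omega
    exact_mod_cast this
  have h3 : ε ^ 2 / 1536 * k ≤ ε ^ 2 / 1536 * (3 * t + 2) := by gcongr
  have h4 : ε * (ε * t / 512) ≤ ε * (j + 1) := by gcongr
  nlinarith

lemma two_rpow_mul_rpow (x y : ℝ) : (2:ℝ) ^ x * 2 ^ y = 2 ^ (x + y) :=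
  (Real.rpow_add two_pos x y).symm

lemma two_rpow_mono {x y : ℝ} (h : x ≤ y) : (2:ℝ) ^ x ≤ 2 ^ y :=
  Real.rpow_le_rpow_of_exponent_le one_le_two h

lemma pairBound_le {K C β ε : ℝ} (hC : 1 ≤ C) (hε : 0 < ε) (hε1 : ε ≤ 1)
    (hβ : ε ≤ β) (hβ1 : β ≤ 1) {p j t : ℕ} (hq : p + 128 * j ≤ t + 2)
    (hj : 512 * (j : ℝ) ≤ ε * t)
    (hk : ε ^ 2 / 1536 * ((p + 128 * j + 2 * t : ℕ) : ℝ) ≤ ε * j + 2) :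
    pairBound K (p + 128 * j + 2 * t) j (C * 2 ^ (β * ((p + 128 * j + t : ℕ) : ℝ)))
      (C * 2 ^ (β * ((p + 128 * j : ℕ) : ℝ))) (C * 2 ^ (β * (p : ℝ)))
    ≤ 64 * (2 ^ 37 * energyC * C ^ 2 + C * (48 * coarseC K) ^ 2 + energyC * C ^ 2 + C ^ 2)
      * 4 ^ (p + 128 * j + 2 * t)
      * 2 ^ ((β - ε ^ 2 / 1536) * ((p + 128 * j + 2 * t : ℕ) : ℝ)) := by
  have hE := energyC_nonneg
  set k := p + 128 * j + 2 * t with hkdef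
  set x : ℝ := (β - ε ^ 2 / 1536) * (k : ℝ) with hx
  have hkR : (k : ℝ) = p + 128 * j + 2 * t := by rw [hkdef]; push_cast; ring
  have hqR : (p : ℝ) + 128 * j ≤ t + 2 := by exact_mod_cast hq
  have hj0 : (0:ℝ) ≤ j := Nat.cast_nonneg _
  have hp0 : (0:ℝ) ≤ p := Nat.cast_nonneg _
  have ht0 : (0:ℝ) ≤ t := Nat.cast_nonneg _
  have hβ0 : 0 ≤ β := hε.le.trans hβ
  have hεj : ε * j ≤ j := mul_le_of_le_one_left hj0 hε1
  have hβ2 : β * ((p : ℝ) + 128 * j) ≤ β * (t + 2) := by gcongr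
  have hεβj : ε * j ≤ β * j := by gcongr
  have hεβt : ε * t ≤ β * t := by gcongr
  have hxe : x = β * (p + 128 * j + 2 * t) - ε ^ 2 / 1536 * k := by rw [hx, sub_mul, hkR]
  have h16 : (2:ℝ) ^ (x + 4) = 16 * 2 ^ x := by
    rw [Real.rpow_add two_pos]; norm_num; ring
  have hj2 : (2:ℝ) ^ (-(j:ℝ)) = 1 / 2 ^ j := by
    rw [Real.rpow_neg two_pos.le, Real.rpow_natCast, one_div]
  have t1 : (2:ℝ) ^ (β * ((p + 128 * j : ℕ) : ℝ)) * 2 ^ (β * ((p + 128 * j + t : ℕ) : ℝ))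
      * (1 / 2 ^ j) ≤ 16 * 2 ^ x := by
    rw [← hj2, two_rpow_mul_rpow, two_rpow_mul_rpow, ← h16]
    apply two_rpow_mono
    push_cast
    nlinarith
  have t2 : (2:ℝ) ^ (β * ((p + 128 * j : ℕ) : ℝ)) * 2 ^ (512 * j) ≤ 16 * 2 ^ x := by
    rw [← Real.rpow_natCast, two_rpow_mul_rpow, ← h16]
    apply two_rpow_mono
    push_cast
    nlinarith
  have t3 : (2:ℝ) ^ (β * (p:ℝ)) * 2 ^ (β * ((p + 128 * j + t : ℕ) : ℝ)) ≤ 16 * 2 ^ x := by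
    rw [two_rpow_mul_rpow, ← h16]
    apply two_rpow_mono
    push_cast
    nlinarith
  have t4 : (2:ℝ) ^ (β * (p:ℝ)) ≤ 16 * 2 ^ x := by
    refine le_trans (le_mul_of_one_le_right (by positivity) ?_) t3
    exact Real.one_le_rpow one_le_two (by positivity)
  set a := (2:ℝ) ^ (β * ((p + 128 * j : ℕ) : ℝ))
  set b := (2:ℝ) ^ (β * ((p + 128 * j + t : ℕ) : ℝ))
  set c := (2:ℝ) ^ (β * (p:ℝ)) with hc
  have hc0 : 0 < c := by positivity
  unfold pairBound
  calc _ = 4 * 4 ^ k * (2 ^ 37 * energyC * C ^ 2 * (a * b * (1 / 2 ^ j))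
        + C * (48 * coarseC K) ^ 2 * (a * 2 ^ (512 * j)) + energyC * C ^ 2 * (c * b)
        + C * c) := by ring
    _ ≤ 4 * 4 ^ k * (2 ^ 37 * energyC * C ^ 2 * (16 * 2 ^ x)
        + C * (48 * coarseC K) ^ 2 * (16 * 2 ^ x) + energyC * C ^ 2 * (16 * 2 ^ x)
        + C ^ 2 * (16 * 2 ^ x)) := by
        gcongr
        nlinarith
    _ = _ := by ring

lemma bad_total_le {C η : ℝ} (hC : 1 ≤ C) (hη : 0 < η) {p j t : ℕ}
    (hp : p + 128 * j + 2 * t ≤ 4 * p) :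
    4 ^ t * (C * 4 ^ (p + 128 * j + t) * 2 ^ (-(η * ((p + 128 * j + t : ℕ) : ℝ))))
      + 4 ^ (2 * t) * (C * 4 ^ (p + 128 * j) * 2 ^ (-(η * ((p + 128 * j : ℕ) : ℝ))))
      + 4 ^ (128 * j + 2 * t) * (C * 4 ^ p * 2 ^ (-(η * (p : ℝ))))
    ≤ 3 * C * 4 ^ (p + 128 * j + 2 * t) *
      2 ^ (-(η / 4 * ((p + 128 * j + 2 * t : ℕ) : ℝ))) := by
  set X := (2:ℝ) ^ (-(η / 4 * ((p + 128 * j + 2 * t : ℕ) : ℝ))) with hX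
  have hpR : ((p + 128 * j + 2 * t : ℕ) : ℝ) ≤ 4 * p := by exact_mod_cast hp
  have h : ∀ n : ℕ, p ≤ n → (2:ℝ) ^ (-(η * (n : ℝ))) ≤ X := fun n hn => by
    apply two_rpow_mono
    have : (p : ℝ) ≤ n := by exact_mod_cast hn
    nlinarith
  have h1 := h (p + 128 * j + t) (by omega)
  have h2 := h (p + 128 * j) (by omega)
  have h3 := h p le_rfl
  calc _ ≤ 4 ^ t * (C * 4 ^ (p + 128 * j + t) * X) + 4 ^ (2 * t) * (C * 4 ^ (p + 128 * j) * X)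
      + 4 ^ (128 * j + 2 * t) * (C * 4 ^ p * X) := by gcongr
    _ = _ := by
      rw [two_mul, pow_add, pow_add, pow_add, pow_add, pow_add, pow_add]; ring

lemma GoodDim.step {b ε : ℝ} (hε : 0 < ε) (hb0 : 0 ≤ b) (hb : b ≤ 1 - ε) (h : GoodDim b) :
    GoodDim (b + ε ^ 2 / 3072) := fun K hK => by
  have hcK := le_coarseC hK.le
  obtain ⟨C, hC, η, hη, hS⟩ := h (16 * coarseC K) (by linarith)
  have hE := energyC_nonneg
  set L : ℝ := 64 * (2 ^ 37 * energyC * C ^ 2 + C * (48 * coarseC K) ^ 2 + energyC * C ^ 2 + C ^ 2)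
    with hL
  have hL0 : 0 ≤ L := by positivity
  refine ⟨3 * C + L, by linarith, min (η / 4) (ε ^ 2 / 3072), by positivity, fun k => ?_⟩
  have hε1 : ε ≤ 1 := by linarith
  obtain ⟨p, j, t, rfl, hqt, hq, hj, hp, hk⟩ := exists_levels hε hε1 k
  obtain ⟨S₁, h1⟩ := hS (p + 128 * j + t)
  obtain ⟨S₂, h2⟩ := hS (p + 128 * j)
  obtain ⟨S₃, h3⟩ := hS p
  obtain ⟨S, hg⟩ := exists_good_of_good hK.le le_rfl hqt h1 h2 h3 (by positivity) (by positivity)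
    (by positivity)
    (V := 2 ^ ((1 - (b + ε ^ 2 / 3072)) * ((p + 128 * j + 2 * t : ℕ) : ℝ))) (by positivity)
  refine ⟨S, hg.mono ?_ (le_mul_of_one_le_left (by positivity) (by linarith))⟩
  have e1 := bad_total_le (C := C) hC hη hp
  have e2 := pairBound_le (K := K) hC hε hε1 (β := 1 - b) (by linarith) (by linarith) hq hj hk
  rw [← hL] at e2
  set k := p + 128 * j + 2 * t with hkdef
  have e3 : pairBound K k j (C * 2 ^ ((1 - b) * ((p + 128 * j + t : ℕ) : ℝ)))
      (C * 2 ^ ((1 - b) * ((p + 128 * j : ℕ) : ℝ))) (C * 2 ^ ((1 - b) * (p : ℝ)))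
      / 2 ^ ((1 - (b + ε ^ 2 / 3072)) * (k : ℝ)) ≤ L * 4 ^ k * 2 ^ (-(ε ^ 2 / 3072 * k)) := by
    rw [div_le_iff₀ (by positivity)]
    refine e2.trans (le_of_eq ?_)
    rw [mul_assoc (L * 4 ^ k), two_rpow_mul_rpow]
    congr 2; ring
  have hk0 : (0:ℝ) ≤ k := Nat.cast_nonneg _
  have m1 : (2:ℝ) ^ (-(η / 4 * k)) ≤ 2 ^ (-(min (η / 4) (ε ^ 2 / 3072) * k)) := by
    apply two_rpow_mono
    gcongr
    exact min_le_left _ _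
  have m2 : (2:ℝ) ^ (-(ε ^ 2 / 3072 * k)) ≤ 2 ^ (-(min (η / 4) (ε ^ 2 / 3072) * k)) := by
    apply two_rpow_mono
    gcongr
    exact min_le_right _ _
  calc _ ≤ 3 * C * 4 ^ k * 2 ^ (-(η / 4 * k)) + L * 4 ^ k * 2 ^ (-(ε ^ 2 / 3072 * k)) :=
        add_le_add e1 e3
    _ ≤ 3 * C * 4 ^ k * 2 ^ (-(min (η / 4) (ε ^ 2 / 3072) * k))
        + L * 4 ^ k * 2 ^ (-(min (η / 4) (ε ^ 2 / 3072) * k)) := by gcongr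
    _ = _ := by ring

lemma goodDim_one_sub {ε : ℝ} (hε : 0 < ε) (hε1 : ε ≤ 1) : GoodDim (1 - ε) := by
  have h : ∀ n : ℕ, GoodDim (min (n * (ε ^ 2 / 3072)) (1 - ε)) := fun n => by
    induction n with
    | zero => exact goodDim_zero.mono (by simp)
    | succ n ih =>
      refine (ih.step hε (le_min (by positivity) (by linarith)) (min_le_right _ _)).mono ?_
      push_cast
      rw [min_add]
      refine min_le_min (by linarith) ?_
      have : 0 < ε ^ 2 / 3072 := by positivity
      linarith
  obtain ⟨n, hn⟩ := exists_nat_ge ((1 - ε) / (ε ^ 2 / 3072))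
  rw [div_le_iff₀ (by positivity)] at hn
  exact (h n).mono (le_min hn le_rfl)

lemma hausdorffMeasure_image_ne_zero {X : Type*} [MetricSpace X] [MeasurableSpace X] [BorelSpace X]
    {f : ℝ → X} (hf : Continuous f) {A : Set ℝ} (hA0 : volume A ≠ 0)
    {C s : ℝ} (hC : 0 < C) (hs : 0 < s) (k₀ : ℕ)
    (h : ∀ k ≥ k₀, ∀ x ∈ A, volume {y ∈ A | dist (f x) (f y) ≤ (1 / 2) ^ k} ≤
      ENNReal.ofReal (C * ((1 / 2 : ℝ) ^ k) ^ s)) :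
    μH[s] (f '' A) ≠ 0 := by
  set μ : Measure X := (volume.restrict A).map f with hμ
  set c : ℝ := C * 2 ^ s with hc
  have hc0 : 0 < c := by positivity
  have hcE : ENNReal.ofReal c ≠ 0 := by simpa using hc0
  have key : (ENNReal.ofReal c)⁻¹ • μ ≤ μH[s] := by
    refine Measure.le_hausdorffMeasure s _ (ENNReal.ofReal ((1 / 2) ^ (k₀ + 1)))
      (by simp) fun U hU => ?_
    rw [Measure.smul_apply, smul_eq_mul, ENNReal.inv_mul_le_iff hcE ENNReal.ofReal_ne_top]
    have h1 : μ U ≤ volume (f ⁻¹' closure U ∩ A) := by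
      refine (measure_mono subset_closure).trans (le_of_eq ?_)
      rw [hμ, Measure.map_apply hf.measurable isClosed_closure.measurableSet,
        Measure.restrict_apply (hf.measurable isClosed_closure.measurableSet)]
    refine h1.trans ?_
    rcases (f ⁻¹' closure U ∩ A).eq_empty_or_nonempty with he | ⟨x, hxU, hxA⟩
    · simp [he]
    have hD : Metric.ediam U ≠ ⊤ := (hU.trans_lt ENNReal.ofReal_lt_top).ne
    obtain ⟨D, hD0, hDU⟩ : ∃ D : ℝ, 0 ≤ D ∧ Metric.ediam U = ENNReal.ofReal D :=
      ⟨_, ENNReal.toReal_nonneg, (ENNReal.ofReal_toReal hD).symm⟩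
    have h2 : ∀ k ≥ k₀, D ≤ (1 / 2) ^ k →
        volume (f ⁻¹' closure U ∩ A) ≤ ENNReal.ofReal (C * ((1 / 2 : ℝ) ^ k) ^ s) := by
      intro k hk hDk
      refine (measure_mono ?_).trans (h k hk x hxA)
      rintro y ⟨hyU, hyA⟩
      refine ⟨hyA, le_trans ?_ hDk⟩
      have := Metric.edist_le_ediam_of_mem (mem_preimage.1 hxU) (mem_preimage.1 hyU)
      rw [Metric.ediam_closure, hDU, edist_dist] at this
      exact (ENNReal.ofReal_le_ofReal_iff hD0).1 this
    rw [hDU] at hU ⊢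
    rw [ENNReal.ofReal_le_ofReal_iff (by positivity)] at hU
    rcases hD0.eq_or_lt with rfl | hDpos
    · have ht : Tendsto (fun k : ℕ => ENNReal.ofReal (C * ((1 / 2 : ℝ) ^ k) ^ s)) atTop
          (nhds 0) := by
        have h3 : Tendsto (fun k : ℕ => (1 / 2 : ℝ) ^ k) atTop (nhds 0) :=
          tendsto_pow_atTop_nhds_zero_of_lt_one (by norm_num) (by norm_num)
        have h4 := ENNReal.tendsto_ofReal ((h3.rpow_const (Or.inr hs.le)).const_mul C)
        simpa [zero_rpow hs.ne'] using h4
      refine (ge_of_tendsto ht ?_).trans zero_le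
      filter_upwards [eventually_ge_atTop k₀] with k hk
      exact h2 k hk (by positivity)
    · have hD1 : D ≤ 1 := hU.trans (pow_le_one₀ (by norm_num) (by norm_num))
      obtain ⟨k, hk1, hk2⟩ := exists_nat_pow_near_of_lt_one hDpos hD1
        (show (0:ℝ) < 1 / 2 by norm_num) (by norm_num)
      have hk : k₀ ≤ k := by
        have := (pow_lt_pow_iff_right_of_lt_one₀ (show (0:ℝ) < 1 / 2 by norm_num)
          (by norm_num)).1 (hk1.trans_le hU)
        omega
      refine (h2 k hk hk2).trans ?_
      rw [ENNReal.ofReal_rpow_of_pos hDpos, ← ENNReal.ofReal_mul hc0.le]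
      refine ENNReal.ofReal_le_ofReal ?_
      rw [hc, mul_assoc, ← mul_rpow (by norm_num) hD0]
      have : (1 / 2 : ℝ) ^ k ≤ 2 * D := by
        rw [pow_succ] at hk1; linarith
      gcongr
  have hμA : μ (f '' A) ≠ 0 := by
    have h1 : volume.restrict A (f ⁻¹' (f '' A)) ≤ μ (f '' A) :=
      Measure.le_map_apply hf.measurable.aemeasurable _
    have h2 : volume A ≤ volume.restrict A (f ⁻¹' (f '' A)) := by
      rw [← Measure.restrict_apply_self volume A]
      exact measure_mono (subset_preimage_image f A)
    exact fun h0 => hA0 (le_antisymm ((h2.trans h1).trans h0.le) zero_le)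
  intro h0
  have := key (f '' A)
  rw [h0, Measure.smul_apply, smul_eq_mul, nonpos_iff_eq_zero, mul_eq_zero] at this
  exact this.elim (by simp) hμA

lemma volume_floor_mem_le (k : ℕ) (F : Finset ℤ) :
    volume {y : ℝ | ⌊4 ^ k * y⌋ ∈ F} ≤ ENNReal.ofReal (F.card / 4 ^ k) := by
  have h4 : (0:ℝ) < 4 ^ k := by positivity
  have hsub : {y : ℝ | ⌊4 ^ k * y⌋ ∈ F} ⊆ ⋃ d ∈ F, Ico ((d:ℝ) / 4 ^ k) ((d + 1) / 4 ^ k) := by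
    intro y hy
    refine mem_biUnion hy ⟨?_, ?_⟩
    · rw [div_le_iff₀ h4, mul_comm]; exact Int.floor_le _
    · rw [lt_div_iff₀ h4, mul_comm]; exact Int.lt_floor_add_one _
  refine (measure_mono hsub).trans ((measure_biUnion_finset_le _ _).trans ?_)
  have : ∀ d ∈ F, volume (Ico ((d:ℝ) / 4 ^ k) ((d + 1) / 4 ^ k)) = ENNReal.ofReal (1 / 4 ^ k) := by
    intro d _
    rw [Real.volume_Ico]
    congr 1
    ring
  rw [Finset.sum_congr rfl this, Finset.sum_const, nsmul_eq_mul, ← ENNReal.ofReal_natCast,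
    ← ENNReal.ofReal_mul (by positivity)]
  exact ENNReal.ofReal_le_ofReal (le_of_eq (by ring))

lemma Good.volume_bad_le {K B V : ℝ} {k : ℕ} {S : Set ℤ} (hS : Good K k B V S) :
    volume {x ∈ Ico (0:ℝ) 1 | ⌊4 ^ k * x⌋ ∉ S} ≤ ENNReal.ofReal (B / 4 ^ k) := by
  classical
  have h4 : (0:ℝ) < 4 ^ k := by positivity
  set F : Finset ℤ := (Finset.Ico 0 (4 ^ k)).filter (· ∉ S) with hF
  refine (measure_mono ?_).trans ((volume_floor_mem_le k F).trans ?_)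
  · rintro x ⟨⟨h0, h1⟩, hx⟩
    refine Finset.mem_filter.2 ⟨Finset.mem_Ico.2 ⟨Int.floor_nonneg.2 (by positivity), ?_⟩, hx⟩
    rw [Int.floor_lt]
    push_cast
    nlinarith
  · have := hS.bad F fun c hc => by
      simpa [hF, and_assoc] using hc
    gcongr

lemma near_floor {k : ℕ} {x y : ℝ} (h1 : |x - y| ≤ (1 / 2) ^ k)
    (h2 : ‖Wc x - Wc y‖ ≤ (1 / 2) ^ k) : Near 50 k ⌊4 ^ k * x⌋ ⌊4 ^ k * y⌋ := by
  have h4 : (0:ℝ) < 4 ^ k := by positivity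
  have hp : (0:ℝ) < 2 ^ k := by positivity
  have hp1 : (1:ℝ) ≤ 2 ^ k := one_le_pow₀ (by norm_num)
  rw [one_div, inv_pow, ← one_div] at h1 h2
  have hfl : ∀ z : ℝ, ‖Wc z - Wc (⌊4 ^ k * z⌋ / 4 ^ k)‖ ≤ 24 / 2 ^ k := fun z => by
    have hz : |z - ⌊4 ^ k * z⌋ / 4 ^ k| ≤ 1 / 4 ^ k := by
      rw [show z - ⌊4 ^ k * z⌋ / 4 ^ k = (4 ^ k * z - ⌊4 ^ k * z⌋) / 4 ^ k by field_simp,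
        abs_div, abs_of_pos h4]
      gcongr
      rw [abs_le]
      constructor <;> linarith [Int.floor_le (4 ^ k * z), Int.lt_floor_add_one (4 ^ k * z)]
    calc _ ≤ _ := Wc_sub_le' k _ _
      _ ≤ 16 * 2 ^ k * (1 / 4 ^ k) + 8 / 2 ^ k := by gcongr
      _ = 24 / 2 ^ k := by rw [four_pow_eq_sq]; field_simp; norm_num
  refine ⟨?_, ?_⟩
  · have e : |4 ^ k * x - 4 ^ k * y| ≤ 2 ^ k := by
      rw [← mul_sub, abs_mul, abs_of_pos h4]
      calc (4:ℝ) ^ k * |x - y| ≤ 4 ^ k * (1 / 2 ^ k) := by gcongr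
        _ = 2 ^ k := by rw [four_pow_eq_sq]; field_simp
    rw [abs_le] at e ⊢
    constructor <;> linarith [Int.floor_le (4 ^ k * x), Int.lt_floor_add_one (4 ^ k * x),
      Int.floor_le (4 ^ k * y), Int.lt_floor_add_one (4 ^ k * y)]
  · set u := Wc (⌊4 ^ k * x⌋ / 4 ^ k)
    set v := Wc (⌊4 ^ k * y⌋ / 4 ^ k)
    have hx := hfl x
    have hy := hfl y
    rw [norm_sub_rev] at hx
    calc ‖u - v‖ = ‖(u - Wc x) + (Wc x - Wc y) + (Wc y - v)‖ := by congr 1; ring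
      _ ≤ ‖u - Wc x‖ + ‖Wc x - Wc y‖ + ‖Wc y - v‖ := norm_add₃_le
      _ ≤ 24 / 2 ^ k + 1 / 2 ^ k + 24 / 2 ^ k := by gcongr
      _ ≤ 50 / 2 ^ k := by
        rw [← add_div, ← add_div]; gcongr; norm_num

lemma exists_set_close_pairs {ε : ℝ} (hε : 0 < ε) (hε1 : ε ≤ 1) :
    ∃ A ⊆ Icc (0:ℝ) 1, volume A ≠ 0 ∧ ∃ C > (0:ℝ), ∃ k₀ : ℕ, ∀ k ≥ k₀,
      ∀ x ∈ A, volume {y ∈ A | |x - y| ≤ (1 / 2) ^ k ∧ ‖Wc x - Wc y‖ ≤ (1 / 2) ^ k} ≤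
        ENNReal.ofReal (C * ((1 / 2 : ℝ) ^ k) ^ (2 - ε)) := by
  obtain ⟨C, hC, η, hη, hG⟩ := goodDim_one_sub hε hε1 50 (by norm_num)
  choose S hS using hG
  set r : ℝ := 2 ^ (-η) with hr
  have hr0 : 0 < r := by positivity
  have hr1 : r < 1 := rpow_lt_one_of_one_lt_of_neg (by norm_num) (by linarith)
  obtain ⟨k₀, hk₀⟩ : ∃ k₀ : ℕ, C / (1 - r) * r ^ k₀ < 1 := by
    have := (tendsto_pow_atTop_nhds_zero_of_lt_one hr0.le hr1).const_mul (C / (1 - r))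
    rw [mul_zero] at this
    exact (this.eventually_lt_const one_pos).exists
  set bad : ℕ → Set ℝ := fun j => {x ∈ Ico (0:ℝ) 1 | ⌊4 ^ (k₀ + j) * x⌋ ∉ S (k₀ + j)} with hbad
  set A : Set ℝ := Ico 0 1 ∩ ⋂ j : ℕ, {x | ⌊4 ^ (k₀ + j) * x⌋ ∈ S (k₀ + j)} with hA
  have hbadv : ∀ j, volume (bad j) ≤ ENNReal.ofReal (C * r ^ k₀ * r ^ j) := fun j => by
    refine (hS (k₀ + j)).volume_bad_le.trans (ENNReal.ofReal_le_ofReal (le_of_eq ?_))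
    rw [mul_assoc C (r ^ k₀), ← pow_add, hr, ← rpow_mul_natCast (by norm_num), neg_mul]
    field_simp
  refine ⟨A, inter_subset_left.trans Ico_subset_Icc_self, ?_, C, by positivity, k₀, ?_⟩
  · intro h0
    have hcov : Ico (0:ℝ) 1 ⊆ A ∪ ⋃ j, bad j := by
      intro x hx
      by_cases hxA : x ∈ A
      · exact Or.inl hxA
      · right
        rw [mem_iUnion]
        by_contra! hb
        refine hxA ⟨hx, mem_iInter.2 fun j => ?_⟩
        by_contra hj
        exact hb j ⟨hx, hj⟩
    have h1 : volume (Ico (0:ℝ) 1) ≤ ∑' j, ENNReal.ofReal (C * r ^ k₀ * r ^ j) :=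
      calc _ ≤ volume (A ∪ ⋃ j, bad j) := measure_mono hcov
        _ ≤ volume A + volume (⋃ j, bad j) := measure_union_le _ _
        _ = volume (⋃ j, bad j) := by rw [h0, zero_add]
        _ ≤ ∑' j, volume (bad j) := measure_iUnion_le _
        _ ≤ _ := ENNReal.tsum_le_tsum hbadv
    rw [← ENNReal.ofReal_tsum_of_nonneg (fun j => by positivity)
      ((summable_geometric_of_lt_one hr0.le hr1).mul_left _), tsum_mul_left,
      tsum_geometric_of_lt_one hr0.le hr1, Real.volume_Ico] at h1
    have h2 : (1:ℝ) ≤ C * r ^ k₀ * (1 - r)⁻¹ := by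
      have hpos : 0 < 1 - r := by linarith
      rw [ENNReal.ofReal_le_ofReal_iff (by positivity)] at h1
      linarith
    rw [show C * r ^ k₀ * (1 - r)⁻¹ = C / (1 - r) * r ^ k₀ by ring] at h2
    linarith
  · intro k hk x hx
    have hmem : ∀ y ∈ A, ⌊4 ^ k * y⌋ ∈ S k := fun y hy => by
      have := mem_iInter.1 hy.2 (k - k₀)
      rwa [Nat.add_sub_cancel' hk] at this
    set N := nbr 50 k (S k) ⌊4 ^ k * x⌋ with hN
    have hcard : (N.card : ℝ) ≤ C * 2 ^ ((1 - (1 - ε)) * k) :=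
      (hS k).mult _ (hmem x hx) N fun d hd => mem_nbr.1 hd
    refine (measure_mono ?_).trans ((volume_floor_mem_le k N).trans
      (ENNReal.ofReal_le_ofReal ?_))
    · rintro y ⟨hy, h1, h2⟩
      exact mem_nbr.2 ⟨hmem y hy, near_floor h1 h2⟩
    · calc (N.card : ℝ) / 4 ^ k ≤ C * 2 ^ ((1 - (1 - ε)) * k) / 4 ^ k := by gcongr
        _ = C * ((1 / 2 : ℝ) ^ k) ^ (2 - ε) := by
          rw [mul_div_assoc, show (4:ℝ) ^ k = 2 ^ (2 * (k:ℝ)) by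
            rw [rpow_mul (by norm_num), rpow_natCast]; norm_num,
            ← rpow_sub (by norm_num), one_div, inv_pow, ← rpow_natCast, ← rpow_neg (by norm_num),
            ← rpow_mul (by norm_num)]
          congr 2
          ring

lemma complex_repr_wexp (x : ℝ) :
    Complex.orthonormalBasisOneI.repr (wexp x) = cs (2 * π * x) := by
  ext i
  fin_cases i <;> simp [cs, wexp, Complex.orthonormalBasisOneI_repr_apply,
    Complex.exp_ofReal_mul_I_re, Complex.exp_ofReal_mul_I_im, -Complex.ofReal_mul]

lemma complex_repr_Wc (x : ℝ) : Complex.orthonormalBasisOneI.repr (Wc x) = Wfn x := by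
  rw [Wc, Wfn, ← LinearIsometryEquiv.coe_toContinuousLinearEquiv, ContinuousLinearEquiv.map_tsum]
  refine tsum_congr fun n => ?_
  rw [← Complex.real_smul]
  simp only [map_smul, LinearIsometryEquiv.coe_toContinuousLinearEquiv]
  rw [complex_repr_wexp, ← mul_assoc]
  congr 1
  rw [sq2, ← Real.sqrt_inv, Real.sqrt_eq_rpow, ← rpow_natCast, ← rpow_mul (by norm_num),
    Real.inv_rpow (by norm_num), ← rpow_neg (by norm_num)]
  congr 1
  ring

lemma dist_Wfn (x y : ℝ) : dist (Wfn x) (Wfn y) = ‖Wc x - Wc y‖ := by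
  rw [← complex_repr_Wc, ← complex_repr_Wc, LinearIsometryEquiv.dist_map, dist_eq_norm]

lemma continuous_Wfn : Continuous Wfn := by
  simp_rw [← funext complex_repr_Wc]
  exact (LinearIsometryEquiv.continuous _).comp continuous_Wc

lemma le_dimH_graph_Wfn {ε : ℝ} (hε : 0 < ε) (hε1 : ε ≤ 1) :
    ENNReal.ofReal (2 - ε) ≤ dimH {p : ℝ × E2 | ∃ x ∈ Icc (0:ℝ) 1, p = (x, Wfn x)} := by
  obtain ⟨A, hA01, hA0, C, hC, k₀, h⟩ := exists_set_close_pairs hε hε1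
  have h0 := hausdorffMeasure_image_ne_zero (f := fun x => (x, Wfn x))
    (continuous_id.prodMk continuous_Wfn) hA0 hC (by linarith : 0 < 2 - ε) k₀
    fun k hk x hx => by
      simpa only [Prod.dist_eq, sup_le_iff, dist_Wfn, Real.dist_eq] using h k hk x hx
  have h1 : ENNReal.ofReal (2 - ε) ≤ dimH ((fun x => (x, Wfn x)) '' A) := by
    refine le_dimH_of_hausdorffMeasure_ne_zero (d := (2 - ε).toNNReal) ?_
    rwa [Real.coe_toNNReal _ (by linarith)]
  refine h1.trans (dimH_mono ?_)
  rintro _ ⟨x, hx, rfl⟩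
  exact ⟨x, hA01 hx, rfl⟩

/-- The Hausdorff dimension of the graph `{(x, W(x)) : x ∈ [0,1]} ⊆ ℝ × ℝ²`
of the two-dimensional Weierstrass function `W` is at least `2`. -/
theorem hausdorff_dim_graph_weierstrass_ge_two :
    2 ≤ dimH {p : ℝ × E2 | ∃ x ∈ Icc (0:ℝ) 1, p = (x, Wfn x)} := by
  refine le_of_forall_lt fun a ha => ?_
  have hne : a ≠ ⊤ := ha.ne_top
  have ha2 : a.toReal < 2 := by
    simpa using (ENNReal.toReal_lt_toReal hne (by simp)).2 ha
  have ha0 : 0 ≤ a.toReal := ENNReal.toReal_nonneg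
  refine lt_of_lt_of_le ?_ (le_dimH_graph_Wfn (ε := (2 - a.toReal) / 2) (by linarith) (by linarith))
  rw [ENNReal.lt_ofReal_iff_toReal_lt hne]
  linarith

end
end

section
/- Let A ⊂ ℝ, let 0 < α ≤ 1, and let f : A → ℝ^d be α-Hölder continuous, i.e. there is C > 0 with |f(x) − f(y)| ≤ C|x − y|^α for all x, y ∈ A. Then the Hausdorff dimension of the graph {(x, f(x)) : x ∈ A} ⊂ ℝ × ℝ^d is at most 1 + (1 − α)·min(d, 1/α). -/
open Real MeasureTheory Set Filter

noncomputable section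

/-- If for every `n` the set `s` is covered by at most `K * (n + 1) ^ p` sets of diameter at most
`D / (n + 1)`, then the Hausdorff dimension of `s` is at most `p`. -/
theorem dimH_le_of_finite_covers {X : Type*} [EMetricSpace X] {s : Set X} {p K D : ℝ}
    (hp : 0 ≤ p) (hD : 0 ≤ D) {ι : ℕ → Type*} [∀ n, Fintype (ι n)]
    (t : ∀ n, ι n → Set X) (hs : ∀ n, s ⊆ ⋃ i, t n i)
    (hd : ∀ n i, Metric.ediam (t n i) ≤ ENNReal.ofReal (D / (n + 1)))
    (hcard : ∀ n, (Fintype.card (ι n) : ℝ) ≤ K * ((n : ℝ) + 1) ^ p) :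
    dimH s ≤ ENNReal.ofReal p := by
  borelize X
  lift p to NNReal using hp
  rw [ENNReal.ofReal_coe_nnreal]
  refine dimH_le_of_hausdorffMeasure_ne_top (ne_top_of_le_ne_top
    (ENNReal.ofReal_ne_top (r := K * D ^ (p : ℝ))) ?_)
  have hr : Tendsto (fun n : ℕ => ENNReal.ofReal (D / (n + 1))) atTop (nhds 0) := by
    have h := (tendsto_one_div_add_atTop_nhds_zero_nat (𝕜 := ℝ)).const_mul D
    simpa [div_eq_mul_inv] using ENNReal.tendsto_ofReal h
  refine (Measure.hausdorffMeasure_le_liminf_sum (p : ℝ) s _ hr t (.of_forall hd)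
    (.of_forall hs)).trans (liminf_le_of_frequently_le' (Frequently.of_forall fun n => ?_))
  have hn : (0 : ℝ) < (n : ℝ) + 1 := by positivity
  calc ∑ i, Metric.ediam (t n i) ^ (p : ℝ)
      ≤ ∑ _i : ι n, ENNReal.ofReal ((D / (n + 1)) ^ (p : ℝ)) := by
        refine Finset.sum_le_sum fun i _ => ?_
        rw [← ENNReal.ofReal_rpow_of_nonneg (by positivity) p.coe_nonneg]
        exact ENNReal.rpow_le_rpow (hd n i) p.coe_nonneg
    _ = ENNReal.ofReal (Fintype.card (ι n) * (D / (n + 1)) ^ (p : ℝ)) := by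
        rw [ENNReal.ofReal_mul (by positivity)]
        simp
    _ ≤ ENNReal.ofReal (K * D ^ (p : ℝ)) := by
        refine ENNReal.ofReal_le_ofReal ?_
        rw [Real.div_rpow hD hn.le, mul_div_assoc', div_le_iff₀ (by positivity)]
        calc (Fintype.card (ι n) : ℝ) * D ^ (p : ℝ)
            ≤ K * ((n : ℝ) + 1) ^ (p : ℝ) * D ^ (p : ℝ) := by gcongr; exact hcard n
          _ = K * D ^ (p : ℝ) * ((n : ℝ) + 1) ^ (p : ℝ) := by ring

theorem abs_sub_le_inv_of_floor_mul_eq {a b M : ℝ} (hM : 0 < M) (ha : 0 ≤ a) (hb : 0 ≤ b)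
    (h : ⌊a * M⌋₊ = ⌊b * M⌋₊) : |a - b| ≤ 1 / M := by
  have ha' := Nat.floor_le (mul_nonneg ha hM.le)
  have hb' := Nat.floor_le (mul_nonneg hb hM.le)
  have ha'' := Nat.lt_floor_add_one (a * M)
  have hb'' := Nat.lt_floor_add_one (b * M)
  rw [h] at ha' ha''
  rw [le_div_iff₀ hM]
  calc |a - b| * M = |a * M - b * M| := by rw [← sub_mul, abs_mul, abs_of_pos hM]
    _ ≤ 1 := abs_le.2 ⟨by linarith, by linarith⟩

theorem EuclideanSpace.norm_le_card_mul {d : ℕ} {v : EuclideanSpace ℝ (Fin d)} {δ : ℝ}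
    (hδ : 0 ≤ δ) (h : ∀ j, |v j| ≤ δ) : ‖v‖ ≤ d * δ := by
  rw [EuclideanSpace.norm_eq]
  refine Real.sqrt_le_iff.2 ⟨by positivity, ?_⟩
  calc ∑ j, ‖v j‖ ^ 2 ≤ ∑ _j : Fin d, δ ^ 2 := by
        gcongr with j
        exact h j
    _ = d * δ ^ 2 := by simp
    _ ≤ (d * d : ℝ) * δ ^ 2 := by
        gcongr
        exact_mod_cast Nat.le_mul_self d
    _ = (d * δ) ^ 2 := by ring

theorem EuclideanSpace.abs_apply_le_norm {d : ℕ} (v : EuclideanSpace ℝ (Fin d)) (j : Fin d) :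
    |v j| ≤ ‖v‖ :=
  PiLp.norm_apply_le v j

/-- The graph over `A` of an `α`-Hölder function with values in `ℝ^d` has Hausdorff dimension at
most `1 + (1 - α) * d` when `A` lies in an interval of unit length. -/
theorem dimH_graph_le_of_subset_Ico {d : ℕ} {A : Set ℝ} {f : ℝ → EuclideanSpace ℝ (Fin d)}
    {α C m : ℝ} (hα : 0 < α) (hα1 : α ≤ 1) (hC : 0 < C)
    (hf : ∀ x ∈ A, ∀ y ∈ A, ‖f x - f y‖ ≤ C * |x - y| ^ α) (hA : A ⊆ Ico m (m + 1)) :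
    dimH ((fun x => (x, f x)) '' A) ≤ ENNReal.ofReal (1 + (1 - α) * d) := by
  have hc : ∀ n i : ℕ, ∃ c : ℝ, ∀ x ∈ A, ⌊(x - m) * ((n : ℝ) + 1)⌋₊ = i →
      c ∈ A ∧ |x - c| ≤ 1 / ((n : ℝ) + 1) := by
    intro n i
    by_cases h : ∃ c ∈ A, ⌊(c - m) * ((n : ℝ) + 1)⌋₊ = i
    · obtain ⟨c, hcA, rfl⟩ := h
      refine ⟨c, fun x hx hxc => ⟨hcA, ?_⟩⟩
      have := abs_sub_le_inv_of_floor_mul_eq (by positivity) (sub_nonneg.2 (hA hx).1)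
        (sub_nonneg.2 (hA hcA).1) hxc
      rwa [sub_sub_sub_cancel_right] at this
    · exact ⟨0, fun x hx hxi => (h ⟨x, hx, hxi⟩).elim⟩
  choose c hc using hc
  let N : ℕ → ℕ := fun n => ⌊2 * C * ((n : ℝ) + 1) ^ (1 - α)⌋₊
  let g : ℕ → ℕ → ℝ → Fin d → ℝ := fun n i x j =>
    f x j - f (c n i) j + C * ((n : ℝ) + 1) ^ (-α)
  have hg : ∀ n i : ℕ, ∀ x ∈ A, ⌊(x - m) * ((n : ℝ) + 1)⌋₊ = i → ∀ j,
      0 ≤ g n i x j ∧ g n i x j ≤ 2 * C * ((n : ℝ) + 1) ^ (-α) := by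
    intro n i x hx hxi j
    obtain ⟨hcA, hxc⟩ := hc n i x hx hxi
    have h : |f x j - f (c n i) j| ≤ C * ((n : ℝ) + 1) ^ (-α) := by
      calc |f x j - f (c n i) j| ≤ ‖f x - f (c n i)‖ :=
            EuclideanSpace.abs_apply_le_norm (f x - f (c n i)) j
        _ ≤ C * |x - c n i| ^ α := hf x hx _ hcA
        _ ≤ C * (1 / ((n : ℝ) + 1)) ^ α := by gcongr
        _ = C * ((n : ℝ) + 1) ^ (-α) := by
            rw [one_div, Real.inv_rpow (by positivity), Real.rpow_neg (by positivity)]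
    obtain ⟨h₁, h₂⟩ := abs_le.1 h
    constructor <;> simp only [g] <;> linarith
  let t : ∀ n : ℕ, Fin (n + 1) × (Fin d → Fin (N n + 1)) →
      Set (ℝ × EuclideanSpace ℝ (Fin d)) := fun n q =>
    (fun x => (x, f x)) '' {x ∈ A | ⌊(x - m) * ((n : ℝ) + 1)⌋₊ = q.1 ∧
      ∀ j, ⌊g n q.1 x j * ((n : ℝ) + 1)⌋₊ = q.2 j}
  have hp : 0 ≤ 1 + (1 - α) * d := by
    have := mul_nonneg (sub_nonneg.2 hα1) (Nat.cast_nonneg d : (0 : ℝ) ≤ d)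
    linarith
  refine dimH_le_of_finite_covers (K := (2 * C + 1) ^ d) (D := d + 1)
    hp (by positivity) t ?_ ?_ ?_
  · rintro n _ ⟨x, hx, rfl⟩
    have hn : (0 : ℝ) < (n : ℝ) + 1 := by positivity
    have hi : ⌊(x - m) * ((n : ℝ) + 1)⌋₊ < n + 1 := by
      rw [Nat.floor_lt (mul_nonneg (sub_nonneg.2 (hA hx).1) hn.le)]
      push_cast
      nlinarith [(hA hx).2]
    have hk : ∀ j, ⌊g n ⌊(x - m) * ((n : ℝ) + 1)⌋₊ x j * ((n : ℝ) + 1)⌋₊ < N n + 1 := by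
      intro j
      refine Nat.lt_succ_of_le (Nat.floor_le_floor ?_)
      calc g n _ x j * ((n : ℝ) + 1)
          ≤ 2 * C * ((n : ℝ) + 1) ^ (-α) * ((n : ℝ) + 1) := by
            gcongr
            exact (hg n _ x hx rfl j).2
        _ = 2 * C * ((n : ℝ) + 1) ^ (1 - α) := by
            rw [mul_assoc, ← Real.rpow_add_one hn.ne', neg_add_eq_sub]
    exact mem_iUnion.2 ⟨(⟨_, hi⟩, fun j => ⟨_, hk j⟩), x, ⟨hx, rfl, fun j => rfl⟩, rfl⟩
  · rintro n ⟨i, k⟩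
    have hn : (0 : ℝ) < (n : ℝ) + 1 := by positivity
    refine Metric.ediam_le_of_forall_dist_le ?_
    rintro _ ⟨x, ⟨hx, hxi, hxk⟩, rfl⟩ _ ⟨y, ⟨hy, hyi, hyk⟩, rfl⟩
    have h₁ : |x - y| ≤ 1 / ((n : ℝ) + 1) := by
      have := abs_sub_le_inv_of_floor_mul_eq hn (sub_nonneg.2 (hA hx).1)
        (sub_nonneg.2 (hA hy).1) (hxi.trans hyi.symm)
      rwa [sub_sub_sub_cancel_right] at this
    have h₂ : ‖f x - f y‖ ≤ d * (1 / ((n : ℝ) + 1)) := by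
      refine EuclideanSpace.norm_le_card_mul (by positivity) fun j => ?_
      have := abs_sub_le_inv_of_floor_mul_eq hn (hg n i x hx hxi j).1 (hg n i y hy hyi j).1
        ((hxk j).trans (hyk j).symm)
      simpa [g] using this
    have h₃ : (0 : ℝ) < 1 / ((n : ℝ) + 1) := by positivity
    have h₄ : (0 : ℝ) ≤ d * (1 / ((n : ℝ) + 1)) := by positivity
    rw [Prod.dist_eq, Real.dist_eq, dist_eq_norm]
    have h₅ : ((d : ℝ) + 1) / ((n : ℝ) + 1) = d * (1 / ((n : ℝ) + 1)) + 1 / ((n : ℝ) + 1) := by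
      ring
    rw [h₅]
    exact max_le (by linarith) (by linarith)
  · intro n
    have hn : (1 : ℝ) ≤ (n : ℝ) + 1 := by simp
    have hn₀ : (0 : ℝ) < (n : ℝ) + 1 := by positivity
    have hN : ((N n : ℝ) + 1) ≤ (2 * C + 1) * ((n : ℝ) + 1) ^ (1 - α) := by
      have h₁ : (N n : ℝ) ≤ 2 * C * ((n : ℝ) + 1) ^ (1 - α) := Nat.floor_le (by positivity)
      have h₂ := Real.one_le_rpow hn (sub_nonneg.2 hα1)
      linarith
    calc (Fintype.card (Fin (n + 1) × (Fin d → Fin (N n + 1))) : ℝ)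
        = ((n : ℝ) + 1) * ((N n : ℝ) + 1) ^ d := by simp
      _ ≤ ((n : ℝ) + 1) * ((2 * C + 1) * ((n : ℝ) + 1) ^ (1 - α)) ^ d := by gcongr
      _ = (2 * C + 1) ^ d * ((n : ℝ) + 1) ^ (1 + (1 - α) * d) := by
          rw [Real.rpow_add hn₀, Real.rpow_one, Real.rpow_mul hn₀.le, Real.rpow_natCast, mul_pow]
          ring

/-- The graph map of an `α`-Hölder function is `α`-Hölder on sets of diameter at most one, so the
graph has Hausdorff dimension at most `1 / α`. -/
theorem dimH_graph_le_one_div {E : Type*} [NormedAddCommGroup E] {A : Set ℝ} {f : ℝ → E}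
    {α C m : ℝ} (hα : 0 < α) (hα1 : α ≤ 1) (hC : 0 < C)
    (hf : ∀ x ∈ A, ∀ y ∈ A, ‖f x - f y‖ ≤ C * |x - y| ^ α) (hA : A ⊆ Ico m (m + 1)) :
    dimH ((fun x => (x, f x)) '' A) ≤ ENNReal.ofReal (1 / α) := by
  have h : HolderOnWith (max 1 C.toNNReal) α.toNNReal (fun x => (x, f x)) A := by
    intro x hx y hy
    have hK : ((max 1 C.toNNReal : NNReal) : ℝ) = max 1 C := by
      simp [hC.le]
    have hxy : |x - y| ≤ 1 := by
      have h₁ := hA hx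
      have h₂ := hA hy
      rw [abs_le]
      constructor <;> linarith [h₁.1, h₁.2, h₂.1, h₂.2]
    have h₀ : 0 ≤ |x - y| ^ α := by positivity
    rw [edist_dist, edist_dist, Real.coe_toNNReal _ hα.le,
      ENNReal.ofReal_rpow_of_nonneg dist_nonneg hα.le, ← ENNReal.ofReal_coe_nnreal, hK,
      ← ENNReal.ofReal_mul (by positivity)]
    refine ENNReal.ofReal_le_ofReal ?_
    rw [Prod.dist_eq, Real.dist_eq, dist_eq_norm]
    refine max_le ?_ ((hf x hx y hy).trans (by gcongr; exact le_max_right _ _))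
    calc |x - y| = |x - y| ^ (1 : ℝ) := (Real.rpow_one _).symm
      _ ≤ |x - y| ^ α := Real.rpow_le_rpow_of_exponent_ge' (abs_nonneg _) hxy hα.le hα1
      _ ≤ max 1 C * |x - y| ^ α := le_mul_of_one_le_left h₀ (le_max_left _ _)
  calc dimH ((fun x => (x, f x)) '' A) ≤ dimH A / α.toNNReal :=
        h.dimH_image_le (Real.toNNReal_pos.2 hα)
    _ ≤ 1 / α.toNNReal := by
        gcongr
        exact (dimH_mono (subset_univ A)).trans_eq Real.dimH_univ
    _ = ENNReal.ofReal (1 / α) := by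
        rw [ENNReal.ofReal_div_of_pos hα, ENNReal.ofReal_one]
        rfl

/-- An `α`-Hölder continuous function `f : A → ℝ^d`, `A ⊆ ℝ`, `0 < α ≤ 1`, has graph of
Hausdorff dimension at most `1 + (1-α)·min(d, 1/α)`. -/
theorem dimH_graph_of_holder_le (d : ℕ) (A : Set ℝ) (f : ℝ → EuclideanSpace ℝ (Fin d))
    (α C : ℝ) (hα : 0 < α) (hα1 : α ≤ 1) (hC : 0 < C)
    (hf : ∀ x ∈ A, ∀ y ∈ A, ‖f x - f y‖ ≤ C * |x - y| ^ α) :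
    dimH {p : ℝ × EuclideanSpace ℝ (Fin d) | ∃ x ∈ A, p = (x, f x)}
      ≤ ENNReal.ofReal (1 + (1 - α) * min (d : ℝ) (1 / α)) := by
  have hgraph : {p : ℝ × EuclideanSpace ℝ (Fin d) | ∃ x ∈ A, p = (x, f x)} =
      ⋃ m : ℤ, (fun x => (x, f x)) '' (A ∩ Ico (m : ℝ) (m + 1)) := by
    rw [← image_iUnion, ← inter_iUnion, iUnion_Ico_intCast, inter_univ]
    ext p
    simp only [mem_ofPred_eq, mem_image, eq_comm]
  rw [hgraph, dimH_iUnion]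
  refine iSup_le fun m => ?_
  have hf' : ∀ x ∈ A ∩ Ico (m : ℝ) (m + 1), ∀ y ∈ A ∩ Ico (m : ℝ) (m + 1),
      ‖f x - f y‖ ≤ C * |x - y| ^ α := fun x hx y hy => hf x hx.1 y hy.1
  rcases min_choice (d : ℝ) (1 / α) with h | h <;> rw [h]
  · exact dimH_graph_le_of_subset_Ico hα hα1 hC hf' inter_subset_right
  · have hexp : 1 + (1 - α) * (1 / α) = 1 / α := by
      field_simp
      ring
    rw [hexp]
    exact dimH_graph_le_one_div hα hα1 hC hf' inter_subset_right

end
end
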